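/- Assume (H1)-(H3) and (J1)-(J2), let τ>0, β>0, and let φ be a traveling wavefront of the delayed nonlocal dispersion equation with the critical speed c=c*. Suppose the initial data u₀ satisfies u₋≤u₀(s,x)≤u₊ for all (s,x)∈[−τ,0]×ℝⁿ, and that (s,x)↦u₀(s,x)−φ(x₁+c*s) belongs to C([−τ,0]; H^m_w(ℝⁿ)∩L¹_w(ℝⁿ)) with ∂_s(u₀−φ)∈L¹([−τ,0]; H^m_w(ℝⁿ)∩L¹_w(ℝⁿ)) for some m>n/2. Then the solution u of the Cauchy problem uniquely exists and there is C>0 such that sup_{x∈ℝⁿ}|u(t,x)−φ(x₁+c*t)| ≤ C(1+t)^{−n/α} for all t>0. -/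

import Mathlib

open MeasureTheory Real Set Filter Asymptotics

noncomputable section

abbrev Rn (n : ℕ) := EuclideanSpace ℝ (Fin n)

/-- The delayed exponential function `e_τ^{kt}`: it equals `0` for `t < -τ`,
and `∑_{j=0}^{m} k^j (t-(j-1)τ)^j / j!` for `(m-1)τ ≤ t < mτ` (where for
`t ≥ -τ` one has `m = ⌊t/τ⌋ + 1`). -/
noncomputable def delayedExp (τ k t : ℝ) : ℝ :=
  if t < -τ then 0
  else ∑ j ∈ Finset.range (⌊t / τ⌋ + 2).toNat,
      k ^ j * (t - ((j : ℝ) - 1) * τ) ^ j / (Nat.factorial j : ℝ)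

/-- Fourier transform of a real kernel on ℝⁿ: `Ĵ(η) = ∫ e^{-i y·η} J(y) dy`. -/
noncomputable def FT {n : ℕ} (J : Rn n → ℝ) (η : Rn n) : ℂ :=
  ∫ y, Complex.exp (-Complex.I * ((inner ℝ y η : ℝ) : ℂ)) * (J y : ℂ)

/-- The n-dimensional heat kernel `f_β(y) = (4πβ)^{-n/2} e^{-|y|²/(4β)}`. -/
noncomputable def heatKernel (n : ℕ) (β : ℝ) (y : Rn n) : ℝ :=
  (4 * Real.pi * β) ^ (-(n : ℝ) / 2) * Real.exp (-‖y‖ ^ 2 / (4 * β))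

/-- The one-dimensional heat kernel `f_{1β}`. -/
noncomputable def heatKernel1 (β : ℝ) (y : ℝ) : ℝ :=
  (4 * Real.pi * β) ^ (-(1 : ℝ) / 2) * Real.exp (-y ^ 2 / (4 * β))

/-- Partial derivative in the `i`-th coordinate direction. -/
noncomputable def pd {n : ℕ} (i : Fin n) (f : Rn n → ℝ) : Rn n → ℝ :=
  fun x => fderiv ℝ f x (EuclideanSpace.single i 1)

/-- Multi-index partial derivative `∂^j_x`. -/
noncomputable def mpd {n : ℕ} (j : Fin n → ℕ) (f : Rn n → ℝ) : Rn n → ℝ :=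
  ((List.ofFn fun i : Fin n => (pd i)^[j i]).foldr (· ∘ ·) id) f

/-- Square of the (unweighted) Sobolev `H^m` norm:
`∑_{|j| ≤ m} ∫ |∂^j f|²`. -/
noncomputable def HSobSq {n : ℕ} (m : ℕ) (f : Rn n → ℝ) : ℝ :=
  ∑ j ∈ Finset.univ.filter (fun j : Fin n → Fin (m + 1) => (∑ i, (j i : ℕ)) ≤ m),
    ∫ x, (mpd (fun i => (j i : ℕ)) f x) ^ 2

/-- Square of the weighted Sobolev `H^m_w` norm, with a weight depending on the
first coordinate: `∑_{|j| ≤ m} ∫ w(x₁) |∂^j f|²`. -/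
noncomputable def HSobSqW {n : ℕ} [NeZero n] (w : ℝ → ℝ) (m : ℕ) (f : Rn n → ℝ) : ℝ :=
  ∑ j ∈ Finset.univ.filter (fun j : Fin n → Fin (m + 1) => (∑ i, (j i : ℕ)) ≤ m),
    ∫ x, w (x 0) * (mpd (fun i => (j i : ℕ)) f x) ^ 2

/-- The weight function `w(x₁) = e^{-λ*(x₁-x*)}` for `x₁ ≤ x*`, `= 1` for `x₁ > x*`. -/
noncomputable def wgt (lamstar xstar x1 : ℝ) : ℝ :=
  if x1 ≤ xstar then Real.exp (-lamstar * (x1 - xstar)) else 1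



/-- Halving lemma. -/
lemma aux_halve {ι : Type*} (z : ι → ℝ → ℝ) (T M μ : ℝ) (hμ : 0 ≤ μ)
    (hM : ∀ i t, T ≤ t → z i t ≤ M)
    (hstep : ∀ K : ℝ, 0 ≤ K → (∀ i t, T ≤ t → z i t ≤ K * Real.exp (μ * (t - T))) →
      ∀ i t, T ≤ t → z i t ≤ K / 2 * Real.exp (μ * (t - T))) :
    ∀ i t, T ≤ t → z i t ≤ 0 := by
  have key : ∀ k : ℕ, ∀ i t, T ≤ t → z i t ≤ |M| / 2 ^ k * Real.exp (μ * (t - T)) := by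
    intro k
    induction k with
    | zero =>
      intro i t ht
      have h1 : 1 ≤ Real.exp (μ * (t - T)) :=
        Real.one_le_exp (mul_nonneg hμ (by linarith))
      have h2 := hM i t ht
      have h3 := le_abs_self M
      have h4 := abs_nonneg M
      simp only [pow_zero, div_one]
      nlinarith
    | succ k ih =>
      intro i t ht
      have := hstep _ (by positivity) ih i t ht
      rw [pow_succ, ← div_div]
      exact this
  intro i t ht
  have h1 : Tendsto (fun k : ℕ => |M| / 2 ^ k * Real.exp (μ * (t - T))) atTop (nhds 0) := by
    have h2 : Tendsto (fun k : ℕ => (1 / 2 : ℝ) ^ k) atTop (nhds 0) :=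
      tendsto_pow_atTop_nhds_zero_of_lt_one (by norm_num) (by norm_num)
    have h3 := (h2.const_mul |M|).mul_const (Real.exp (μ * (t - T)))
    simp only [mul_zero, zero_mul] at h3
    refine h3.congr (fun k => ?_)
    rw [one_div, inv_pow]; rfl
  exact ge_of_tendsto' h1 (fun k => key k i t ht)

/-- Comparison lemma. -/
lemma aux_cmp {ι : Type*} (z z' : ι → ℝ → ℝ) (T M L : ℝ) (hL : 0 < L)
    (hcont : ∀ i, ContinuousOn (z i) (Ici T))
    (h0 : ∀ i, z i T ≤ 0)
    (hM : ∀ i t, T ≤ t → z i t ≤ M)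
    (hder : ∀ i t, T < t → HasDerivAt (z i) (z' i t) t)
    (hstep : ∀ K : ℝ, 0 ≤ K → ∀ i t, T < t → 0 < z i t →
      (∀ j s, T ≤ s → s ≤ t → z j s ≤ K) → z' i t ≤ L * K) :
    ∀ i t, T ≤ t → z i t ≤ 0 := by
  apply aux_halve z T M (2 * L) (by positivity) hM
  intro K hK hb i t ht
  rcases ht.eq_or_lt with rfl | htT
  · exact (h0 i).trans (by positivity)
  apply le_of_forall_pos_le_add
  intro ε hε
  obtain ⟨η, hη, hηe⟩ : ∃ η > 0, η * Real.exp (2 * L * (t - T)) ≤ ε :=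
    ⟨ε / Real.exp (2 * L * (t - T)), by positivity, by
      rw [div_mul_cancel₀ _ (Real.exp_pos _).ne']⟩
  set B : ℝ → ℝ := fun r => (K / 2 + η) * Real.exp (2 * L * (r - T)) with hB
  have hBpos : ∀ r, 0 < B r := fun r => by positivity
  have hBη : ∀ r, T ≤ r → η ≤ B r := by
    intro r hr
    have h1 : 1 ≤ Real.exp (2 * L * (r - T)) :=
      Real.one_le_exp (mul_nonneg (by positivity) (by linarith))
    have : (K / 2 + η) * 1 ≤ (K / 2 + η) * Real.exp (2 * L * (r - T)) := by gcongr
    simp only [hB]; linarith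
  have hBd : ∀ r, HasDerivAt B (2 * L * B r) r := by
    intro r
    have h1 : HasDerivAt (fun r => 2 * L * (r - T)) (2 * L) r := by
      simpa using ((hasDerivAt_id r).sub_const T).const_mul (2 * L)
    have := (h1.exp).const_mul (K / 2 + η)
    refine this.congr_deriv ?_
    change _ = 2 * L * ((K / 2 + η) * Real.exp (2 * L * (r - T)))
    ring
  -- starting point
  obtain ⟨a, haT, hat, ha⟩ : ∃ a, T < a ∧ a < t ∧ z i a ≤ B a := by
    have hc := (hcont i) T self_mem_Ici
    have h1 : ∀ᶠ r in nhdsWithin T (Ici T), z i r < η :=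
      hc.eventually_lt_const (lt_of_le_of_lt (h0 i) hη)
    have h2 : ∀ᶠ r in nhdsWithin T (Ioi T), z i r < η :=
      h1.filter_mono (nhdsWithin_mono _ Ioi_subset_Ici_self)
    have h3 : ∀ᶠ r in nhdsWithin T (Ioi T), r ∈ Ioo T t := Ioo_mem_nhdsGT htT
    obtain ⟨a, h4, h5⟩ := (h2.and h3).exists
    exact ⟨a, h5.1, h5.2, h4.le.trans (hBη a h5.1.le)⟩
  have := image_le_of_deriv_right_lt_deriv_boundary' (f := z i) (f' := z' i) (a := a) (b := t)
    ((hcont i).mono (fun r hr => haT.le.trans hr.1))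
    (fun r hr => (hder i r (haT.trans_le hr.1)).hasDerivWithinAt) (B := B)
    (B' := fun r => 2 * L * B r) ha
    (fun r _ => (hBd r).continuousAt.continuousWithinAt)
    (fun r _ => (hBd r).hasDerivWithinAt)
    (by
      intro r hr hzr
      have hTr : T < r := haT.trans_le hr.1
      have := hstep (K * Real.exp (2 * L * (r - T))) (by positivity) i r hTr
        (by rw [hzr]; exact hBpos r)
        (by
          intro j s hs hsr
          refine (hb j s hs).trans ?_
          gcongr)
      refine this.trans_lt ?_
      have h2 : 0 < L * η * Real.exp (2 * L * (r - T)) := by positivity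
      simp only [hB]; nlinarith)
    (right_mem_Icc.2 hat.le)
  refine this.trans ?_
  simp only [hB]; linarith

/-- kernel: nonnegative integrable of mass one -/
structure Kern {n : ℕ} (k : Rn n → ℝ) : Prop where
  nn : ∀ y, 0 ≤ k y
  int : Integrable k
  mass : ∫ y, k y = 1

/-- convolution -/
def cv {n : ℕ} (k g : Rn n → ℝ) (x : Rn n) : ℝ := ∫ y, k y * g (x - y)

lemma cv_int {n : ℕ} {k g : Rn n → ℝ} (hk : Integrable k) (hg : Continuous g) {M : ℝ}
    (hM : ∀ x, |g x| ≤ M) (x : Rn n) : Integrable (fun y => k y * g (x - y)) :=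
  hk.mul_bdd (c := M) (hg.comp (by fun_prop)).aestronglyMeasurable
    (Filter.Eventually.of_forall fun y => by simpa using hM (x - y))

lemma cv_cont {n : ℕ} {k : Rn n → ℝ} {g : ℝ → Rn n → ℝ} (hk : Integrable k)
    (hg : Continuous (Function.uncurry g)) {M : ℝ} (hM : ∀ t x, |g t x| ≤ M) :
    Continuous (Function.uncurry fun t x => cv k (g t) x) := by
  unfold cv Function.uncurry
  apply MeasureTheory.continuous_of_dominated (bound := fun y => ‖k y‖ * M)
  · intro p
    refine (cv_int hk (g := g p.1) ?_ (hM p.1) p.2).aestronglyMeasurable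
    exact hg.comp (by fun_prop : Continuous fun x => (p.1, x))
  · intro p
    refine Filter.Eventually.of_forall fun y => ?_
    rw [norm_mul]
    exact mul_le_mul_of_nonneg_left (hM _ _) (norm_nonneg _)
  · exact hk.norm.mul_const M
  · refine Filter.Eventually.of_forall fun y => ?_
    exact continuous_const.mul
      (hg.comp (by fun_prop : Continuous fun p : ℝ × Rn n => (p.1, p.2 - y)))

lemma cv_mono {n : ℕ} {k g h : Rn n → ℝ} (hk : ∀ y, 0 ≤ k y) {x : Rn n}
    (hg : Integrable (fun y => k y * g (x - y))) (hh : Integrable (fun y => k y * h (x - y)))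
    (hgh : ∀ y, g y ≤ h y) : cv k g x ≤ cv k h x :=
  integral_mono hg hh fun y => mul_le_mul_of_nonneg_left (hgh _) (hk y)

lemma cv_const {n : ℕ} {k : Rn n → ℝ} (hk : Kern k) (c : ℝ) (x : Rn n) :
    cv k (fun _ => c) x = c := by
  unfold cv
  rw [integral_mul_const, hk.mass, one_mul]

lemma cv_le {n : ℕ} {k g : Rn n → ℝ} (hk : Kern k) (hg : Continuous g) {M c : ℝ}
    (hM : ∀ x, |g x| ≤ M) (hc : ∀ x, g x ≤ c) (x : Rn n) : cv k g x ≤ c := by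
  rw [← cv_const hk c x]
  exact cv_mono hk.nn (cv_int hk.int hg hM x) (hk.int.mul_const c) hc

lemma le_cv {n : ℕ} {k g : Rn n → ℝ} (hk : Kern k) (hg : Continuous g) {M c : ℝ}
    (hM : ∀ x, |g x| ≤ M) (hc : ∀ x, c ≤ g x) (x : Rn n) : c ≤ cv k g x := by
  rw [← cv_const hk c x]
  exact cv_mono hk.nn (hk.int.mul_const c) (cv_int hk.int hg hM x) hc

lemma cv_sub {n : ℕ} {k g h : Rn n → ℝ} {x : Rn n}
    (hg : Integrable (fun y => k y * g (x - y))) (hh : Integrable (fun y => k y * h (x - y))) :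
    cv k (fun y => g y - h y) x = cv k g x - cv k h x := by
  unfold cv
  rw [← integral_sub hg hh]
  simp only [mul_sub]

lemma cv_add {n : ℕ} {k g h : Rn n → ℝ} {x : Rn n}
    (hg : Integrable (fun y => k y * g (x - y))) (hh : Integrable (fun y => k y * h (x - y))) :
    cv k (fun y => g y + h y) x = cv k g x + cv k h x := by
  unfold cv
  rw [← integral_add hg hh]
  simp only [mul_add]

lemma cv_smul {n : ℕ} {k g : Rn n → ℝ} {x : Rn n} (c : ℝ) :
    cv k (fun y => c * g y) x = c * cv k g x := by
  unfold cv
  rw [← integral_const_mul]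
  congr 1; ext y; ring

lemma cv_abs {n : ℕ} {k g : Rn n → ℝ} (hk : ∀ y, 0 ≤ k y) (x : Rn n) :
    |cv k g x| ≤ cv k (fun y => |g y|) x := by
  unfold cv
  refine (abs_integral_le_integral_abs).trans (le_of_eq ?_)
  congr 1; ext y
  rw [abs_mul, abs_of_nonneg (hk y)]

lemma cv_eq {n : ℕ} {k g : Rn n → ℝ} (x : Rn n) :
    ∫ y, k (x - y) * g y = cv k g x := by
  unfold cv
  rw [← integral_sub_left_eq_self (fun y => k (x - y) * g y) volume x]
  congr 1; ext y; simp

lemma uc_x {n : ℕ} {g : ℝ → Rn n → ℝ} (hg : Continuous (Function.uncurry g)) (t : ℝ) :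
    Continuous (g t) := hg.comp (by fun_prop : Continuous fun x => (t, x))

lemma uc_t {n : ℕ} {g : ℝ → Rn n → ℝ} (hg : Continuous (Function.uncurry g)) (x : Rn n) :
    Continuous (fun t => g t x) := hg.comp (by fun_prop : Continuous fun t => (t, x))

lemma marg_int {n : ℕ} (k : Fin n → ℝ → ℝ) (hk : ∀ i, Integrable (k i)) :
    Integrable (fun y : Rn n => ∏ i, k i (y i)) := by
  rw [← (PiLp.volume_preserving_toLp (Fin n)).integrable_comp_emb
    (MeasurableEquiv.toLp 2 (Fin n → ℝ)).measurableEmbedding]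
  exact Integrable.fintype_prod hk

lemma marg_eq {n : ℕ} (k : Fin n → ℝ → ℝ) :
    ∫ y : Rn n, ∏ i, k i (y i) = ∏ i, ∫ y, k i y := by
  rw [← (PiLp.volume_preserving_toLp (Fin n)).integral_comp
    (MeasurableEquiv.toLp 2 (Fin n → ℝ)).measurableEmbedding]
  exact integral_fintype_prod_volume_eq_prod k

lemma prod_upd {n : ℕ} [NeZero n] (k : Fin n → ℝ → ℝ) (g : ℝ → ℝ) (y : Rn n) :
    (∏ i, k i (y i)) * g (y 0)
      = ∏ i, (Function.update k 0 (fun s => k 0 s * g s)) i (y i) := by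
  rw [← Finset.mul_prod_erase Finset.univ _ (Finset.mem_univ (0 : Fin n)),
    ← Finset.mul_prod_erase Finset.univ (fun i => (Function.update k 0 _) i (y i))
      (Finset.mem_univ (0 : Fin n))]
  have : ∏ i ∈ Finset.univ.erase (0 : Fin n),
      (Function.update k 0 (fun s => k 0 s * g s)) i (y i)
      = ∏ i ∈ Finset.univ.erase (0 : Fin n), k i (y i) := by
    apply Finset.prod_congr rfl
    intro i hi
    rw [Function.update_of_ne (Finset.ne_of_mem_erase hi)]
  rw [this]
  simp; ring

lemma marginal {n : ℕ} [NeZero n] (k : Fin n → ℝ → ℝ) (hk : ∀ i, ∫ y, k i y = 1) (g : ℝ → ℝ) :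
    ∫ y : Rn n, (∏ i, k i (y i)) * g (y 0) = ∫ y, k 0 y * g y := by
  simp only [prod_upd]
  rw [marg_eq, ← Finset.mul_prod_erase Finset.univ _ (Finset.mem_univ (0 : Fin n)),
    Finset.prod_eq_one]
  · simp
  · intro i hi
    rw [Function.update_of_ne (Finset.ne_of_mem_erase hi)]
    exact hk i

lemma marginal_int {n : ℕ} [NeZero n] (k : Fin n → ℝ → ℝ) (hk : ∀ i, Integrable (k i)) (g : ℝ → ℝ)
    (hg : Integrable fun y => k 0 y * g y) :
    Integrable fun y : Rn n => (∏ i, k i (y i)) * g (y 0) := by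
  simp only [prod_upd]
  apply marg_int
  intro i
  by_cases h : i = 0
  · subst h; simpa using hg
  · rw [Function.update_of_ne h]; exact hk i

lemma int_of_mass {f : ℝ → ℝ} (h : ∫ y, f y = 1) : Integrable f := by
  by_contra hc
  rw [integral_undef hc] at h
  norm_num at h

lemma hk1_mass {β : ℝ} (hβ : 0 < β) : ∫ y, heatKernel1 β y = 1 := by
  unfold heatKernel1
  rw [integral_const_mul]
  have h1 : ∀ y : ℝ, Real.exp (-y ^ 2 / (4 * β)) = Real.exp (-(1 / (4 * β)) * y ^ 2) := by
    intro y; congr 1; ring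
  simp only [h1]
  rw [integral_gaussian, show π / (1 / (4 * β)) = 4 * π * β by field_simp, Real.sqrt_eq_rpow,
    ← Real.rpow_add (by positivity)]
  norm_num

lemma hk_prod (n : ℕ) {β : ℝ} (hβ : 0 < β) (y : Rn n) :
    heatKernel n β y = ∏ i, heatKernel1 β (y i) := by
  unfold heatKernel heatKernel1
  rw [Finset.prod_mul_distrib, Finset.prod_const, ← Real.exp_sum, EuclideanSpace.norm_sq_eq]
  congr 1
  · rw [Finset.card_univ, Fintype.card_fin, ← Real.rpow_natCast, ← Real.rpow_mul (by positivity)]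
    congr 1; ring
  · congr 1
    rw [← Finset.sum_div, Finset.sum_neg_distrib]
    simp

lemma hk_pos (n : ℕ) {β : ℝ} (hβ : 0 < β) (y : Rn n) : 0 < heatKernel n β y := by
  unfold heatKernel; positivity

lemma hk_cont (n : ℕ) (β : ℝ) : Continuous (heatKernel n β) := by
  unfold heatKernel; fun_prop

lemma hk_kern (n : ℕ) {β : ℝ} (hβ : 0 < β) : Kern (heatKernel n β) where
  nn y := (hk_pos n hβ y).le
  int := by
    rw [funext (hk_prod n hβ)]
    exact marg_int _ fun i => int_of_mass (hk1_mass hβ)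
  mass := by
    rw [funext (hk_prod n hβ), marg_eq]
    simp [hk1_mass hβ]

lemma hk_le {n : ℕ} [NeZero n] {σ : ℝ} (hσ : 0 < σ) (lam : ℝ) (w : Rn n) :
    heatKernel n σ w * Real.exp (-lam * w 0)
      ≤ (4 * π * σ) ^ (-(n : ℝ) / 2) * Real.exp (lam ^ 2 * σ) := by
  unfold heatKernel
  rw [mul_assoc, ← Real.exp_add]
  gcongr
  have h1 : (w 0) ^ 2 ≤ ‖w‖ ^ 2 := by
    rw [EuclideanSpace.norm_sq_eq]
    have := Finset.single_le_sum (f := fun i => ‖w i‖ ^ 2) (fun i _ => by positivity)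
      (Finset.mem_univ (0 : Fin n))
    simpa using this
  rw [div_add' _ _ _ (by positivity), div_le_iff₀ (by positivity)]
  nlinarith [sq_nonneg (w 0 + 2 * lam * σ)]

lemma hk_bdd {n : ℕ} {σ : ℝ} (hσ : 0 < σ) (w : Rn n) :
    heatKernel n σ w ≤ (4 * π * σ) ^ (-(n : ℝ) / 2) := by
  unfold heatKernel
  have : Real.exp (-‖w‖ ^ 2 / (4 * σ)) ≤ 1 := by
    apply Real.exp_le_one_iff.2
    apply div_nonpos_of_nonpos_of_nonneg <;> [nlinarith [sq_nonneg ‖w‖]; positivity]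
  exact mul_le_of_le_one_right (by positivity) this

lemma hk_zero {n : ℕ} {σ : ℝ} (hσ : 0 < σ) :
    Tendsto (heatKernel n σ) (cocompact (Rn n)) (nhds 0) := by
  unfold heatKernel
  have h1 : Tendsto (fun r : ℝ => Real.exp (-r ^ 2 / (4 * σ))) atTop (nhds 0) := by
    apply Real.tendsto_exp_atBot.comp
    have : Tendsto (fun r : ℝ => r ^ 2 / (4 * σ)) atTop atTop :=
      (tendsto_pow_atTop (by norm_num)).atTop_div_const (by positivity)
    refine (tendsto_neg_atTop_atBot.comp this).congr (fun r => ?_)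
    simp only [Function.comp]; ring
  have h2 := (h1.comp (tendsto_norm_cocompact_atTop (E := Rn n))).const_mul
    ((4 * π * σ) ^ (-(n : ℝ) / 2))
  simpa using h2

lemma hk_conv (n : ℕ) {σ β : ℝ} (hσ : 0 < σ) (hβ : 0 < β) (w : Rn n) :
    cv (heatKernel n σ) (heatKernel n β) w = heatKernel n (σ + β) w := by
  unfold cv heatKernel
  have h1 : ∀ y : Rn n, (4 * π * σ) ^ (-(n : ℝ) / 2) * Real.exp (-‖y‖ ^ 2 / (4 * σ)) *
      ((4 * π * β) ^ (-(n : ℝ) / 2) * Real.exp (-‖w - y‖ ^ 2 / (4 * β)))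
      = ((4 * π * σ) ^ (-(n : ℝ) / 2) * (4 * π * β) ^ (-(n : ℝ) / 2)
        * Real.exp (-‖w‖ ^ 2 / (4 * (σ + β))))
        * Real.exp (-((σ + β) / (4 * σ * β)) * ‖y - (σ / (σ + β)) • w‖ ^ 2) := by
    intro y
    have : Real.exp (-‖y‖ ^ 2 / (4 * σ)) * Real.exp (-‖w - y‖ ^ 2 / (4 * β))
      = Real.exp (-‖w‖ ^ 2 / (4 * (σ + β)))
        * Real.exp (-((σ + β) / (4 * σ * β)) * ‖y - (σ / (σ + β)) • w‖ ^ 2) := by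
      rw [← Real.exp_add, ← Real.exp_add, @norm_sub_sq_real _ _ _ w y,
        @norm_sub_sq_real _ _ _ y, inner_smul_right, norm_smul, mul_pow, real_inner_comm,
        Real.norm_eq_abs, sq_abs]
      congr 1
      field_simp
      ring
    linear_combination ((4 * π * σ) ^ (-(n : ℝ) / 2) * (4 * π * β) ^ (-(n : ℝ) / 2)) * this
  simp only [h1]
  rw [integral_const_mul,
    integral_sub_right_eq_self (fun y : Rn n => Real.exp (-((σ + β) / (4 * σ * β)) * ‖y‖ ^ 2)),
    GaussianFourier.integral_rexp_neg_mul_sq_norm (by positivity)]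
  have h2 : (4 * π * σ) ^ (-(n : ℝ) / 2) * (4 * π * β) ^ (-(n : ℝ) / 2) *
      (π / ((σ + β) / (4 * σ * β))) ^ ((n : ℝ) / 2) = (4 * π * (σ + β)) ^ (-(n : ℝ) / 2) := by
    have e : ∀ a : ℝ, 0 < a → a ^ (-(n : ℝ) / 2) = (a⁻¹) ^ ((n : ℝ) / 2) := by
      intro a ha
      rw [neg_div, Real.rpow_neg ha.le, Real.inv_rpow ha.le]
    rw [e _ (by positivity), e _ (by positivity), e _ (by positivity),
      ← Real.mul_rpow (by positivity) (by positivity), ← Real.mul_rpow (by positivity) (by positivity)]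
    congr 1
    field_simp
    try ring
  rw [← h2]
  simp only [finrank_euclideanSpace, Fintype.card_fin]
  ring

lemma fub_int {n : ℕ} {k l g : Rn n → ℝ} (hk : Integrable k) (hl : Integrable l)
    (hg : Continuous g) {M : ℝ} (hM : ∀ x, |g x| ≤ M) (x : Rn n) :
    Integrable (Function.uncurry fun y w => k y * (l w * g (x - y - w)))
      (volume.prod volume) := by
  have h1 := (hk.mul_prod hl).mul_bdd (c := M) (g := fun p : Rn n × Rn n => g (x - p.1 - p.2))
    (hg.comp (by fun_prop)).aestronglyMeasurable
    (Filter.Eventually.of_forall fun y => by simpa using hM _)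
  refine h1.congr (Filter.Eventually.of_forall fun p => ?_)
  simp only [Function.uncurry]; ring

lemma cv_comm {n : ℕ} {k l g : Rn n → ℝ} (hk : Integrable k) (hl : Integrable l)
    (hg : Continuous g) {M : ℝ} (hM : ∀ x, |g x| ≤ M) (x : Rn n) :
    cv k (cv l g) x = cv l (cv k g) x := by
  unfold cv
  simp only [← integral_const_mul]
  rw [integral_integral_swap (fub_int hk hl hg hM x)]
  congr 1; ext y; congr 1; ext w
  rw [sub_right_comm]; ring

lemma cv_assoc {n : ℕ} {k l g : Rn n → ℝ} (hk : Integrable k) (hl : Integrable l)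
    (hg : Continuous g) {M : ℝ} (hM : ∀ x, |g x| ≤ M) (x : Rn n) :
    cv k (cv l g) x = cv (cv k l) g x := by
  unfold cv
  simp only [← integral_const_mul, ← integral_mul_const]
  have h0 : ∀ y, ∫ w, k y * (l w * g (x - y - w)) = ∫ w, k y * l (w - y) * g (x - w) := by
    intro y
    rw [← integral_sub_right_eq_self (fun w => k y * (l w * g (x - y - w))) y]
    congr 1; ext w
    rw [show x - y - (w - y) = x - w by abel]; ring
  simp only [h0]
  rw [integral_integral_swap]
  have h1 := (fub_int hk hl hg hM x)
  have h2 : MeasurePreserving (fun p : Rn n × Rn n => (p.1, p.2 - p.1))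
      (volume.prod volume) (volume.prod volume) := measurePreserving_prod_sub volume volume
  have h3 := h2.integrable_comp_of_integrable h1
  refine h3.congr (Filter.Eventually.of_forall fun p => ?_)
  simp only [Function.uncurry, Function.comp]
  rw [show x - p.1 - (p.2 - p.1) = x - p.2 by abel]; ring

lemma hk_semi (n : ℕ) {σ β : ℝ} (hσ : 0 < σ) (hβ : 0 < β) {g : Rn n → ℝ}
    (hg : Continuous g) {M : ℝ} (hM : ∀ x, |g x| ≤ M) (x : Rn n) :
    cv (heatKernel n σ) (cv (heatKernel n β) g) x = cv (heatKernel n (σ + β)) g x := by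
  rw [cv_assoc (hk_kern n hσ).int (hk_kern n hβ).int hg hM]
  rw [funext (hk_conv n hσ hβ)]

lemma alpha_ge {n : ℕ} [NeZero n] (J₁ : Fin n → ℝ → ℝ) (J : Rn n → ℝ)
    (hJprod : ∀ x : Rn n, J x = ∏ i, J₁ i (x i))
    (hJeven : ∀ i, ∀ y : ℝ, J₁ i (-y) = J₁ i y)
    (hJpos : ∀ i, ∀ y : ℝ, 0 ≤ J₁ i y)
    (hJunit : ∀ i, (∫ y : ℝ, J₁ i y) = 1)
    (Kcal alpha : ℝ) (hK : 0 < Kcal) (hal : 0 < alpha)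
    (hJ2 : (fun ξ : Rn n => (FT J ξ).re - (1 - Kcal * ‖ξ‖ ^ alpha))
        =o[nhds 0] fun ξ : Rn n => ‖ξ‖ ^ alpha)
    (hJ1exp : ∀ lam > (0 : ℝ), Integrable (fun y : ℝ => J₁ 0 y * Real.exp (-lam * y))) :
    2 ≤ alpha := by
  by_contra hlt
  push Not at hlt
  have hint : ∀ i, Integrable (J₁ i) := fun i => int_of_mass (hJunit i)
  -- second moment
  have e1 := hJ1exp 1 one_pos
  have e2 : Integrable (fun y : ℝ => J₁ 0 y * Real.exp y) := by
    have := e1.comp_neg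
    refine this.congr (Filter.Eventually.of_forall fun y => ?_)
    simp [hJeven]
  have hsq : ∀ y : ℝ, y ^ 2 ≤ 2 * (Real.exp (-1 * y) + Real.exp y) := by
    intro y
    rcases le_total 0 y with h | h
    · have := Real.quadratic_le_exp_of_nonneg h
      have := Real.exp_pos (-1 * y)
      linarith
    · have := Real.quadratic_le_exp_of_nonneg (x := -1 * y) (by linarith)
      have := Real.exp_pos y
      nlinarith
  have m2 : Integrable (fun y : ℝ => J₁ 0 y * y ^ 2) := by
    refine ((e1.add e2).const_mul 2).mono'
      ((hint 0).aestronglyMeasurable.mul (by fun_prop)) (Filter.Eventually.of_forall fun y => ?_)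
    rw [Real.norm_of_nonneg (mul_nonneg (hJpos 0 y) (sq_nonneg y))]
    have := mul_le_mul_of_nonneg_left (hsq y) (hJpos 0 y)
    simp only [Pi.add_apply]; linarith
  set C := ∫ y, J₁ 0 y * y ^ 2 with hC
  -- Fourier transform on the axis
  have hJint : Integrable J := by
    rw [funext hJprod]; exact marg_int _ hint
  have hFT : ∀ r : ℝ, 1 - C * r ^ 2 ≤ (FT J (EuclideanSpace.single 0 r)).re := by
    intro r
    have h1 : (FT J (EuclideanSpace.single 0 r)).re = ∫ y : Rn n, J y * Real.cos (r * y 0) := by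
      unfold FT
      rw [← RCLike.re_eq_complex_re, ← integral_re]
      · congr 1; ext y
        rw [RCLike.re_eq_complex_re, Complex.re_mul_ofReal, EuclideanSpace.inner_single_right,
          mul_comm]
        congr 1
        rw [Complex.exp_re]
        simp
      · refine (hJint.ofReal (𝕜 := ℂ)).bdd_mul (c := 1) (by fun_prop)
          (Filter.Eventually.of_forall fun y => ?_)
        rw [Complex.norm_exp]; simp
    rw [h1]
    simp only [hJprod]
    rw [marginal J₁ hJunit (fun s => Real.cos (r * s)), ← hJunit 0, hC, ← integral_mul_const,
      ← integral_sub (hint 0) (m2.mul_const _)]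
    apply integral_mono ((hint 0).sub (m2.mul_const _))
    · exact (hint 0).mul_bdd (c := 1) (by fun_prop)
        (Filter.Eventually.of_forall fun y => by simpa using Real.abs_cos_le_one _)
    · intro y
      have := Real.one_sub_sq_div_two_le_cos (x := r * y)
      have h2 := mul_le_mul_of_nonneg_left this (hJpos 0 y)
      have h3 : 0 ≤ J₁ 0 y * (r * y) ^ 2 := mul_nonneg (hJpos 0 y) (sq_nonneg _)
      simp only [Pi.sub_apply] 
      nlinarith
  have hlo := hJ2.def (half_pos hK)
  have htd : Tendsto (fun r : ℝ => (EuclideanSpace.single 0 r : Rn n)) (nhdsWithin 0 (Ioi 0)) (nhds 0) := by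
    rw [tendsto_zero_iff_norm_tendsto_zero]
    simp only [PiLp.norm_single]
    have : Tendsto (fun r : ℝ => ‖r‖) (nhds 0) (nhds 0) := tendsto_norm_zero
    exact this.mono_left nhdsWithin_le_nhds
  have h5 := htd.eventually hlo
  have h6 : ∀ᶠ r : ℝ in nhdsWithin 0 (Ioi 0), Kcal / 2 ≤ C * r ^ (2 - alpha) := by
    filter_upwards [h5, self_mem_nhdsWithin] with r hr hr0
    have hr0 : 0 < r := hr0
    have h7 := hFT r
    simp only [PiLp.norm_single, Real.norm_eq_abs, abs_of_pos hr0] at hr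
    have hp : 0 < r ^ alpha := by positivity
    rw [abs_of_pos hp] at hr
    have h8 := (le_abs_self _).trans hr
    have h9 : Kcal / 2 * r ^ alpha ≤ C * r ^ 2 := by nlinarith
    have h10 : r ^ (2 - alpha) * r ^ alpha = r ^ 2 := by
      rw [← Real.rpow_add hr0, sub_add_cancel, Real.rpow_two]
    rw [← h10, ← mul_assoc] at h9
    exact le_of_mul_le_mul_right h9 hp
  have h11 : Tendsto (fun r : ℝ => C * r ^ (2 - alpha)) (nhdsWithin 0 (Ioi 0)) (nhds 0) := by
    have : ContinuousAt (fun r : ℝ => C * r ^ (2 - alpha)) 0 :=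
      continuousAt_const.mul (Real.continuousAt_rpow_const _ _ (Or.inr (by linarith)))
    have h12 := this.tendsto
    rw [Real.zero_rpow (by linarith), mul_zero] at h12
    exact h12.mono_left nhdsWithin_le_nhds
  have := ge_of_tendsto h11 h6
  linarith

/-- structural hypotheses used throughout -/
structure Sys {n : ℕ} (J f : Rn n → ℝ) (d b : ℝ → ℝ) (D B U τ : ℝ) : Prop where
  kJ : Kern J
  kf : Kern f
  D0 : 0 ≤ D
  B0 : 0 ≤ B
  U0 : 0 < U
  τ0 : 0 < τ
  hd : ∀ p r, p ≤ r → 0 ≤ d r - d p ∧ d r - d p ≤ D * (r - p)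
  hb : ∀ p r, p ≤ r → 0 ≤ b r - b p ∧ b r - b p ≤ B * (r - p)
  d0 : d 0 = 0
  b0 : b 0 = 0
  dbU : d U = b U
  dc : Continuous d
  bc : Continuous b

/-- range and continuity -/
structure In {n : ℕ} (U : ℝ) (u : ℝ → Rn n → ℝ) : Prop where
  c : Continuous (Function.uncurry u)
  nn : ∀ t x, 0 ≤ u t x
  le : ∀ t x, u t x ≤ U

lemma In.abs {n : ℕ} {U : ℝ} {u : ℝ → Rn n → ℝ} (h : In U u) (t : ℝ) (x : Rn n) : |u t x| ≤ U := by
  rw [abs_of_nonneg (h.nn t x)]; exact h.le t x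

/-- right-hand side (shifted by `D u`) -/
def rhs {n : ℕ} (J f : Rn n → ℝ) (d b : ℝ → ℝ) (D τ : ℝ) (u : ℝ → Rn n → ℝ) (s : ℝ) (x : Rn n) : ℝ :=
  cv J (u s) x + (D * u s x - d (u s x)) + cv f (fun y => b (u (s - τ) y)) x

/-- Picard map -/
def pic {n : ℕ} (J f : Rn n → ℝ) (d b : ℝ → ℝ) (D τ : ℝ) (u0 : ℝ → Rn n → ℝ)
    (u : ℝ → Rn n → ℝ) (t : ℝ) (x : Rn n) : ℝ :=
  u0 (min t 0) x - u0 0 x + Real.exp (-(1 + D) * max t 0) *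
    (u0 0 x + ∫ s in (0 : ℝ)..(max t 0), Real.exp ((1 + D) * s) * rhs J f d b D τ u s x)

section
variable {n : ℕ} {J f : Rn n → ℝ} {d b : ℝ → ℝ} {D B U τ : ℝ}

lemma Sys.bIn (S : Sys J f d b D B U τ) {u : ℝ → Rn n → ℝ} (hu : In U u) :
    In (b U) (fun t x => b (u (t - τ) x)) where
  c := S.bc.comp (hu.c.comp (by fun_prop : Continuous fun p : ℝ × Rn n => (p.1 - τ, p.2)))
  nn t x := by have := (S.hb 0 _ (hu.nn (t - τ) x)).1; rw [S.b0] at this; linarith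
  le t x := by have := (S.hb _ _ (hu.le (t - τ) x)).1; linarith

lemma Sys.rhs_cont (S : Sys J f d b D B U τ) {u : ℝ → Rn n → ℝ} (hu : In U u) :
    Continuous (Function.uncurry (rhs J f d b D τ u)) := by
  have h1 := cv_cont S.kJ.int hu.c hu.abs
  have h2 := cv_cont S.kf.int (S.bIn hu).c (S.bIn hu).abs
  have h3 : Continuous (fun p : ℝ × Rn n => D * u p.1 p.2 - d (u p.1 p.2)) :=
    (continuous_const.mul hu.c).sub (S.dc.comp hu.c)
  exact (h1.add h3).add h2

lemma Sys.rhs_nn (S : Sys J f d b D B U τ) {u : ℝ → Rn n → ℝ} (hu : In U u) (s : ℝ) (x : Rn n) :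
    cv f (fun y => b (u (s - τ) y)) x ≤ rhs J f d b D τ u s x ∧ 0 ≤ rhs J f d b D τ u s x := by
  have h1 := le_cv S.kJ (uc_x hu.c s) (hu.abs s) (hu.nn s) x
  have h2 := le_cv S.kf (uc_x (S.bIn hu).c s) ((S.bIn hu).abs s) ((S.bIn hu).nn s) x
  have h3 := (S.hd 0 _ (hu.nn s x)).2
  rw [S.d0] at h3
  unfold rhs
  constructor <;> linarith

lemma Sys.rhs_le (S : Sys J f d b D B U τ) {u : ℝ → Rn n → ℝ} (hu : In U u) (s : ℝ) (x : Rn n) :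
    rhs J f d b D τ u s x ≤ (1 + D) * U := by
  have h1 := cv_le S.kJ (uc_x hu.c s) (hu.abs s) (hu.le s) x
  have h2 := cv_le S.kf (uc_x (S.bIn hu).c s) ((S.bIn hu).abs s) ((S.bIn hu).le s) x
  have h3 := (S.hd _ _ (hu.le s x)).2
  have := S.dbU
  unfold rhs
  nlinarith

lemma exp_prim {a : ℝ} (ha : a ≠ 0) (c t0 t : ℝ) :
    ∫ s in t0..t, c * Real.exp (a * s) = c / a * (Real.exp (a * t) - Real.exp (a * t0)) := by
  rw [intervalIntegral.integral_const_mul, intervalIntegral.integral_comp_mul_left _ ha,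
    integral_exp, smul_eq_mul]
  ring

lemma Sys.pic_In (S : Sys J f d b D B U τ) {u0 u : ℝ → Rn n → ℝ} (h0 : In U u0) (hu : In U u) :
    In U (pic J f d b D τ u0 u) := by
  have hc : Continuous (Function.uncurry fun (x : Rn n) (s : ℝ) =>
      Real.exp ((1 + D) * s) * rhs J f d b D τ u s x) := by
    have := (S.rhs_cont hu).comp (continuous_swap (X := Rn n) (Y := ℝ))
    exact (by fun_prop : Continuous fun p : Rn n × ℝ => Real.exp ((1 + D) * p.2)).mul this
  have hci : ∀ x a c, IntervalIntegrable (fun s => Real.exp ((1 + D) * s) * rhs J f d b D τ u s x)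
      volume a c := fun x a c =>
    (hc.comp (by fun_prop : Continuous fun s : ℝ => (x, s))).intervalIntegrable a c
  have hD := S.D0
  refine ⟨?_, ?_, ?_⟩
  · have h1 : Continuous fun p : ℝ × Rn n => u0 (min p.1 0) p.2 :=
      h0.c.comp (by fun_prop : Continuous fun p : ℝ × Rn n => (min p.1 0, p.2))
    have h2 : Continuous fun p : ℝ × Rn n => u0 0 p.2 :=
      h0.c.comp (by fun_prop : Continuous fun p : ℝ × Rn n => ((0 : ℝ), p.2))
    have h3 : Continuous fun p : ℝ × Rn n => ∫ s in (0 : ℝ)..(max p.1 0),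
        Real.exp ((1 + D) * s) * rhs J f d b D τ u s p.2 := by
      apply intervalIntegral.continuous_parametric_intervalIntegral_of_continuous
        (f := fun (p : ℝ × Rn n) s => Real.exp ((1 + D) * s) * rhs J f d b D τ u s p.2)
      · exact hc.comp (by fun_prop : Continuous fun q : (ℝ × Rn n) × ℝ => (q.1.2, q.2))
      · fun_prop
    exact (h1.sub h2).add ((by fun_prop : Continuous fun p : ℝ × Rn n =>
      Real.exp (-(1 + D) * max p.1 0)).mul (h2.add h3))
  · intro t x
    unfold pic
    rcases le_total t 0 with ht | ht
    · simp [ht]; exact h0.nn t x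
    · rw [max_eq_left ht, min_eq_right ht, sub_self, zero_add]
      have : 0 ≤ ∫ s in (0 : ℝ)..t, Real.exp ((1 + D) * s) * rhs J f d b D τ u s x :=
        intervalIntegral.integral_nonneg ht fun s _ =>
          mul_nonneg (Real.exp_pos _).le (S.rhs_nn hu s x).2
      have := h0.nn 0 x
      positivity
  · intro t x
    unfold pic
    rcases le_total t 0 with ht | ht
    · simp [ht]; exact h0.le t x
    · rw [max_eq_left ht, min_eq_right ht, sub_self, zero_add]
      have h1 : ∫ s in (0 : ℝ)..t, Real.exp ((1 + D) * s) * rhs J f d b D τ u s x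
          ≤ ∫ s in (0 : ℝ)..t, ((1 + D) * U) * Real.exp ((1 + D) * s) := by
        apply intervalIntegral.integral_mono_on ht (hci x _ _)
          ((by fun_prop : Continuous fun s : ℝ => ((1 + D) * U) * Real.exp ((1 + D) * s)).intervalIntegrable _ _)
        intro s _
        rw [mul_comm]
        exact mul_le_mul_of_nonneg_right (S.rhs_le hu s x) (Real.exp_pos _).le
      have h1' : (1 + D) * U / (1 + D) = U := by field_simp
      rw [exp_prim (by positivity), h1', mul_zero, Real.exp_zero] at h1
      have h2 := h0.le 0 x
      have h3 : Real.exp (-(1 + D) * t) * (u0 0 x +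
          ∫ s in (0 : ℝ)..t, Real.exp ((1 + D) * s) * rhs J f d b D τ u s x)
          ≤ Real.exp (-(1 + D) * t) * (U * Real.exp ((1 + D) * t)) := by
        gcongr; linarith
      refine h3.trans (le_of_eq ?_)
      rw [mul_left_comm, ← Real.exp_add, show -(1 + D) * t + (1 + D) * t = 0 by ring]; simp

lemma Sys.b_abs (S : Sys J f d b D B U τ) (p r : ℝ) : |b p - b r| ≤ B * |p - r| := by
  rcases le_total p r with h | h
  · have := S.hb _ _ h
    rw [abs_of_nonpos (by linarith), abs_of_nonpos (by linarith)]; linarith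
  · have := S.hb _ _ h
    rw [abs_of_nonneg (by linarith), abs_of_nonneg (by linarith)]; linarith

lemma Sys.d_abs (S : Sys J f d b D B U τ) (p r : ℝ) :
    |(D * p - d p) - (D * r - d r)| ≤ D * |p - r| := by
  rcases le_total p r with h | h
  · have := S.hd _ _ h
    rw [abs_of_nonpos (a := p - r) (by linarith), abs_le]; constructor <;> nlinarith
  · have := S.hd _ _ h
    rw [abs_of_nonneg (a := p - r) (by linarith), abs_le]; constructor <;> nlinarith

lemma Sys.rhs_diff (S : Sys J f d b D B U τ) {u v : ℝ → Rn n → ℝ} (hu : In U u) (hv : In U v)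
    (K : ℝ) (s : ℝ) (h1 : ∀ x, |u s x - v s x| ≤ K) (h2 : ∀ x, |u (s - τ) x - v (s - τ) x| ≤ K)
    (x : Rn n) :
    |rhs J f d b D τ u s x - rhs J f d b D τ v s x| ≤ (1 + D + B) * K := by
  have hD := S.D0
  have hB := S.B0
  have e1 : |cv J (u s) x - cv J (v s) x| ≤ K := by
    rw [← cv_sub (cv_int S.kJ.int (uc_x hu.c s) (hu.abs s) x)
      (cv_int S.kJ.int (uc_x hv.c s) (hv.abs s) x)]
    refine (cv_abs S.kJ.nn x).trans ?_
    have hc : Continuous fun y => |u s y - v s y| := ((uc_x hu.c s).sub (uc_x hv.c s)).abs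
    exact cv_le S.kJ hc (M := K) (fun y => by rw [abs_abs]; exact h1 y) h1 x
  have e2 : |cv f (fun y => b (u (s - τ) y)) x - cv f (fun y => b (v (s - τ) y)) x| ≤ B * K := by
    rw [← cv_sub (cv_int S.kf.int (uc_x (S.bIn hu).c s) ((S.bIn hu).abs s) x)
      (cv_int S.kf.int (uc_x (S.bIn hv).c s) ((S.bIn hv).abs s) x)]
    refine (cv_abs S.kf.nn x).trans ?_
    have hc : Continuous fun y => |b (u (s - τ) y) - b (v (s - τ) y)| :=
      ((uc_x (S.bIn hu).c s).sub (uc_x (S.bIn hv).c s)).abs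
    have hle : ∀ y, |b (u (s - τ) y) - b (v (s - τ) y)| ≤ B * K := fun y =>
      (S.b_abs _ _).trans (mul_le_mul_of_nonneg_left (h2 y) hB)
    exact cv_le S.kf hc (M := B * K) (fun y => by rw [abs_abs]; exact hle y) hle x
  have e3 : |(D * u s x - d (u s x)) - (D * v s x - d (v s x))| ≤ D * K :=
    (S.d_abs _ _).trans (mul_le_mul_of_nonneg_left (h1 x) hD)
  unfold rhs
  rw [abs_le] at *
  constructor <;> linarith [e1.1, e1.2, e2.1, e2.2, e3.1, e3.2]

lemma Sys.pic_diff (S : Sys J f d b D B U τ) {u0 u v : ℝ → Rn n → ℝ} (hu : In U u) (hv : In U v)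
    (K : ℝ) (hK : 0 ≤ K)
    (h : ∀ t x, |u t x - v t x| ≤ K * Real.exp (2 * (1 + D + B) * max t 0)) (t : ℝ) (x : Rn n) :
    |pic J f d b D τ u0 u t x - pic J f d b D τ u0 v t x|
      ≤ K / 2 * Real.exp (2 * (1 + D + B) * max t 0) := by
  have hD := S.D0
  have hB := S.B0
  have hτ := S.τ0
  set L := 1 + D + B with hL
  have hLp : 0 < L := by positivity
  set T := max t 0 with hT
  have hT0 : 0 ≤ T := le_max_right _ _
  have hci : ∀ {w : ℝ → Rn n → ℝ}, In U w →
      IntervalIntegrable (fun s => Real.exp ((1 + D) * s) * rhs J f d b D τ w s x) volume 0 T :=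
    fun {w} hw => ((by fun_prop : Continuous fun s : ℝ => Real.exp ((1 + D) * s)).mul
      (uc_t (S.rhs_cont hw) x)).intervalIntegrable _ _
  have e : pic J f d b D τ u0 u t x - pic J f d b D τ u0 v t x =
      Real.exp (-(1 + D) * T) * ∫ s in (0 : ℝ)..T, (Real.exp ((1 + D) * s) * rhs J f d b D τ u s x
        - Real.exp ((1 + D) * s) * rhs J f d b D τ v s x) := by
    rw [intervalIntegral.integral_sub (hci hu) (hci hv)]
    unfold pic
    rw [← hT]; ring
  rw [e, abs_mul, abs_of_pos (Real.exp_pos _)]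
  have h1 : |∫ s in (0 : ℝ)..T, (Real.exp ((1 + D) * s) * rhs J f d b D τ u s x
        - Real.exp ((1 + D) * s) * rhs J f d b D τ v s x)|
      ≤ ∫ s in (0 : ℝ)..T, (Real.exp ((1 + D) * T) * (L * K)) * Real.exp (2 * L * s) := by
    rw [← Real.norm_eq_abs]
    apply intervalIntegral.norm_integral_le_of_norm_le hT0
    · refine Filter.Eventually.of_forall fun s hs => ?_
      rw [← mul_sub, norm_mul, Real.norm_eq_abs, Real.norm_eq_abs, abs_of_pos (Real.exp_pos _)]
      have h2 := S.rhs_diff hu hv (K * Real.exp (2 * L * s)) s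
        (fun y => by have := h s y; rwa [max_eq_left hs.1.le] at this)
        (fun y => by
          refine (h (s - τ) y).trans ?_
          gcongr
          exact max_le (by linarith) hs.1.le) x
      calc _ ≤ Real.exp ((1 + D) * T) * (L * (K * Real.exp (2 * L * s))) := by
            gcongr
            exact hs.2
        _ = _ := by ring
    · exact (by fun_prop : Continuous fun s : ℝ =>
        (Real.exp ((1 + D) * T) * (L * K)) * Real.exp (2 * L * s)).intervalIntegrable _ _
  rw [exp_prim (by positivity), mul_zero, Real.exp_zero] at h1
  calc _ ≤ Real.exp (-(1 + D) * T) * (Real.exp ((1 + D) * T) * (L * K) / (2 * L) *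
        (Real.exp (2 * L * T) - 1)) := by gcongr
    _ = (Real.exp (-(1 + D) * T) * Real.exp ((1 + D) * T)) * (K / 2 * (Real.exp (2 * L * T) - 1)) := by
        field_simp
    _ = K / 2 * (Real.exp (2 * L * T) - 1) := by
        rw [← Real.exp_add, show -(1 + D) * T + (1 + D) * T = 0 by ring]; simp
    _ ≤ _ := by nlinarith

lemma Sys.exist (S : Sys J f d b D B U τ) {u0 : ℝ → Rn n → ℝ} (h0 : In U u0) :
    ∃ u : ℝ → Rn n → ℝ, In U u ∧ (∀ t ≤ 0, ∀ x, u t x = u0 t x) ∧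
      ∀ t > 0, ∀ x, HasDerivAt (fun t => u t x)
        (cv J (u t) x - u t x - d (u t x) + cv f (fun y => b (u (t - τ) y)) x) t := by
  have hD := S.D0
  have hB := S.B0
  have hU := S.U0
  set L := 1 + D + B with hL
  set P := pic J f d b D τ u0 with hP
  set q : ℕ → ℝ → Rn n → ℝ := fun k => P^[k] u0 with hq
  have hqs : ∀ k, q (k + 1) = P (q k) := fun k => Function.iterate_succ_apply' P k u0
  have hqIn : ∀ k, In U (q k) := by
    intro k
    induction k with
    | zero => exact h0
    | succ k ih => rw [hqs]; exact S.pic_In h0 ih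
  have hdiff : ∀ k t x, |q k t x - q (k + 1) t x| ≤ U / 2 ^ k * Real.exp (2 * L * max t 0) := by
    intro k
    induction k with
    | zero =>
      intro t x
      have h1 : (1 : ℝ) ≤ Real.exp (2 * L * max t 0) := Real.one_le_exp (by positivity)
      have h2 : |q 0 t x - q 1 t x| ≤ U := by
        rw [abs_le]
        constructor <;> linarith [(hqIn 0).nn t x, (hqIn 0).le t x, (hqIn 1).nn t x, (hqIn 1).le t x]
      simp only [pow_zero, div_one, zero_add]
      nlinarith
    | succ k ih =>
      intro t x
      have := S.pic_diff (u0 := u0) (hqIn k) (hqIn (k + 1)) (U / 2 ^ k) (by positivity) ih t x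
      rw [hqs (k + 1), hqs k, pow_succ, ← div_div]
      rw [hqs k] at this
      exact this
  have hgeo : ∀ t x, ∀ k, dist (q k t x) (q (k + 1) t x)
      ≤ (2 * U * Real.exp (2 * L * max t 0)) / 2 / 2 ^ k := by
    intro t x k
    rw [Real.dist_eq]
    refine (hdiff k t x).trans (le_of_eq ?_)
    field_simp
  have hlim : ∀ t x, ∃ a, Tendsto (fun k => q k t x) atTop (nhds a) := fun t x =>
    cauchySeq_tendsto_of_complete (cauchySeq_of_le_geometric_two (hgeo t x))
  choose u hu using hlim
  have hrate : ∀ k t x, |q k t x - u t x| ≤ 2 * U / 2 ^ k * Real.exp (2 * L * max t 0) := by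
    intro k t x
    have := dist_le_of_le_geometric_two_of_tendsto (hgeo t x) (hu t x) k
    rw [Real.dist_eq] at this
    refine this.trans (le_of_eq ?_)
    ring
  have h2k : ∀ c : ℝ, Tendsto (fun k : ℕ => 2 * U / 2 ^ k * c) atTop (nhds 0) := by
    intro c
    have h2 : Tendsto (fun k : ℕ => (1 / 2 : ℝ) ^ k) atTop (nhds 0) :=
      tendsto_pow_atTop_nhds_zero_of_lt_one (by norm_num) (by norm_num)
    have h3 := (h2.const_mul (2 * U)).mul_const c
    simp only [mul_zero, zero_mul] at h3
    refine h3.congr (fun k => ?_)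
    rw [one_div, inv_pow]; rfl
  have huIn : In U u := by
    refine ⟨?_, fun t x => ge_of_tendsto' (hu t x) fun k => (hqIn k).nn t x,
      fun t x => le_of_tendsto' (hu t x) fun k => (hqIn k).le t x⟩
    have : TendstoLocallyUniformly (fun k => Function.uncurry (q k)) (Function.uncurry u) atTop := by
      rw [Metric.tendstoLocallyUniformly_iff]
      intro ε hε p
      refine ⟨{p' | p'.1 < p.1 + 1}, (isOpen_lt continuous_fst continuous_const).mem_nhds
        (by simp), ?_⟩
      have h4 := (h2k (Real.exp (2 * L * max (p.1 + 1) 0))).eventually_lt_const hε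
      filter_upwards [h4] with k hk p' hp'
      have hp'' : p'.1 < p.1 + 1 := hp'
      rw [dist_comm, Real.dist_eq]
      refine lt_of_le_of_lt ((hrate k p'.1 p'.2).trans ?_) hk
      gcongr
    exact this.continuous (Filter.Frequently.of_forall fun k => (hqIn k).c)
  have hfix : ∀ t x, u t x = P u t x := by
    intro t x
    refine tendsto_nhds_unique ((tendsto_add_atTop_iff_nat 1).2 (hu t x)) ?_
    rw [tendsto_iff_dist_tendsto_zero]
    refine squeeze_zero (fun k => dist_nonneg) (fun k => ?_) (h2k (1 / 2 * Real.exp (2 * L * max t 0)))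
    rw [hqs, Real.dist_eq]
    have := S.pic_diff (u0 := u0) (hqIn k) huIn (2 * U / 2 ^ k) (by positivity) (hrate k) t x
    refine this.trans (le_of_eq ?_)
    ring
  refine ⟨u, huIn, ?_, ?_⟩
  · intro t ht x
    rw [hfix, hP]
    unfold pic
    simp [ht]
  · intro t ht x
    have hE : ∀ r > 0, u r x = Real.exp (-(1 + D) * r) *
        (u0 0 x + ∫ s in (0 : ℝ)..r, Real.exp ((1 + D) * s) * rhs J f d b D τ u s x) := by
      intro r hr
      rw [hfix, hP]
      unfold pic
      rw [max_eq_left hr.le, min_eq_right hr.le, sub_self, zero_add]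
    have hcont : Continuous fun s => Real.exp ((1 + D) * s) * rhs J f d b D τ u s x :=
      (by fun_prop : Continuous fun s : ℝ => Real.exp ((1 + D) * s)).mul
        (uc_t (S.rhs_cont huIn) x)
    have h1 : HasDerivAt (fun r => u0 0 x + ∫ s in (0 : ℝ)..r, Real.exp ((1 + D) * s) *
        rhs J f d b D τ u s x) (Real.exp ((1 + D) * t) * rhs J f d b D τ u t x) t :=
      (hcont.integral_hasStrictDerivAt 0 t).hasDerivAt.const_add _
    have h2 : HasDerivAt (fun r : ℝ => Real.exp (-(1 + D) * r))
        (Real.exp (-(1 + D) * t) * (-(1 + D))) t := by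
      have : HasDerivAt (fun r : ℝ => -(1 + D) * r) (-(1 + D)) t := by
        simpa using (hasDerivAt_id t).const_mul (-(1 + D))
      exact this.exp
    have h3 := h2.mul h1
    have h4 := h3.congr_of_eventuallyEq (f₁ := fun r => u r x)
      (Filter.eventually_of_mem (Ioi_mem_nhds ht) (fun r hr => hE r hr))
    refine h4.congr_deriv ?_
    have h5 : Real.exp (-(1 + D) * t) * Real.exp ((1 + D) * t) = 1 := by
      rw [← Real.exp_add, show -(1 + D) * t + (1 + D) * t = 0 by ring]; simp
    have h6 := hE t ht
    have h7 : rhs J f d b D τ u t x = cv J (u t) x + (D * u t x - d (u t x))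
      + cv f (fun y => b (u (t - τ) y)) x := rfl
    linear_combination (1 + D) * h6 + rhs J f d b D τ u t x * h5 + h7
end

/-- solutions for positive time -/
structure Sol {n : ℕ} (J f : Rn n → ℝ) (d b : ℝ → ℝ) (U τ : ℝ) (u : ℝ → Rn n → ℝ) : Prop where
  i : In U u
  e : ∀ t > 0, ∀ x, HasDerivAt (fun t => u t x)
    (cv J (u t) x - u t x - d (u t x) + cv f (fun y => b (u (t - τ) y)) x) t

section
variable {n : ℕ} {J f : Rn n → ℝ} {d b : ℝ → ℝ} {D B U τ : ℝ}

lemma Sys.comparison (S : Sys J f d b D B U τ) {u u' : ℝ → Rn n → ℝ} (hu : Sol J f d b U τ u)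
    (hu' : Sol J f d b U τ u') (h : ∀ t ∈ Icc (-τ) 0, ∀ x, u t x ≤ u' t x) :
    ∀ t ≥ -τ, ∀ x, u t x ≤ u' t x := by
  have key := aux_cmp (fun (x : Rn n) t => u t x - u' t x)
    (fun x t => (cv J (u t) x - u t x - d (u t x) + cv f (fun y => b (u (t - τ) y)) x) -
      (cv J (u' t) x - u' t x - d (u' t x) + cv f (fun y => b (u' (t - τ) y)) x)) 0 U (1 + B)
    (by have := S.B0; linarith)
    (fun x => ((uc_t hu.i.c x).sub (uc_t hu'.i.c x)).continuousOn)
    (fun x => by have := h 0 ⟨by linarith [S.τ0], le_rfl⟩ x; simpa using this)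
    (fun x t _ => by have := hu.i.le t x; have := hu'.i.nn t x; linarith)
    (fun x t ht => (hu.e t ht x).sub (hu'.e t ht x))
    (by
      intro K hK x t ht hz hs

      have h1 : cv J (u t) x - cv J (u' t) x ≤ K := by
        rw [← cv_sub (cv_int S.kJ.int (uc_x hu.i.c t) (hu.i.abs t) x)
          (cv_int S.kJ.int (uc_x hu'.i.c t) (hu'.i.abs t) x)]
        refine cv_le S.kJ ((uc_x hu.i.c t).sub (uc_x hu'.i.c t)) (M := U + U) (fun y => ?_) (fun y => hs y t ht.le le_rfl) x
        exact (abs_sub _ _).trans (add_le_add (hu.i.abs t y) (hu'.i.abs t y))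
      have h2 : cv f (fun y => b (u (t - τ) y)) x - cv f (fun y => b (u' (t - τ) y)) x ≤ B * K := by
        have i1 := S.bIn hu.i
        have i2 := S.bIn hu'.i
        rw [← cv_sub (cv_int S.kf.int (uc_x i1.c t) (i1.abs t) x)
          (cv_int S.kf.int (uc_x i2.c t) (i2.abs t) x)]
        refine cv_le S.kf ((uc_x i1.c t).sub (uc_x i2.c t)) (M := b U + b U) (fun y => ?_) (fun y => ?_) x
        · exact (abs_sub _ _).trans (add_le_add (i1.abs t y) (i2.abs t y))
        · rcases le_total (u (t - τ) y) (u' (t - τ) y) with hle | hle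
          · have := (S.hb _ _ hle).1
            have := mul_nonneg S.B0 hK
            change b (u (t - τ) y) - b (u' (t - τ) y) ≤ _
            linarith
          · have h3 := (S.hb _ _ hle).2
            refine h3.trans (mul_le_mul_of_nonneg_left ?_ S.B0)
            rcases le_total 0 (t - τ) with h4 | h4
            · exact hs y _ h4 (by linarith [S.τ0])
            · have := h (t - τ) ⟨by linarith, h4⟩ y
              linarith
      have h3 := (S.hd (u' t x) (u t x) (by linarith)).1
      linarith)
  intro t ht x
  rcases le_total t 0 with h0 | h0
  · exact h t ⟨ht, h0⟩ x
  · have := key x t h0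
    linarith

lemma Sys.uniq (S : Sys J f d b D B U τ) {u u' : ℝ → Rn n → ℝ} (hu : Sol J f d b U τ u)
    (hu' : Sol J f d b U τ u') (h : ∀ t ∈ Icc (-τ) 0, ∀ x, u t x = u' t x) :
    ∀ t ≥ -τ, ∀ x, u t x = u' t x := fun t ht x =>
  le_antisymm (S.comparison hu hu' (fun t ht x => (h t ht x).le) t ht x)
    (S.comparison hu' hu (fun t ht x => (h t ht x).ge) t ht x)

end

lemma wL1 {n : ℕ} {v vs : ℝ → Rn n → ℝ} {τ : ℝ} (hτ : 0 < τ) {w : Rn n → ℝ} (hwm : Measurable w)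
    (hw : ∀ x, 0 < w x)
    (hc : ContinuousOn (fun p : ℝ × Rn n => v p.1 p.2) (Icc (-τ) 0 ×ˢ univ))
    (hder : ∀ s ∈ Icc (-τ) 0, ∀ x, HasDerivAt (fun s => v s x) (vs s x) s)
    (h0 : Integrable fun x => w x * |v 0 x|)
    (hs : ∀ s ∈ Icc (-τ) 0, Integrable fun x => w x * |vs s x|)
    {h : ℝ → ℝ} (hh : ∀ s, 0 ≤ h s)
    (hI : IntegrableOn (fun s => (∫ x, w x * |vs s x|) + h s) (Icc (-τ) 0)) :
    ∃ M : ℝ, ∀ s ∈ Icc (-τ) 0, (Integrable fun x => w x * |v s x|) → ∫ x, w x * |v s x| ≤ M := by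
  set vt : Rn n → ℝ → ℝ := fun x r => v (max (-τ) (min r 0)) x with hvt
  have hvtc : Continuous (Function.uncurry vt) := by
    have : Continuous fun p : Rn n × ℝ => (max (-τ) (min p.2 0), p.1) := by fun_prop
    exact hc.comp_continuous this fun p => ⟨⟨le_max_left _ _, max_le (by linarith) (min_le_right _ _)⟩, mem_univ _⟩
  have hmeas : Measurable fun p : Rn n × ℝ => deriv (vt p.1) p.2 := measurable_deriv_with_param hvtc
  have hdeq : ∀ x, ∀ r ∈ Ioo (-τ) 0, deriv (vt x) r = vs r x := by
    intro x r hr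
    refine ((hder r ⟨hr.1.le, hr.2.le⟩ x).congr_of_eventuallyEq ?_).deriv
    filter_upwards [Ioo_mem_nhds hr.1 hr.2] with q hq
    simp only [hvt]
    rw [min_eq_left hq.2.le, max_eq_right hq.1.le]
  set μ := volume.restrict (Ioo (-τ) 0) with hμ
  set F : Rn n → ℝ → ENNReal := fun x r => ENNReal.ofReal (w x * |deriv (vt x) r|) with hF
  have hFm : Measurable (Function.uncurry F) := by
    apply Measurable.ennreal_ofReal
    exact (hwm.comp measurable_fst).mul (hmeas.abs)
  set R := ∫⁻ x, ∫⁻ r, F x r ∂μ with hR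
  have hRfin : R ≠ ⊤ := by
    rw [hR, lintegral_lintegral_swap hFm.aemeasurable]
    have h1 : ∫⁻ r, (∫⁻ x, F x r) ∂μ ≤ ∫⁻ r, ENNReal.ofReal ((∫ x, w x * |vs r x|) + h r) ∂μ := by
      refine setLIntegral_mono_ae' measurableSet_Ioo (Eventually.of_forall fun r hr => ?_)
      have h2 : ∫⁻ x, F x r = ENNReal.ofReal (∫ x, w x * |vs r x|) := by
        rw [ofReal_integral_eq_lintegral_ofReal (hs r ⟨hr.1.le, hr.2.le⟩)
          (Eventually.of_forall fun x => mul_nonneg (hw x).le (abs_nonneg _))]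
        simp only [hF, hdeq _ r hr]
      rw [h2]
      exact ENNReal.ofReal_le_ofReal (by linarith [hh r])
    have h3 : IntegrableOn (fun s => (∫ x, w x * |vs s x|) + h s) (Ioo (-τ) 0) :=
      hI.mono_set Ioo_subset_Icc_self
    exact ne_top_of_le_ne_top (Integrable.lintegral_lt_top h3).ne h1
  set A := ∫⁻ x, ENNReal.ofReal (w x * |v 0 x|) with hA
  have hAfin : A ≠ ⊤ := h0.lintegral_lt_top.ne
  refine ⟨(A + R).toReal, fun s hsI hint => ?_⟩
  rw [integral_eq_lintegral_of_nonneg_ae (Eventually.of_forall fun x => mul_nonneg (hw x).le (abs_nonneg _)) hint.1]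
  refine ENNReal.toReal_mono (ENNReal.add_ne_top.2 ⟨hAfin, hRfin⟩) ?_
  have hm0 : Measurable fun x => ENNReal.ofReal (w x * |v 0 x|) := by
    have : Continuous fun x => v 0 x := by
      have h := hvtc.comp (by fun_prop : Continuous fun x : Rn n => (x, (0 : ℝ)))
      refine h.congr fun x => ?_
      simp [hvt, Function.uncurry, hτ.le]
    exact (hwm.mul this.measurable.abs).ennreal_ofReal
  rw [hA, hR, ← lintegral_add_left hm0]
  refine lintegral_mono fun x => ?_
  have hk : ∫⁻ r, F x r ∂μ = ENNReal.ofReal (w x) * ∫⁻ r, ENNReal.ofReal |deriv (vt x) r| ∂μ := by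
    rw [← lintegral_const_mul']
    · simp only [hF, ENNReal.ofReal_mul (hw x).le]
    · exact ENNReal.ofReal_ne_top
  rw [ENNReal.ofReal_mul (hw x).le, ENNReal.ofReal_mul (hw x).le, hk, ← mul_add]
  refine mul_le_mul_right ?_ _
  by_cases hinf : ∫⁻ r, ENNReal.ofReal |deriv (vt x) r| ∂μ = ⊤
  · rw [hinf]; simp
  have hii : Integrable (fun r => deriv (vt x) r) μ := by
    refine ⟨(measurable_deriv _).aestronglyMeasurable, ?_⟩
    rw [hasFiniteIntegral_iff_norm]
    exact lt_of_le_of_ne le_top hinf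
  have hii2 : IntervalIntegrable (fun r => vs r x) volume s 0 := by
    rw [intervalIntegrable_iff_integrableOn_Ioo_of_le hsI.2]
    refine IntegrableOn.congr_fun (f := fun r => deriv (vt x) r) ?_ (fun r hr => hdeq x r ⟨hsI.1.trans_lt hr.1, hr.2⟩) measurableSet_Ioo
    exact IntegrableOn.mono_set hii (Ioo_subset_Ioo hsI.1 le_rfl)
  have hftc := intervalIntegral.integral_eq_sub_of_hasDerivAt (a := s) (b := 0)
    (fun r hr => hder r (by rw [uIcc_of_le hsI.2] at hr; exact ⟨hsI.1.trans hr.1, hr.2⟩) x) hii2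
  have hle : |v s x| ≤ |v 0 x| + ∫ r, |deriv (vt x) r| ∂μ := by
    have h1 : |∫ r in s..0, vs r x| ≤ ∫ r, |deriv (vt x) r| ∂μ := by
      refine (intervalIntegral.abs_integral_le_integral_abs hsI.2).trans ?_
      rw [intervalIntegral.integral_of_le hsI.2, integral_Ioc_eq_integral_Ioo,
        setIntegral_congr_fun (g := fun r => |deriv (vt x) r|) measurableSet_Ioo
          (fun r hr => by simp only []; rw [hdeq x r ⟨hsI.1.trans_lt hr.1, hr.2⟩])]
      exact setIntegral_mono_set hii.abs (Eventually.of_forall fun _ => abs_nonneg _)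
        (Ioo_subset_Ioo hsI.1 le_rfl).eventuallyLE
    rw [hftc] at h1
    have h2 := abs_sub_abs_le_abs_sub (v s x) (v 0 x)
    rw [abs_sub_comm] at h2
    linarith
  rw [← ofReal_integral_eq_lintegral_ofReal hii.abs (Eventually.of_forall fun _ => abs_nonneg _),
    ← ENNReal.ofReal_add (abs_nonneg _) (integral_nonneg fun _ => abs_nonneg _)]
  exact ENNReal.ofReal_le_ofReal hle

/-- the full setting for the decay estimate -/
structure Setup {n : ℕ} [NeZero n] (J : Rn n → ℝ) (d b : ℝ → ℝ) (D B U τ β c lam d1 P M : ℝ)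
    (u w : ℝ → Rn n → ℝ) : Prop where
  S : Sys J (heatKernel n β) d b D B U τ
  β0 : 0 < β
  c0 : 0 < c
  lam0 : 0 < lam
  B1 : 0 < B
  d10 : 0 ≤ d1
  d1D : d1 ≤ D
  hd1 : ∀ p r, 0 ≤ p → p ≤ r → r ≤ U → d1 * (r - p) ≤ d r - d p
  Ji : Integrable fun y => J y * Real.exp (-lam * y 0)
  JP : ∫ y, J y * Real.exp (-lam * y 0) = P
  tan : c * lam + 1 + d1 = P + B * Real.exp (β * lam ^ 2 - lam * c * τ)
  hu : Sol J (heatKernel n β) d b U τ u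
  hw : Sol J (heatKernel n β) d b U τ w
  M0 : 0 < M
  hMi : ∀ s ∈ Icc (-τ) 0, Integrable fun x => Real.exp (-lam * (x 0 + c * s)) * |u s x - w s x|
  hM : ∀ s ∈ Icc (-τ) 0, ∫ x, Real.exp (-lam * (x 0 + c * s)) * |u s x - w s x| ≤ M

/-- absolute difference -/
def av {n : ℕ} (u w : ℝ → Rn n → ℝ) (t : ℝ) (x : Rn n) : ℝ := |u t x - w t x|

section
variable {n : ℕ} [NeZero n] {J : Rn n → ℝ} {d b : ℝ → ℝ} {D B U τ β c lam d1 P M : ℝ}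
  {u w : ℝ → Rn n → ℝ}

lemma Setup.av_In (H : Setup J d b D B U τ β c lam d1 P M u w) : In U (av u w) where
  c := (H.hu.i.c.sub H.hw.i.c).abs
  nn t x := abs_nonneg _
  le t x := by
    have := H.hu.i.le t x; have := H.hu.i.nn t x; have := H.hw.i.le t x; have := H.hw.i.nn t x
    exact abs_le.2 ⟨by linarith, by linarith⟩

/-- majorant of the right-hand side -/
def Rm {n : ℕ} (J f : Rn n → ℝ) (D B τ d1 : ℝ) (a : ℝ → Rn n → ℝ) (t : ℝ) (x : Rn n) : ℝ :=
  cv J (a t) x + (D - d1) * a t x + B * cv f (a (t - τ)) x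

lemma shift_In {a : ℝ → Rn n → ℝ} (h : In U a) (τ : ℝ) : In U (fun t => a (t - τ)) where
  c := h.c.comp (by fun_prop : Continuous fun p : ℝ × Rn n => (p.1 - τ, p.2))
  nn t x := h.nn _ x
  le t x := h.le _ x

lemma Setup.Rm_cont (H : Setup J d b D B U τ β c lam d1 P M u w) {a : ℝ → Rn n → ℝ} (h : In U a) :
    Continuous (Function.uncurry (Rm J (heatKernel n β) D B τ d1 a)) := by
  have h1 := cv_cont H.S.kJ.int h.c h.abs
  have h2 := cv_cont H.S.kf.int (shift_In h τ).c (shift_In h τ).abs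
  exact (h1.add (continuous_const.mul h.c)).add (continuous_const.mul h2)

lemma Setup.Rm_bd (H : Setup J d b D B U τ β c lam d1 P M u w) {a : ℝ → Rn n → ℝ} (h : In U a)
    (t : ℝ) (x : Rn n) : |Rm J (heatKernel n β) D B τ d1 a t x| ≤ (1 + (D - d1) + B) * U := by
  have h1 := cv_le H.S.kJ (uc_x h.c t) (h.abs t) (h.le t) x
  have h2 := cv_le H.S.kf (uc_x h.c (t - τ)) (h.abs _) (h.le _) x
  have h3 := le_cv H.S.kJ (uc_x h.c t) (h.abs t) (h.nn t) x
  have h4 := le_cv H.S.kf (uc_x h.c (t - τ)) (h.abs _) (h.nn _) x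
  have h5 : 0 ≤ D - d1 := by linarith [H.d1D]
  have h6 := h.nn t x
  have h7 := h.le t x
  have := H.B1
  unfold Rm
  rw [abs_of_nonneg (by positivity)]
  have := mul_le_mul_of_nonneg_left h7 h5
  have := mul_le_mul_of_nonneg_left h2 H.B1.le
  linarith

lemma Setup.diff_b (H : Setup J d b D B U τ β c lam d1 P M u w) (t : ℝ) (x : Rn n) :
    |cv (heatKernel n β) (fun y => b (u (t - τ) y)) x - cv (heatKernel n β) (fun y => b (w (t - τ) y)) x|
      ≤ B * cv (heatKernel n β) (av u w (t - τ)) x := by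
  have i1 := H.S.bIn H.hu.i
  have i2 := H.S.bIn H.hw.i
  have j1 := cv_int H.S.kf.int (uc_x i1.c t) (i1.abs t) x
  have j2 := cv_int H.S.kf.int (uc_x i2.c t) (i2.abs t) x
  rw [← cv_sub j1 j2, ← cv_smul]
  refine (cv_abs H.S.kf.nn x).trans (cv_mono H.S.kf.nn ?_ ?_ fun y => H.S.b_abs _ _)
  · refine cv_int H.S.kf.int (M := b U + b U) ((uc_x i1.c t).sub (uc_x i2.c t)).abs (fun y => ?_) x
    rw [abs_abs]
    exact (abs_sub _ _).trans (add_le_add (i1.abs t y) (i2.abs t y))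
  · have := (cv_int H.S.kf.int (uc_x H.av_In.c (t - τ)) (H.av_In.abs _) x).const_mul B
    refine this.congr (Eventually.of_forall fun y => ?_)
    simp only [av]; ring

lemma Setup.diff_J (H : Setup J d b D B U τ β c lam d1 P M u w) (t : ℝ) (x : Rn n) :
    |cv J (u t) x - cv J (w t) x| ≤ cv J (av u w t) x := by
  have j1 := cv_int H.S.kJ.int (uc_x H.hu.i.c t) (H.hu.i.abs t) x
  have j2 := cv_int H.S.kJ.int (uc_x H.hw.i.c t) (H.hw.i.abs t) x
  rw [← cv_sub j1 j2]
  exact cv_abs H.S.kJ.nn x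

lemma Setup.diff_d (H : Setup J d b D B U τ β c lam d1 P M u w) (t : ℝ) (x : Rn n) :
    |D * (u t x - w t x) - (d (u t x) - d (w t x))| ≤ (D - d1) * av u w t x := by
  have g1 := H.hu.i.nn t x; have g2 := H.hu.i.le t x
  have g3 := H.hw.i.nn t x; have g4 := H.hw.i.le t x
  unfold av
  rcases le_total (u t x) (w t x) with h | h
  · have h1 := H.hd1 _ _ g1 h g4
    have h2 := (H.S.hd _ _ h).2
    rw [abs_of_nonpos (by linarith : u t x - w t x ≤ 0), abs_of_nonpos (by linarith)]
    linarith
  · have h1 := H.hd1 _ _ g3 h g2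
    have h2 := (H.S.hd _ _ h).2
    rw [abs_of_nonneg (by linarith : 0 ≤ u t x - w t x), abs_of_nonneg (by linarith)]
    linarith

lemma Setup.duh (H : Setup J d b D B U τ β c lam d1 P M u w) {t : ℝ} (ht : 0 ≤ t) (x : Rn n) :
    Real.exp ((1 + D) * t) * av u w t x ≤ av u w 0 x +
      ∫ r in (0 : ℝ)..t, Real.exp ((1 + D) * r) * Rm J (heatKernel n β) D B τ d1 (av u w) r x := by
  set f := heatKernel n β with hf
  set g : ℝ → ℝ := fun r => Real.exp ((1 + D) * r) * ((cv J (u r) x - cv J (w r) x) +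
    (D * (u r x - w r x) - (d (u r x) - d (w r x))) +
    (cv f (fun y => b (u (r - τ) y)) x - cv f (fun y => b (w (r - τ) y)) x)) with hg
  have hgc : Continuous g := by
    have c1 := uc_t (cv_cont H.S.kJ.int H.hu.i.c H.hu.i.abs) x
    have c2 := uc_t (cv_cont H.S.kJ.int H.hw.i.c H.hw.i.abs) x
    have c3 := uc_t (cv_cont H.S.kf.int (H.S.bIn H.hu.i).c (H.S.bIn H.hu.i).abs) x
    have c4 := uc_t (cv_cont H.S.kf.int (H.S.bIn H.hw.i).c (H.S.bIn H.hw.i).abs) x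
    have c5 := uc_t H.hu.i.c x
    have c6 := uc_t H.hw.i.c x
    have c7 := H.S.dc.comp c5
    have c8 := H.S.dc.comp c6
    exact (by fun_prop : Continuous fun r : ℝ => Real.exp ((1 + D) * r)).mul
      (((c1.sub c2).add ((continuous_const.mul (c5.sub c6)).sub (c7.sub c8))).add (c3.sub c4))
  have hftc := intervalIntegral.integral_eq_sub_of_hasDerivAt_of_le (f := fun r => Real.exp ((1 + D) * r) * (u r x - w r x)) (f' := g) ht
    ((by fun_prop : Continuous fun r : ℝ => Real.exp ((1 + D) * r)).mul
      ((uc_t H.hu.i.c x).sub (uc_t H.hw.i.c x))).continuousOn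
    (fun r hr => by
      have h1 := (H.hu.e r hr.1 x).sub (H.hw.e r hr.1 x)
      have h2 : HasDerivAt (fun r : ℝ => Real.exp ((1 + D) * r)) (Real.exp ((1 + D) * r) * (1 + D)) r := by
        have := (hasDerivAt_id r).const_mul (1 + D)
        simpa using this.exp
      refine (h2.mul h1).congr_deriv ?_
      simp only [hg, Pi.sub_apply]; ring)
    (hgc.intervalIntegrable _ _)
  have hle : ∀ r, |g r| ≤ Real.exp ((1 + D) * r) * Rm J f D B τ d1 (av u w) r x := by
    intro r
    rw [hg]; simp only []
    rw [abs_mul, abs_of_pos (Real.exp_pos _)]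
    refine mul_le_mul_of_nonneg_left ?_ (Real.exp_pos _).le
    refine (abs_add_three _ _ _).trans ?_
    exact add_le_add (add_le_add (H.diff_J r x) (H.diff_d r x)) (H.diff_b r x)
  have h3 : |∫ r in (0 : ℝ)..t, g r| ≤ ∫ r in (0 : ℝ)..t, Real.exp ((1 + D) * r) * Rm J f D B τ d1 (av u w) r x := by
    refine (intervalIntegral.abs_integral_le_integral_abs ht).trans ?_
    refine intervalIntegral.integral_mono_on ht (hgc.abs.intervalIntegrable _ _) ?_ (fun r _ => hle r)
    exact ((by fun_prop : Continuous fun r : ℝ => Real.exp ((1 + D) * r)).mul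
      (uc_t (H.Rm_cont H.av_In) x)).intervalIntegrable _ _
  rw [hftc] at h3
  simp only [mul_zero, Real.exp_zero, one_mul] at h3
  have h4 : Real.exp ((1 + D) * t) * av u w t x = |Real.exp ((1 + D) * t) * (u t x - w t x)| := by
    rw [abs_mul, abs_of_pos (Real.exp_pos _)]; rfl
  have h5 := abs_sub_abs_le_abs_sub (Real.exp ((1 + D) * t) * (u t x - w t x)) (u 0 x - w 0 x)
  rw [h4]
  change _ ≤ |u 0 x - w 0 x| + _
  linarith

end

lemma cv_swap {n : ℕ} {k : Rn n → ℝ} (hk : Integrable k) {g : ℝ → Rn n → ℝ}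
    (hg : Continuous (Function.uncurry g)) {t C : ℝ} (ht : 0 ≤ t)
    (hC : ∀ r ∈ Icc 0 t, ∀ x, |g r x| ≤ C) (x : Rn n) :
    cv k (fun y => ∫ r in (0 : ℝ)..t, g r y) x = ∫ r in (0 : ℝ)..t, cv k (g r) x := by
  unfold cv
  rw [intervalIntegral_integral_swap]
  · congr 1; ext y
    rw [intervalIntegral.integral_const_mul]
  · rw [uIoc_of_le ht]
    have h1 : Integrable (fun z : ℝ × Rn n => C * |k z.2|)
        ((volume.restrict (Ioc 0 t)).prod volume) :=
      Integrable.mul_prod (μ := volume.restrict (Ioc 0 t)) (f := fun _ => C) (integrable_const C) hk.abs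
    refine h1.mono' ?_ ?_
    · have : Continuous fun z : ℝ × Rn n => g z.1 (x - z.2) :=
        hg.comp (by fun_prop : Continuous fun z : ℝ × Rn n => (z.1, x - z.2))
      exact (hk.1.comp_snd).mul this.aestronglyMeasurable
    · have h2 : ∀ᵐ z ∂((volume.restrict (Ioc 0 t)).prod (volume : Measure (Rn n))), z.1 ∈ Ioc 0 t := by
        have := (Measure.quasiMeasurePreserving_fst (μ := volume.restrict (Ioc 0 t)) (ν := (volume : Measure (Rn n)))).ae
          (ae_restrict_mem (measurableSet_Ioc (a := (0 : ℝ)) (b := t)))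
        exact this
      filter_upwards [h2] with z hz
      simp only [Function.uncurry, norm_mul, Real.norm_eq_abs]
      rw [mul_comm]
      exact mul_le_mul_of_nonneg_right (hC _ ⟨hz.1.le, hz.2⟩ _) (abs_nonneg _)

lemma aux_sub_pow {S γ q : ℝ} (hS : 0 < S) (hγ : 0 ≤ γ) (hq : 0 < q) :
    (S + γ) ^ (-q) + q * γ * (S + γ) ^ (-q - 1) ≤ S ^ (-q) := by
  have h1 : 0 < S + γ := by linarith
  have h2 : S ^ (-q) = (S + γ) ^ (-q) * (S / (S + γ)) ^ (-q) := by
    rw [← Real.mul_rpow h1.le (by positivity)]; congr 1; field_simp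
  have h3 : (S + γ) ^ (-q - 1) = (S + γ) ^ (-q) * (1 / (S + γ)) := by
    rw [Real.rpow_sub_one h1.ne']; ring
  have h4 : 1 + q * (γ / (S + γ)) ≤ (S / (S + γ)) ^ (-q) := by
    rw [Real.rpow_def_of_pos (by positivity)]
    have h5 := Real.add_one_le_exp (Real.log (S / (S + γ)) * -q)
    have h6 := Real.log_le_sub_one_of_pos (by positivity : 0 < S / (S + γ))
    have h7 : S / (S + γ) - 1 = - (γ / (S + γ)) := by field_simp; ring
    rw [h7] at h6
    nlinarith
  rw [h2, h3]
  have h8 := mul_le_mul_of_nonneg_left h4 (Real.rpow_nonneg h1.le (-q))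
  calc _ = (S + γ) ^ (-q) * (1 + q * (γ / (S + γ))) := by ring
    _ ≤ _ := h8

section
variable {n : ℕ} [NeZero n] {J : Rn n → ℝ} {d b : ℝ → ℝ} {D B U τ β c lam d1 P M : ℝ}
  {u w : ℝ → Rn n → ℝ}

lemma Setup.duhG (H : Setup J d b D B U τ β c lam d1 P M u w) {σ : ℝ} (hσ : 0 < σ) {t : ℝ}
    (ht : 0 ≤ t) (x : Rn n) :
    Real.exp ((1 + D) * t) * cv (heatKernel n σ) (av u w t) x ≤ cv (heatKernel n σ) (av u w 0) x +
      ∫ r in (0 : ℝ)..t, Real.exp ((1 + D) * r) * (cv J (cv (heatKernel n σ) (av u w r)) x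
        + (D - d1) * cv (heatKernel n σ) (av u w r) x
        + B * cv (heatKernel n (σ + β)) (av u w (r - τ)) x) := by
  have hk := hk_kern n hσ
  have hI := H.av_In
  have hRc := H.Rm_cont hI
  have hRb := H.Rm_bd hI
  have hΛ : 0 < 1 + D := by linarith [H.S.D0]
  set G := heatKernel n σ with hG
  set R := Rm J (heatKernel n β) D B τ d1 (av u w) with hR
  set CR := (1 + (D - d1) + B) * U with hCR
  set g : ℝ → Rn n → ℝ := fun r y => Real.exp ((1 + D) * r) * R r y with hg
  have hgc : Continuous (Function.uncurry g) :=
    (by fun_prop : Continuous fun p : ℝ × Rn n => Real.exp ((1 + D) * p.1)).mul hRc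
  have hgb : ∀ r ∈ Icc 0 t, ∀ x, |g r x| ≤ Real.exp ((1 + D) * t) * CR := by
    intro r hr y
    rw [hg]; simp only []
    rw [abs_mul, abs_of_pos (Real.exp_pos _)]
    exact mul_le_mul (Real.exp_le_exp.2 (mul_le_mul_of_nonneg_left hr.2 hΛ.le)) (hRb r y) (abs_nonneg _) (Real.exp_pos _).le
  have hIc : Continuous fun y => ∫ r in (0 : ℝ)..t, g r y := by
    apply intervalIntegral.continuous_parametric_intervalIntegral_of_continuous' (f := fun y r => g r y)
    exact hgc.comp continuous_swap
  have hIb : ∀ y, |∫ r in (0 : ℝ)..t, g r y| ≤ Real.exp ((1 + D) * t) * CR * |t - 0| := by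
    intro y
    rw [← Real.norm_eq_abs]
    exact intervalIntegral.norm_integral_le_of_norm_le_const (f := fun r => g r y) (C := Real.exp ((1 + D) * t) * CR) (fun r hr => by
      rw [uIoc_of_le ht] at hr; exact hgb r ⟨hr.1.le, hr.2⟩ y)
  have e1 : ∀ r, cv G (R r) x = cv J (cv G (av u w r)) x + (D - d1) * cv G (av u w r) x
        + B * cv (heatKernel n (σ + β)) (av u w (r - τ)) x := by
    intro r
    have i1 := cv_int hk.int (uc_x (cv_cont H.S.kJ.int hI.c hI.abs) r) (M := U) (fun y => by
      rw [abs_of_nonneg (le_cv H.S.kJ (uc_x hI.c r) (hI.abs r) (hI.nn r) y)]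
      exact cv_le H.S.kJ (uc_x hI.c r) (hI.abs r) (hI.le r) y) x
    have i2 := cv_int hk.int (uc_x hI.c r) (hI.abs r) x
    have i3 := cv_int hk.int (uc_x (cv_cont H.S.kf.int hI.c hI.abs) (r - τ)) (M := U) (fun y => by
      rw [abs_of_nonneg (le_cv H.S.kf (uc_x hI.c _) (hI.abs _) (hI.nn _) y)]
      exact cv_le H.S.kf (uc_x hI.c _) (hI.abs _) (hI.le _) y) x
    have j2 : Integrable fun y => G y * ((D - d1) * av u w r (x - y)) := by
      refine (i2.const_mul (D - d1)).congr (Eventually.of_forall fun y => ?_); simp only []; ring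
    have j3 : Integrable fun y => G y * (B * cv (heatKernel n β) (av u w (r - τ)) (x - y)) := by
      refine (i3.const_mul B).congr (Eventually.of_forall fun y => ?_); simp only []; ring
    have j12 : Integrable fun y => G y * (cv J (av u w r) (x - y) + (D - d1) * av u w r (x - y)) := by
      refine (i1.add j2).congr (Eventually.of_forall fun y => ?_); simp only [Pi.add_apply]; ring
    rw [hR]
    change cv G (fun y => (cv J (av u w r) y + (D - d1) * av u w r y) + B * cv (heatKernel n β) (av u w (r - τ)) y) x = _
    rw [cv_add j12 j3, cv_add i1 j2, cv_smul, cv_smul, hG, hk_semi n hσ H.β0 (uc_x hI.c _) (hI.abs _)]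
    congr 2
    exact cv_comm hk.int H.S.kJ.int (uc_x hI.c _) (hI.abs _) x
  have e2 : (∫ r in (0 : ℝ)..t, Real.exp ((1 + D) * r) * (cv J (cv G (av u w r)) x
        + (D - d1) * cv G (av u w r) x
        + B * cv (heatKernel n (σ + β)) (av u w (r - τ)) x)) = cv G (fun y => ∫ r in (0 : ℝ)..t, g r y) x := by
    rw [cv_swap hk.int hgc ht hgb]
    congr 1; ext r
    rw [← e1, ← cv_smul]
  have k0 := cv_int hk.int (uc_x hI.c 0) (hI.abs 0) x
  have k1 := cv_int hk.int hIc hIb x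
  rw [e2, ← cv_add k0 k1, ← cv_smul]
  refine cv_mono hk.nn ?_ ?_ fun y => H.duh ht y
  · refine ((cv_int hk.int (uc_x hI.c t) (hI.abs t) x).const_mul (Real.exp ((1 + D) * t))).congr (Eventually.of_forall fun y => ?_); simp only []; ring
  · refine (k0.add k1).congr (Eventually.of_forall fun y => ?_); simp only [Pi.add_apply]; ring

/-- supersolution -/
def Ys {n : ℕ} [NeZero n] (c lam CF κ : ℝ) (σ : ℝ) (t : ℝ) (x : Rn n) : ℝ :=
  Real.exp (lam * (x 0 + c * t) + lam ^ 2 * σ) * (CF * (σ + κ * t) ^ (-((n : ℝ) / 2)))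

lemma Setup.Ys_super (H : Setup J d b D B U τ β c lam d1 P M u w) {CF κ : ℝ} (hCF : 0 < CF) (hκ : 0 < κ)
    (hκ1 : κ * τ ≤ β / 2)
    (hκ2 : κ ≤ B * Real.exp (β * lam ^ 2 - lam * c * τ) * (β / 2) * 2 ^ (-((n : ℝ) / 2) - 1))
    {σ t : ℝ} (hσ : β ≤ σ) (ht : 0 ≤ t) (x : Rn n) :
    ∃ y', HasDerivAt (fun t => Ys c lam CF κ σ t x) y' t ∧
      P * Ys c lam CF κ σ t x + (D - d1) * Ys c lam CF κ σ t x
        + B * Ys c lam CF κ (σ + β) (t - τ) x ≤ y' + (1 + D) * Ys c lam CF κ σ t x := by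
  have hβ := H.β0
  have hn : (0 : ℝ) < n := by exact_mod_cast Nat.pos_of_ne_zero (NeZero.ne n)
  set q : ℝ := (n : ℝ) / 2 with hq
  have hq0 : 0 < q := by positivity
  have hS : β ≤ σ + κ * t := by have := mul_nonneg hκ.le ht; linarith
  have hS0 : 0 < σ + κ * t := by linarith
  set S := σ + κ * t with hSdef
  set E := Real.exp (lam * (x 0 + c * t) + lam ^ 2 * σ) with hE
  have hE0 : 0 < E := Real.exp_pos _
  refine ⟨E * (lam * c) * (CF * S ^ (-q)) + E * (CF * (κ * (-q) * S ^ (-q - 1))), ?_, ?_⟩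
  · have h1 : HasDerivAt (fun t : ℝ => lam * (x 0 + c * t) + lam ^ 2 * σ) (lam * c) t := by
      have := ((((hasDerivAt_id t).const_mul c).const_add (x 0)).const_mul lam).add_const (lam ^ 2 * σ)
      simpa using this
    have h2 : HasDerivAt (fun t : ℝ => σ + κ * t) κ t := by
      have := ((hasDerivAt_id t).const_mul κ).const_add σ
      simpa using this
    exact h1.exp.mul ((h2.rpow_const (p := -q) (Or.inl hS0.ne')).const_mul CF)
  · set γ := β - κ * τ with hγ
    have hκτ := mul_pos hκ H.S.τ0
    have hγ1 : β / 2 ≤ γ := by linarith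
    have hγ0 : 0 ≤ γ := by linarith
    have e1 : Ys c lam CF κ (σ + β) (t - τ) x = E * Real.exp (β * lam ^ 2 - lam * c * τ) * (CF * (S + γ) ^ (-q)) := by
      unfold Ys
      rw [hE, ← Real.exp_add]
      rw [show σ + β + κ * (t - τ) = S + γ by rw [hSdef, hγ]; ring]
      congr 2
      ring
    have e2 : Ys c lam CF κ σ t x = E * (CF * S ^ (-q)) := rfl
    have hsp := aux_sub_pow hS0 (by linarith : 0 ≤ γ) hq0
    have h3 : S ^ (-q - 1) * 2 ^ (-q - 1) ≤ (S + γ) ^ (-q - 1) := by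
      rw [← Real.mul_rpow hS0.le (by norm_num)]
      exact Real.rpow_le_rpow_of_nonpos (by linarith) (by linarith) (by linarith)
    set B' := B * Real.exp (β * lam ^ 2 - lam * c * τ) with hB'
    have hB'0 : 0 < B' := mul_pos H.B1 (Real.exp_pos _)
    have hsp1 : 0 < S ^ (-q - 1) := Real.rpow_pos_of_pos hS0 _
    have h4 : κ * q * S ^ (-q - 1) ≤ B' * (S ^ (-q) - (S + γ) ^ (-q)) := by
      calc κ * q * S ^ (-q - 1) ≤ (B' * (β / 2) * 2 ^ (-q - 1)) * q * S ^ (-q - 1) := by gcongr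
        _ = B' * (q * (β / 2) * (S ^ (-q - 1) * 2 ^ (-q - 1))) := by ring
        _ ≤ B' * (q * γ * (S + γ) ^ (-q - 1)) := by
            gcongr
        _ ≤ _ := by gcongr; linarith
    have htan := H.tan
    rw [← hB'] at htan
    rw [e1, e2]
    have h5 := mul_le_mul_of_nonneg_left h4 (mul_pos hE0 hCF).le
    have : P = c * lam + 1 + d1 - B' := by linarith
    rw [this]
    have e3 : B * (E * Real.exp (β * lam ^ 2 - lam * c * τ) * (CF * (S + γ) ^ (-q))) = B' * (E * CF * (S + γ) ^ (-q)) := by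
      rw [hB']; ring
    rw [e3]
    linarith
end

section
variable {n : ℕ} [NeZero n] {J : Rn n → ℝ} {d b : ℝ → ℝ} {D B U τ β c lam d1 P M : ℝ}
  {u w : ℝ → Rn n → ℝ}

lemma Setup.gau_init (H : Setup J d b D B U τ β c lam d1 P M u w) {κ : ℝ} (hκ : 0 < κ)
    (hκ1 : κ * τ ≤ β / 2) {σ s : ℝ} (hσ : β ≤ σ) (hs : s ∈ Icc (-τ) 0) (x : Rn n) :
    cv (heatKernel n σ) (av u w s) x ≤ Ys c lam (M * (4 * π) ^ (-((n : ℝ) / 2))) κ σ s x := by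
  have hβ := H.β0
  have hσ0 : 0 < σ := by linarith
  have hI := H.av_In
  set Cσ := (4 * π * σ) ^ (-(n : ℝ) / 2) * Real.exp (lam ^ 2 * σ) with hCσ
  have h1 : cv (heatKernel n σ) (av u w s) x ≤
      ∫ y, (Cσ * Real.exp (lam * (x 0 + c * s))) * (Real.exp (-lam * (y 0 + c * s)) * |u s y - w s y|) := by
    rw [← cv_eq]
    refine integral_mono_of_nonneg (Eventually.of_forall fun y => mul_nonneg ((hk_kern n hσ0).nn _) (hI.nn _ _))
      ((H.hMi s hs).const_mul _) (Eventually.of_forall fun y => ?_)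
    have h2 := hk_le hσ0 lam (x - y)
    have h3 : heatKernel n σ (x - y) = (heatKernel n σ (x - y) * Real.exp (-lam * (x - y) 0)) *
        (Real.exp (lam * (x 0 + c * s)) * Real.exp (-lam * (y 0 + c * s))) := by
      rw [← Real.exp_add, mul_assoc, ← Real.exp_add]
      have : -lam * (x - y) 0 + (lam * (x 0 + c * s) + -lam * (y 0 + c * s)) = 0 := by
        simp only [PiLp.sub_apply]; ring
      rw [this]; simp
    simp only []
    rw [h3]
    change _ * |u s y - w s y| ≤ _
    calc _ ≤ Cσ * (Real.exp (lam * (x 0 + c * s)) * Real.exp (-lam * (y 0 + c * s))) * |u s y - w s y| := by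
          gcongr
      _ = _ := by ring
  rw [integral_const_mul] at h1
  have hpos : 0 < Cσ * Real.exp (lam * (x 0 + c * s)) := by positivity
  have h4 := h1.trans (mul_le_mul_of_nonneg_left (H.hM s hs) hpos.le)
  refine h4.trans ?_
  unfold Ys
  have hκs : κ * s ≤ 0 := mul_nonpos_of_nonneg_of_nonpos hκ.le hs.2
  have hκs2 : -(κ * τ) ≤ κ * s := by nlinarith [hs.1]
  have h5 : σ ^ (-((n : ℝ) / 2)) ≤ (σ + κ * s) ^ (-((n : ℝ) / 2)) :=
    Real.rpow_le_rpow_of_nonpos (by linarith) (by linarith) (by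
      have : (0 : ℝ) ≤ n := Nat.cast_nonneg n
      linarith)
  have h6 : Cσ = (4 * π) ^ (-((n : ℝ) / 2)) * σ ^ (-((n : ℝ) / 2)) * Real.exp (lam ^ 2 * σ) := by
    rw [hCσ, ← Real.mul_rpow (by positivity) hσ0.le, neg_div]
  rw [h6, Real.exp_add]
  have hM0 := H.M0
  calc _ = Real.exp (lam * (x 0 + c * s)) * Real.exp (lam ^ 2 * σ) *
        (M * (4 * π) ^ (-((n : ℝ) / 2)) * σ ^ (-((n : ℝ) / 2))) := by ring
    _ ≤ _ := by gcongr

lemma Setup.gau (H : Setup J d b D B U τ β c lam d1 P M u w) {κ : ℝ} (hκ : 0 < κ)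
    (hκ1 : κ * τ ≤ β / 2)
    (hκ2 : κ ≤ B * Real.exp (β * lam ^ 2 - lam * c * τ) * (β / 2) * 2 ^ (-((n : ℝ) / 2) - 1))
    {σ t : ℝ} (hσ : β ≤ σ) (ht : -τ ≤ t) (x : Rn n) :
    cv (heatKernel n σ) (av u w t) x ≤ Ys c lam (M * (4 * π) ^ (-((n : ℝ) / 2))) κ σ t x := by
  have hβ := H.β0
  have hI := H.av_In
  set CF := M * (4 * π) ^ (-((n : ℝ) / 2)) with hCF
  have hCF0 : 0 < CF := by have := H.M0; positivity
  set L := 1 + (D - d1) + B with hL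
  have hL0 : 0 < L := by linarith [H.d1D, H.B1]
  have hΛ : 0 < 1 + D := by linarith [H.S.D0]
  have hYnn : ∀ σ' t' (x' : Rn n), β ≤ σ' → -τ ≤ t' → 0 ≤ Ys c lam CF κ σ' t' x' := by
    intro σ' t' x' h1 h2
    have : 0 ≤ σ' + κ * t' := by nlinarith
    unfold Ys; positivity
  have key := aux_halve (ι := {σ : ℝ // β ≤ σ} × Rn n)
    (fun i t => cv (heatKernel n i.1.1) (av u w t) i.2 - Ys c lam CF κ i.1.1 t i.2) 0 U (2 * L) (by positivity)
    (by
      intro i t ht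
      have h1 := cv_le (hk_kern n (by linarith [i.1.2] : 0 < i.1.1)) (uc_x hI.c t) (hI.abs t) (hI.le t) i.2
      have h2 := hYnn i.1.1 t i.2 i.1.2 (by linarith [H.S.τ0])
      linarith)
    (by
      intro K hK hz ⟨⟨σ, hσ⟩, x⟩ t ht
      simp only [sub_zero] at hz ⊢
      have hσ0 : 0 < σ := by linarith
      have hz' : ∀ σ' (x' : Rn n) s, β ≤ σ' → -τ ≤ s →
          cv (heatKernel n σ') (av u w s) x' ≤ Ys c lam CF κ σ' s x' + K * Real.exp (2 * L * s) := by
        intro σ' x' s h1 h2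
        rcases le_total 0 s with h3 | h3
        · have := hz (⟨σ', h1⟩, x') s h3
          linarith
        · have := H.gau_init hκ hκ1 h1 ⟨h2, h3⟩ x'
          have : 0 ≤ K * Real.exp (2 * L * s) := by positivity
          linarith
      have hdu := H.duhG hσ0 ht x
      have h0 := H.gau_init hκ hκ1 hσ ⟨by linarith [H.S.τ0], le_rfl⟩ x
      choose! Y' hY' hYs using fun (r : ℝ) (hr : 0 ≤ r) => H.Ys_super hCF0 hκ hκ1 hκ2 hσ hr x
      set Hf : ℝ → ℝ := fun r => Real.exp ((1 + D) * r) * Ys c lam CF κ σ r x +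
        L * K / (1 + D + 2 * L) * Real.exp ((1 + D + 2 * L) * r) with hHf
      have hHd : ∀ r, 0 ≤ r → HasDerivAt Hf (Real.exp ((1 + D) * r) * (Y' r + (1 + D) * Ys c lam CF κ σ r x)
          + L * K * Real.exp ((1 + D + 2 * L) * r)) r := by
        intro r hr
        have h2 : HasDerivAt (fun r : ℝ => Real.exp ((1 + D) * r)) (Real.exp ((1 + D) * r) * (1 + D)) r := by
          have := (hasDerivAt_id r).const_mul (1 + D)
          simpa using this.exp
        have h3 : HasDerivAt (fun r : ℝ => Real.exp ((1 + D + 2 * L) * r)) (Real.exp ((1 + D + 2 * L) * r) * (1 + D + 2 * L)) r := by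
          have := (hasDerivAt_id r).const_mul (1 + D + 2 * L)
          simpa using this.exp
        refine ((h2.mul (hY' r hr)).add (h3.const_mul (L * K / (1 + D + 2 * L)))).congr_deriv ?_
        have : (1 + D + 2 * L) ≠ 0 := by positivity
        field_simp
        ring
      have hcI : Continuous fun r => Real.exp ((1 + D) * r) * (cv J (cv (heatKernel n σ) (av u w r)) x
        + (D - d1) * cv (heatKernel n σ) (av u w r) x
        + B * cv (heatKernel n (σ + β)) (av u w (r - τ)) x) := by
        have k1 := (hk_kern n hσ0)
        have k2 := (hk_kern n (by linarith : 0 < σ + β))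
        have c1 := cv_cont k1.int hI.c hI.abs
        have c2 := uc_t (cv_cont k2.int (shift_In hI τ).c (shift_In hI τ).abs) x
        have c3 := uc_t (cv_cont H.S.kJ.int c1 (M := U) (fun t y => by
          rw [abs_of_nonneg (le_cv k1 (uc_x hI.c _) (hI.abs _) (hI.nn _) y)]
          exact cv_le k1 (uc_x hI.c _) (hI.abs _) (hI.le _) y)) x
        exact (by fun_prop : Continuous fun r : ℝ => Real.exp ((1 + D) * r)).mul
          ((c3.add (continuous_const.mul (uc_t c1 x))).add (continuous_const.mul c2))
      have hmain : (∫ r in (0 : ℝ)..t, Real.exp ((1 + D) * r) * (cv J (cv (heatKernel n σ) (av u w r)) x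
        + (D - d1) * cv (heatKernel n σ) (av u w r) x
        + B * cv (heatKernel n (σ + β)) (av u w (r - τ)) x)) ≤ Hf t - Hf 0 := by
        refine intervalIntegral.integral_le_sub_of_hasDeriv_right_of_le ht
          (fun r hr => (hHd r hr.1).continuousAt.continuousWithinAt)
          (fun r hr => (hHd r hr.1.le).hasDerivWithinAt)
          (hcI.continuousOn.integrableOn_Icc) (fun r hr => ?_)
        have hr0 := hr.1.le
        have hb1 : cv J (cv (heatKernel n σ) (av u w r)) x ≤ P * Ys c lam CF κ σ r x + K * Real.exp (2 * L * r) := by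
          have k1 := (hk_kern n hσ0)
          have e1 : cv J (fun y => Ys c lam CF κ σ r y) x = P * Ys c lam CF κ σ r x ∧
             Integrable (fun y => J y * Ys c lam CF κ σ r (x - y)) := by
            have e0 : (fun y => J y * Ys c lam CF κ σ r (x - y)) =
                fun y => (J y * Real.exp (-lam * y 0)) * Ys c lam CF κ σ r x := by
              ext y
              unfold Ys
              have : lam * ((x - y) 0 + c * r) + lam ^ 2 * σ = -lam * y 0 + (lam * (x 0 + c * r) + lam ^ 2 * σ) := by
                simp only [PiLp.sub_apply]; ring
              rw [this, Real.exp_add (-lam * y 0)]; ring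
            refine ⟨?_, ?_⟩
            · unfold cv; rw [e0, integral_mul_const, H.JP]
            · rw [e0]; exact H.Ji.mul_const _
          have i2 : Integrable fun y : Rn n => J y * (K * Real.exp (2 * L * r)) := H.S.kJ.int.mul_const _
          have e2 : cv J (fun y => Ys c lam CF κ σ r y + K * Real.exp (2 * L * r)) x
              = P * Ys c lam CF κ σ r x + K * Real.exp (2 * L * r) := by
            rw [cv_add e1.2 i2, e1.1, cv_const H.S.kJ]
          rw [← e2]
          refine cv_mono H.S.kJ.nn (cv_int H.S.kJ.int (uc_x (cv_cont k1.int hI.c hI.abs) r) (M := U) (fun y => by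
            rw [abs_of_nonneg (le_cv k1 (uc_x hI.c _) (hI.abs _) (hI.nn _) y)]
            exact cv_le k1 (uc_x hI.c _) (hI.abs _) (hI.le _) y) x) ?_
            (fun y => hz' σ y r hσ (by linarith [H.S.τ0]))
          refine (e1.2.add i2).congr (Eventually.of_forall fun y => ?_)
          simp only [Pi.add_apply]; ring
        have hb2 := hz' σ x r hσ (by linarith [H.S.τ0])
        have hb3 := hz' (σ + β) x (r - τ) (by linarith) (by linarith)
        have hb4 : K * Real.exp (2 * L * (r - τ)) ≤ K * Real.exp (2 * L * r) := by
          gcongr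
          linarith [H.S.τ0]
        have hb5 := hYs r hr0
        have hb6 : Real.exp ((1 + D + 2 * L) * r) = Real.exp ((1 + D) * r) * Real.exp (2 * L * r) := by
          rw [← Real.exp_add]; ring_nf
        have hDd : 0 ≤ D - d1 := by linarith [H.d1D]
        have hb7 := mul_le_mul_of_nonneg_left hb2 hDd
        have hb8 := mul_le_mul_of_nonneg_left (hb3.trans (add_le_add_right hb4 _)) H.B1.le
        rw [hb6]
        have hb9 : cv J (cv (heatKernel n σ) (av u w r)) x
          + (D - d1) * cv (heatKernel n σ) (av u w r) x
          + B * cv (heatKernel n (σ + β)) (av u w (r - τ)) x ≤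
          (Y' r + (1 + D) * Ys c lam CF κ σ r x) + L * K * Real.exp (2 * L * r) := by
          rw [hL]; linarith
        calc _ ≤ Real.exp ((1 + D) * r) * ((Y' r + (1 + D) * Ys c lam CF κ σ r x) + L * K * Real.exp (2 * L * r)) :=
              mul_le_mul_of_nonneg_left hb9 (Real.exp_pos _).le
          _ = _ := by ring
      have hfin : Real.exp ((1 + D) * t) * cv (heatKernel n σ) (av u w t) x ≤
          Real.exp ((1 + D) * t) * (Ys c lam CF κ σ t x + K / 2 * Real.exp (2 * L * t)) := by
        have hb6 : Real.exp ((1 + D + 2 * L) * t) = Real.exp ((1 + D) * t) * Real.exp (2 * L * t) := by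
          rw [← Real.exp_add]; ring_nf
        have h1 : 0 ≤ L * K / (1 + D + 2 * L) := by positivity
        have h2 : L * K / (1 + D + 2 * L) ≤ K / 2 := by
          rw [div_le_div_iff₀ (by positivity) (by norm_num)]
          nlinarith [mul_nonneg hΛ.le hK]
        have h3 : Hf 0 = Ys c lam CF κ σ 0 x + L * K / (1 + D + 2 * L) := by
          simp [hHf]
        have h4 : Hf t = Real.exp ((1 + D) * t) * Ys c lam CF κ σ t x + L * K / (1 + D + 2 * L) * (Real.exp ((1 + D) * t) * Real.exp (2 * L * t)) := by
          rw [hHf, ← hb6]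
        have h5 : L * K / (1 + D + 2 * L) * (Real.exp ((1 + D) * t) * Real.exp (2 * L * t)) ≤ K / 2 * (Real.exp ((1 + D) * t) * Real.exp (2 * L * t)) := by gcongr
        rw [h3, h4] at hmain
        linarith
      have := le_of_mul_le_mul_left hfin (Real.exp_pos _)
      linarith)
  rcases le_total 0 t with h | h
  · have := key (⟨σ, hσ⟩, x) t h
    linarith
  · exact H.gau_init hκ hκ1 hσ ⟨ht, h⟩ x

end

lemma split_J {n : ℕ} [NeZero n] {J : Rn n → ℝ} (kJ : Kern J) {lam β : ℝ} (hβ : 0 < β)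
    (Ji : Integrable fun y => J y * Real.exp (-lam * y 0)) :
    ∃ (K : ℝ) (Ja : Rn n → ℝ), 0 ≤ K ∧ (∀ y, 0 ≤ Ja y) ∧ Integrable Ja ∧
      (∀ y, Ja y ≤ J y) ∧ (∀ y, J y ≤ Ja y + K * heatKernel n β y) ∧
      (Integrable fun y => Ja y * (1 + Real.exp (-lam * y 0))) ∧
      ∫ y, Ja y * (1 + Real.exp (-lam * y 0)) ≤ 1 / 4 := by
  set A : ℕ → Rn n → ℝ := fun k y => max (J y - k * heatKernel n β y) 0 with hA
  have hA0 : ∀ k y, 0 ≤ A k y := fun k y => le_max_right _ _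
  have hAJ : ∀ k y, A k y ≤ J y := fun k y =>
    max_le (by have := mul_nonneg (Nat.cast_nonneg (α := ℝ) k) (hk_pos n hβ y).le; linarith) (kJ.nn y)
  have hint : ∀ k, Integrable (A k) := fun k =>
    (kJ.int.sub ((hk_kern n hβ).int.const_mul k)).pos_part
  have hF : Integrable fun y => J y * (1 + Real.exp (-lam * y 0)) := by
    refine (kJ.int.add Ji).congr (Eventually.of_forall fun y => ?_)
    simp only [Pi.add_apply]; ring
  have hmeas : ∀ k, AEStronglyMeasurable (fun y : Rn n => A k y * (1 + Real.exp (-lam * y 0))) volume := fun k =>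
    (hint k).1.mul (by fun_prop : Continuous fun y : Rn n => 1 + Real.exp (-lam * y 0)).aestronglyMeasurable
  have hbd : ∀ k y, ‖A k y * (1 + Real.exp (-lam * y 0))‖ ≤ J y * (1 + Real.exp (-lam * y 0)) := by
    intro k y
    rw [Real.norm_of_nonneg (mul_nonneg (hA0 k y) (by positivity))]
    exact mul_le_mul_of_nonneg_right (hAJ k y) (by positivity)
  have hlim : Tendsto (fun k => ∫ y, A k y * (1 + Real.exp (-lam * y 0))) atTop (nhds (∫ _ : Rn n, (0 : ℝ))) := by
    apply tendsto_integral_of_dominated_convergence _ hmeas hF (fun k => Eventually.of_forall (hbd k))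
    refine Eventually.of_forall fun y => ?_
    apply tendsto_const_nhds.congr'
    obtain ⟨k0, hk0⟩ := exists_nat_ge (J y / heatKernel n β y)
    filter_upwards [eventually_ge_atTop k0] with k hk
    have h1 : J y ≤ k * heatKernel n β y := by
      rw [div_le_iff₀ (hk_pos n hβ y)] at hk0
      refine hk0.trans ?_
      have : (k0 : ℝ) ≤ k := by exact_mod_cast hk
      exact mul_le_mul_of_nonneg_right this (hk_pos n hβ y).le
    simp only [hA]
    rw [max_eq_right (by linarith)]; simp
  rw [integral_zero] at hlim
  obtain ⟨k, hk⟩ := (hlim.eventually (gt_mem_nhds (show (0 : ℝ) < 1 / 4 by norm_num))).exists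
  refine ⟨k, A k, Nat.cast_nonneg k, hA0 k, hint k, hAJ k, fun y => ?_, ?_, hk.le⟩
  · have := le_max_left (J y - k * heatKernel n β y) 0
    simp only [hA]; linarith
  · exact hF.mono' (hmeas k) (Eventually.of_forall (hbd k))

section
variable {n : ℕ} [NeZero n] {J : Rn n → ℝ} {d b : ℝ → ℝ} {D B U τ β c lam d1 P M : ℝ}
  {u w : ℝ → Rn n → ℝ}

lemma Setup.symm (H : Setup J d b D B U τ β c lam d1 P M u w) : Setup J d b D B U τ β c lam d1 P M w u where
  S := H.S
  β0 := H.β0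
  c0 := H.c0
  lam0 := H.lam0
  B1 := H.B1
  d10 := H.d10
  d1D := H.d1D
  hd1 := H.hd1
  Ji := H.Ji
  JP := H.JP
  tan := H.tan
  hu := H.hw
  hw := H.hu
  M0 := H.M0
  hMi := fun s hs => by simp only [abs_sub_comm (w s _)]; exact H.hMi s hs
  hM := fun s hs => by simp only [abs_sub_comm (w s _)]; exact H.hM s hs

lemma Setup.avg (H : Setup J d b D B U τ β c lam d1 P M u w) {T0 : ℝ} (hT0 : τ < T0) :
    ∃ C > 0, ∀ t ≥ -τ, ∀ x, cv (heatKernel n β) (av u w t) x ≤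
      C * (T0 + t) ^ (-((n : ℝ) / 2)) * Real.exp (lam * (x 0 + c * t)) := by
  have hβ := H.β0
  have hτ := H.S.τ0
  have hB := H.B1
  have hM := H.M0
  have hn : (0 : ℝ) ≤ n := Nat.cast_nonneg n
  set q : ℝ := (n : ℝ) / 2 with hq
  have hq0 : 0 ≤ q := by positivity
  set κ := min (β / 2 / τ) (B * Real.exp (β * lam ^ 2 - lam * c * τ) * (β / 2) * 2 ^ (-q - 1)) with hκ
  have hκ0 : 0 < κ := by positivity
  have hκ1 : κ * τ ≤ β / 2 := by
    have := min_le_left (β / 2 / τ) (B * Real.exp (β * lam ^ 2 - lam * c * τ) * (β / 2) * 2 ^ (-q - 1))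
    rwa [← hκ, le_div_iff₀ hτ] at this
  have hκ2 : κ ≤ B * Real.exp (β * lam ^ 2 - lam * c * τ) * (β / 2) * 2 ^ (-q - 1) := min_le_right _ _
  have hT00 : 0 < T0 := by linarith
  set θ := min κ (β / 2 / T0) with hθ
  have hθ0 : 0 < θ := by positivity
  have hθ1 : θ * T0 ≤ β / 2 := by
    have := min_le_right κ (β / 2 / T0)
    rwa [← hθ, le_div_iff₀ hT00] at this
  have hθ2 : θ ≤ κ := min_le_left _ _
  refine ⟨Real.exp (lam ^ 2 * β) * (M * (4 * π) ^ (-q)) * θ ^ (-q), by positivity, fun t ht x => ?_⟩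
  have h1 := H.gau hκ0 hκ1 hκ2 le_rfl ht x
  refine h1.trans ?_
  unfold Ys
  have h2 : θ * (T0 + t) ≤ β + κ * t := by nlinarith
  have h3 : 0 < T0 + t := by linarith
  have h4 : (β + κ * t) ^ (-q) ≤ θ ^ (-q) * (T0 + t) ^ (-q) := by
    rw [← Real.mul_rpow hθ0.le h3.le]
    exact Real.rpow_le_rpow_of_nonpos (by positivity) h2 (by linarith)
  rw [Real.exp_add]
  calc _ ≤ Real.exp (lam * (x 0 + c * t)) * Real.exp (lam ^ 2 * β) * (M * (4 * π) ^ (-q) * (θ ^ (-q) * (T0 + t) ^ (-q))) := by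
        gcongr
    _ = _ := by ring

lemma Setup.W_one (H : Setup J d b D B U τ β c lam d1 P M u w) {T0 : ℝ} (hT1 : 0 < T0) (hT0 : 2 * τ ≤ T0)
    (hTq : 4 * ((n : ℝ) / 2) ≤ T0) :
    ∃ C > 0, ∀ t ≥ 0, ∀ x, u t x - w t x ≤
      C * (T0 + t) ^ (-((n : ℝ) / 2)) * (1 + Real.exp (lam * (x 0 + c * t))) := by
  have hβ := H.β0
  have hτ := H.S.τ0
  have hB := H.B1
  have hI := H.av_In
  have hU := H.S.U0
  have hc := H.c0
  have hlam := H.lam0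
  have hn : (0 : ℝ) ≤ n := Nat.cast_nonneg n
  obtain ⟨C1, hC1, hav⟩ := H.avg (by linarith : τ < T0)
  obtain ⟨Kb, Ja, hKb, hJa0, hJai, hJaJ, hJab, hJae, hJa4⟩ := split_J H.S.kJ hβ H.Ji
  set q : ℝ := (n : ℝ) / 2 with hq
  have hq0 : 0 ≤ q := by positivity
  set C2 := Kb * C1 + B * C1 * 2 ^ q with hC2
  have hC20 : 0 < C2 := by positivity
  set C := 2 * C2 + U * T0 ^ q with hC
  have hC0 : 0 < C := by positivity
  set Wf : Rn n → ℝ → ℝ := fun x t => C * (T0 + t) ^ (-q) * (1 + Real.exp (lam * (x 0 + c * t))) with hWf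
  set W' : Rn n → ℝ → ℝ := fun x t => C * (-q * (T0 + t) ^ (-q - 1)) * (1 + Real.exp (lam * (x 0 + c * t)))
    + C * (T0 + t) ^ (-q) * (Real.exp (lam * (x 0 + c * t)) * (lam * c)) with hW'
  have hWd : ∀ x t, 0 ≤ t → HasDerivAt (Wf x) (W' x t) t := by
    intro x t ht
    have h1 : HasDerivAt (fun t : ℝ => lam * (x 0 + c * t)) (lam * c) t := by
      have := (((hasDerivAt_id t).const_mul c).const_add (x 0)).const_mul lam
      simpa using this
    have h2 : HasDerivAt (fun t : ℝ => T0 + t) 1 t := (hasDerivAt_id t).const_add T0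
    have h3 := ((h2.rpow_const (p := -q) (Or.inl (by positivity))).const_mul C).mul (h1.exp.const_add 1)
    refine h3.congr_deriv ?_
    simp only [hW', one_mul]
  have hW0 : ∀ x t, 0 ≤ t → 0 ≤ Wf x t := by
    intro x t ht; simp only [hWf]; positivity
  refine ⟨C, hC0, ?_⟩
  have key := aux_cmp (fun (x : Rn n) t => u t x - w t x - Wf x t)
    (fun x t => (cv J (u t) x - u t x - d (u t x) + cv (heatKernel n β) (fun y => b (u (t - τ) y)) x) -
      (cv J (w t) x - w t x - d (w t x) + cv (heatKernel n β) (fun y => b (w (t - τ) y)) x) - W' x t) 0 U 1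
    one_pos
    (fun x => ((uc_t H.hu.i.c x).sub (uc_t H.hw.i.c x)).continuousOn.sub
      fun t ht => (hWd x t ht).continuousAt.continuousWithinAt)
    (fun x => by
      have h1 : u 0 x - w 0 x ≤ U := (le_abs_self _).trans (hI.le 0 x)
      have h2 : U ≤ Wf x 0 := by
        simp only [hWf, add_zero]
        have h3 : U ≤ C * T0 ^ (-q) := by
          have : U * T0 ^ q * T0 ^ (-q) = U := by
            rw [mul_assoc, ← Real.rpow_add hT1]; simp
          have h5 : 0 ≤ 2 * C2 * T0 ^ (-q) := by positivity
          rw [hC, add_mul]; linarith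
        refine h3.trans (le_mul_of_one_le_right (by positivity) ?_)
        have := Real.exp_pos (lam * (x 0 + c * 0))
        linarith
      linarith)
    (fun x t ht => by
      have h1 : u t x - w t x ≤ U := (le_abs_self _).trans (hI.le t x)
      have := hW0 x t ht
      linarith)
    (fun x t ht => ((H.hu.e t ht x).sub (H.hw.e t ht x)).sub (hWd x t ht.le))
    (by
      intro K hK x t ht hz hs
      have hT : 0 < T0 + t := by linarith
      set Θ := (T0 + t) ^ (-q) with hΘ
      have hΘ0 : 0 < Θ := Real.rpow_pos_of_pos hT _
      set E := Real.exp (lam * (x 0 + c * t)) with hE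
      have hE0 : 0 < E := Real.exp_pos _
      have hWx : Wf x t = C * Θ * (1 + E) := rfl
      have hWnn := hW0 x t ht.le
      have hdd := (H.S.hd (w t x) (u t x) (by linarith)).1
      have hbb := (abs_le.1 (H.diff_b t x)).2
      have h1 : cv (heatKernel n β) (av u w (t - τ)) x ≤ C1 * 2 ^ q * Θ * E := by
        refine (hav (t - τ) (by linarith) x).trans ?_
        have h2 : (T0 + (t - τ)) ^ (-q) ≤ 2 ^ q * Θ := by
          have : (2 : ℝ) ^ q * Θ = ((T0 + t) / 2) ^ (-q) := by
            rw [Real.div_rpow hT.le (by norm_num), Real.rpow_neg (by norm_num : (0:ℝ) ≤ 2), div_inv_eq_mul, mul_comm]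
          rw [this]
          exact Real.rpow_le_rpow_of_nonpos (by linarith) (by linarith) (by linarith)
        have h3 : Real.exp (lam * (x 0 + c * (t - τ))) ≤ E := by
          rw [hE]; gcongr; linarith
        calc _ ≤ C1 * (2 ^ q * Θ) * E := by gcongr
          _ = _ := by ring
      have h2 : cv J (u t) x - cv J (w t) x ≤ C * Θ * (1 + E) / 4 + K + Kb * (C1 * Θ * E) := by
        rw [← cv_sub (cv_int H.S.kJ.int (uc_x H.hu.i.c t) (H.hu.i.abs t) x)
          (cv_int H.S.kJ.int (uc_x H.hw.i.c t) (H.hw.i.abs t) x)]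
        have i1 : Integrable fun y => (C * Θ * (1 + E)) * (Ja y * (1 + Real.exp (-lam * y 0))) := hJae.const_mul _
        have i2 : Integrable fun y => Ja y * K := hJai.mul_const K
        have i3 : Integrable fun y => Kb * (heatKernel n β y * av u w t (x - y)) :=
          (cv_int H.S.kf.int (uc_x hI.c t) (hI.abs t) x).const_mul Kb
        have j1 : cv J (u t - w t) x ≤ ∫ y, ((C * Θ * (1 + E)) * (Ja y * (1 + Real.exp (-lam * y 0))) + Ja y * K + Kb * (heatKernel n β y * av u w t (x - y))) := by
          refine integral_mono ?_ ((i1.add i2).add i3) (fun y => ?_)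
          · refine (cv_int H.S.kJ.int (g := u t - w t) ((uc_x H.hu.i.c t).sub (uc_x H.hw.i.c t)) (M := U) (fun y => hI.le t y) x)
          · have a1 := hs (x - y) t ht.le le_rfl
            have a2 : Wf (x - y) t ≤ (C * Θ * (1 + E)) * (1 + Real.exp (-lam * y 0)) := by
              simp only [hWf]
              rw [← hΘ, mul_assoc (C * Θ)]
              refine mul_le_mul_of_nonneg_left ?_ (by positivity)
              have : Real.exp (lam * ((x - y) 0 + c * t)) = E * Real.exp (-lam * y 0) := by
                rw [hE, ← Real.exp_add]; congr 1; simp only [PiLp.sub_apply]; ring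
              rw [this]
              have := Real.exp_pos (-lam * y 0)
              nlinarith
            have a3 : u t (x - y) - w t (x - y) ≤ (C * Θ * (1 + E)) * (1 + Real.exp (-lam * y 0)) + K := by linarith
            have a4 := le_abs_self (u t (x - y) - w t (x - y))
            have a5 := hJab y
            have a6 := hJaJ y
            have a7 := hJa0 y
            have a8 := hI.nn t (x - y)
            change J y * (u t (x - y) - w t (x - y)) ≤ _
            change u t (x - y) - w t (x - y) ≤ av u w t (x - y) at a4
            have b1 := mul_le_mul_of_nonneg_left a3 a7
            have b2 := mul_le_mul_of_nonneg_left a4 (by linarith : 0 ≤ J y - Ja y)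
            have b3 := mul_le_mul_of_nonneg_right (by linarith : J y - Ja y ≤ Kb * heatKernel n β y) a8
            linarith
        refine j1.trans ?_
        have i12 : Integrable fun y => (C * Θ * (1 + E)) * (Ja y * (1 + Real.exp (-lam * y 0))) + Ja y * K := i1.add i2
        rw [integral_add i12 i3, integral_add i1 i2, integral_const_mul, integral_mul_const, integral_const_mul]
        have m1 : ∫ y, Ja y ≤ 1 := by
          rw [← H.S.kJ.mass]; exact integral_mono hJai H.S.kJ.int hJaJ
        have m2 := hav t (by linarith) x
        have m3 := mul_le_mul_of_nonneg_left hJa4 (by positivity : 0 ≤ C * Θ * (1 + E))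
        have m4 := mul_le_mul_of_nonneg_right m1 hK
        have m5 := mul_le_mul_of_nonneg_left m2 hKb
        change _ + _ + Kb * cv (heatKernel n β) (av u w t) x ≤ _
        linarith
      have h3 : -(C * Θ * (1 + E) / 4) ≤ W' x t := by
        simp only [hW']
        have e1 : (T0 + t) ^ (-q - 1) = Θ / (T0 + t) := by rw [Real.rpow_sub_one hT.ne']
        rw [e1, ← hE, ← hΘ]
        have e2 : q * (Θ / (T0 + t)) ≤ Θ / 4 := by
          rw [mul_div_assoc', div_le_div_iff₀ hT (by norm_num)]
          nlinarith
        have e3 := mul_le_mul_of_nonneg_left e2 (by positivity : 0 ≤ C * (1 + E))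
        have e4 : 0 ≤ C * Θ * (E * (lam * c)) := by positivity
        linarith
      have h4 := mul_le_mul_of_nonneg_left h1 hB.le
      have h5 : 2 * C2 * (Θ * E) ≤ C * (Θ * E) := by
        have : 0 < U * T0 ^ q := by positivity
        gcongr; linarith
      have h6 : C2 * (Θ * E) = Kb * (C1 * Θ * E) + B * (C1 * 2 ^ q * Θ * E) := by rw [hC2]; ring
      have h7 : 0 ≤ C * Θ := by positivity
      rw [hWx] at hz
      linarith)
  intro t ht x
  have := key x t ht
  simp only [hWf] at this
  linarith

lemma Setup.Wb (H : Setup J d b D B U τ β c lam d1 P M u w) {T0 : ℝ} (hT1 : 0 < T0) (hT0 : 2 * τ ≤ T0)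
    (hTq : 4 * ((n : ℝ) / 2) ≤ T0) :
    ∃ C > 0, ∀ t ≥ 0, ∀ x, av u w t x ≤
      C * (T0 + t) ^ (-((n : ℝ) / 2)) * (1 + Real.exp (lam * (x 0 + c * t))) := by
  obtain ⟨C, hC, h⟩ := H.W_one hT1 hT0 hTq
  obtain ⟨C', hC', h'⟩ := H.symm.W_one hT1 hT0 hTq
  refine ⟨C + C', by positivity, fun t ht x => ?_⟩
  have h1 := h t ht x
  have h2 := h' t ht x
  have h3 : 0 ≤ (T0 + t) ^ (-((n : ℝ) / 2)) * (1 + Real.exp (lam * (x 0 + c * t))) := by positivity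
  have h4 := mul_nonneg hC.le h3
  have h5 := mul_nonneg hC'.le h3
  exact abs_le.2 ⟨by linarith, by linarith⟩

end

lemma tail_ex {n : ℕ} [NeZero n] {k : Rn n → ℝ} (hk : Kern k) {δ : ℝ} (hδ : 0 < δ) :
    ∃ L0 : ℝ, 0 ≤ L0 ∧ ∀ L ≥ L0, ∫ y, {y : Rn n | L < y 0}.indicator k y ≤ δ := by
  have h : Tendsto (fun L : ℝ => ∫ y, {y : Rn n | L < y 0}.indicator k y) atTop (nhds (∫ _ : Rn n, (0:ℝ))) := by
    apply tendsto_integral_filter_of_dominated_convergence (bound := k)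
    · refine Eventually.of_forall fun L => hk.int.aestronglyMeasurable.indicator ?_
      exact measurableSet_lt measurable_const (by fun_prop : Continuous fun y : Rn n => y 0).measurable
    · refine Eventually.of_forall fun L => Eventually.of_forall fun y => ?_
      refine (norm_indicator_le_norm_self _ _).trans ?_
      rw [Real.norm_of_nonneg (hk.nn y)]
    · exact hk.int
    · refine Eventually.of_forall fun y => tendsto_const_nhds.congr' ?_
      filter_upwards [eventually_ge_atTop (y 0)] with L hL
      rw [indicator_of_notMem]
      simpa using hL
  simp only [integral_zero] at h
  obtain ⟨L1, h1⟩ := eventually_atTop.1 (h.eventually (eventually_le_nhds hδ))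
  exact ⟨max L1 0, le_max_right _ _, fun L hL => h1 L ((le_max_left _ _).trans hL)⟩

lemma cv_ge_tail {n : ℕ} [NeZero n] {k g : Rn n → ℝ} (hk : Kern k) {x : Rn n}
    (hg : Integrable fun y => k y * g (x - y)) {δ L a e : ℝ}
    (hL : ∫ y, {y : Rn n | L < y 0}.indicator k y ≤ δ) (he : 0 ≤ e)
    (h1 : ∀ y : Rn n, y 0 ≤ L → a ≤ g (x - y)) (h2 : ∀ y : Rn n, a - e ≤ g (x - y)) :
    a - e * δ ≤ cv k g x := by
  have hm : MeasurableSet {y : Rn n | L < y 0} :=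
    measurableSet_lt measurable_const (by fun_prop : Continuous fun y : Rn n => y 0).measurable
  have i2 : Integrable fun y => e * {y : Rn n | L < y 0}.indicator k y :=
    (hk.int.indicator hm).const_mul e
  have i1 : Integrable fun y => k y * a := hk.int.mul_const a
  have : ∫ y, (k y * a - e * {y : Rn n | L < y 0}.indicator k y) ≤ cv k g x := by
    refine integral_mono (i1.sub i2) hg fun y => ?_
    have := hk.nn y
    by_cases hy : L < y 0
    · rw [indicator_of_mem (by exact hy)]
      nlinarith [h2 y]
    · rw [indicator_of_notMem (by exact hy)]
      nlinarith [h1 y (not_lt.1 hy)]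
  rw [integral_sub i1 i2, integral_mul_const, integral_const_mul, hk.mass] at this
  nlinarith

section
variable {n : ℕ} [NeZero n] {J : Rn n → ℝ} {d b : ℝ → ℝ} {D B U τ β c lam d1 P M : ℝ}
  {f : Rn n → ℝ} {u w : ℝ → Rn n → ℝ}

/-- propagation of positivity -/
lemma pos_prop (S : Sys J f d b D B U τ) (hu : Sol J f d b U τ u) (hc : 0 < c) {ε dh bh δ L xa xb T : ℝ}
    (hε : 0 < ε) (hdh : ∀ p, 0 ≤ p → p ≤ ε → d p ≤ dh * p)
    (hbh : ∀ p, 0 ≤ p → p ≤ ε → bh * p ≤ b p) (hbh0 : 0 ≤ bh) (hdh0 : 0 ≤ dh)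
    (hδ : δ * (1 + bh) ≤ bh - dh)
    (hJt : ∫ y, {y : Rn n | L < y 0}.indicator J y ≤ δ)
    (hft : ∫ y, {y : Rn n | L < y 0}.indicator f y ≤ δ)
    (hxb : xa + 1 + L + c * τ ≤ xb) (hL : 0 ≤ L) (hT : τ ≤ T)
    (hmid : ∀ t ≥ T, ∀ x : Rn n, xa ≤ x 0 + c * t → x 0 + c * t ≤ xb → ε ≤ u t x)
    (hini : ∀ t ∈ Icc (T - τ) T, ∀ x : Rn n, xa ≤ x 0 + c * t → ε ≤ u t x) :
    ∀ t ≥ T, ∀ x : Rn n, xa + 1 ≤ x 0 + c * t → ε ≤ u t x := by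
  have hτ := S.τ0
  have hcτ : 0 < c * τ := mul_pos hc hτ
  set z : Rn n → ℝ → ℝ := fun x t => ε * Real.smoothTransition (x 0 + c * t - xa) - u t x with hz
  have hSd : ∀ r, HasDerivAt Real.smoothTransition (deriv Real.smoothTransition r) r := fun r =>
    ((Real.smoothTransition.contDiff (n := 1)).differentiable (by norm_num) r).hasDerivAt
  have hS1 : ∀ r, 1 < r → deriv Real.smoothTransition r = 0 := by
    intro r hr
    have : Real.smoothTransition =ᶠ[nhds r] fun _ => 1 := by
      filter_upwards [lt_mem_nhds hr] with s hs
      exact Real.smoothTransition.one_of_one_le hs.le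
    rw [this.deriv_eq]; simp
  have hz0 : ∀ t ∈ Icc (T - τ) T, ∀ x, z x t ≤ 0 := by
    intro t ht x
    simp only [hz]
    rcases le_total (x 0 + c * t) xa with h | h
    · rw [Real.smoothTransition.zero_of_nonpos (by linarith)]
      linarith [hu.i.nn t x]
    · have h1 := hini t ht x h
      have h2 := Real.smoothTransition.le_one (x 0 + c * t - xa)
      nlinarith
  have key := aux_cmp z (fun x t => ε * (deriv Real.smoothTransition (x 0 + c * t - xa) * c) -
      (cv J (u t) x - u t x - d (u t x) + cv f (fun y => b (u (t - τ) y)) x)) T ε (1 + bh) (by linarith)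
    (fun x => by
      have h1 := uc_t hu.i.c x
      have h2 : Continuous Real.smoothTransition := Real.smoothTransition.continuous
      exact ((continuous_const.mul (h2.comp (by fun_prop))).sub h1).continuousOn)
    (fun x => hz0 T ⟨by linarith, le_rfl⟩ x)
    (fun x t ht => by
      have h2 := Real.smoothTransition.le_one (x 0 + c * t - xa)
      have := hu.i.nn t x
      simp only [hz]
      nlinarith)
    (fun x t ht => by
      have h1 : HasDerivAt (fun t : ℝ => x 0 + c * t - xa) c t := by
        simpa using (((hasDerivAt_id t).const_mul c).const_add (x 0)).sub_const xa
      exact (((hSd _).comp t h1).const_mul ε).sub (hu.e t (by linarith) x))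
    (by
      intro K hK x t ht hzt hs
      have hge : ∀ s, T - τ ≤ s → s ≤ t → ∀ y : Rn n, ε * Real.smoothTransition (y 0 + c * s - xa) - K ≤ u s y := by
        intro s h1 h2 y
        rcases le_total T s with h | h
        · have := hs y s h h2
          simp only [hz] at this; linarith
        · have := hz0 s ⟨h1, h⟩ y
          simp only [hz] at this; linarith
      have hx1 : xa < x 0 + c * t := by
        by_contra hcon
        simp only [hz] at hzt
        rw [Real.smoothTransition.zero_of_nonpos (by linarith)] at hzt
        linarith [hu.i.nn t x]
      have hp : u t x < ε := by
        simp only [hz] at hzt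
        have h2 := Real.smoothTransition.le_one (x 0 + c * t - xa)
        nlinarith
      have hx2 : xb < x 0 + c * t := by
        by_contra hcon
        have := hmid t ht.le x hx1.le (by linarith)
        linarith
      rw [hS1 _ (by linarith)]
      have hST : ∀ r, 1 ≤ r → ε * Real.smoothTransition r = ε := fun r hr => by
        rw [Real.smoothTransition.one_of_one_le hr, mul_one]
      have hSn : ∀ r, 0 ≤ ε * Real.smoothTransition r := fun r =>
        mul_nonneg hε.le (Real.smoothTransition.nonneg r)
      have g1 : (ε - K) - ε * δ ≤ cv J (u t) x := by
        refine cv_ge_tail S.kJ (cv_int S.kJ.int (uc_x hu.i.c t) (hu.i.abs t) x) hJt hε.le ?_ ?_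
        · intro y hy
          have := hge t (by linarith) le_rfl (x - y)
          rw [hST _ (by simp only [PiLp.sub_apply]; linarith)] at this
          exact this
        · intro y
          have := hge t (by linarith) le_rfl (x - y)
          have := hSn ((x - y) 0 + c * t - xa)
          linarith
      have hbm : ∀ p q, 0 ≤ p → q ≤ p → q ≤ ε → bh * q ≤ b p := by
        intro p q h1 h2 h3
        rcases le_total p ε with h | h
        · exact (mul_le_mul_of_nonneg_left h2 hbh0).trans (hbh p h1 h)
        · have := (S.hb ε p h).1
          have := hbh ε hε.le le_rfl
          nlinarith
      have g2 : (bh * (ε - K)) - (bh * ε) * δ ≤ cv f (fun y => b (u (t - τ) y)) x := by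
        have hI := S.bIn hu.i
        refine cv_ge_tail S.kf (cv_int S.kf.int (uc_x hI.c t) (hI.abs t) x) hft (by positivity) ?_ ?_
        · intro y hy
          have := hge (t - τ) (by linarith) (by linarith) (x - y)
          rw [hST _ (by simp only [PiLp.sub_apply]; linarith)] at this
          exact hbm _ _ (hu.i.nn _ _) this (by linarith)
        · intro y
          have h1 := hge (t - τ) (by linarith) (by linarith) (x - y)
          have h2 := hSn ((x - y) 0 + c * (t - τ) - xa)
          have := hbm _ (-K) (hu.i.nn (t - τ) (x - y)) (by linarith) (by linarith)
          linarith
      have g3 := hdh _ (hu.i.nn t x) hp.le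
      have g4 := mul_le_mul_of_nonneg_left hp.le hdh0
      have g5 := mul_le_mul_of_nonneg_left hδ hε.le
      linarith)
  intro t ht x hx
  have h1 := key x t ht
  simp only [hz] at h1
  rw [Real.smoothTransition.one_of_one_le (by linarith)] at h1
  linarith

/-- final comparison, one-sided -/
lemma fin_one (S : Sys J f d b D B U τ) (hu : Sol J f d b U τ u) (hw : Sol J f d b U τ w) (hc : 0 < c)
    {Ds Bs δ L X x1 T T0 Ms q : ℝ} (hq : 0 ≤ q) (hMs : 0 < Ms) (hDs : 0 ≤ Ds) (hBs : 0 ≤ Bs) (hδ0 : 0 ≤ δ)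
    (hd : ∀ t ≥ T - τ, ∀ x : Rn n, X ≤ x 0 + c * t → w t x ≤ u t x →
      Ds * (u t x - w t x) ≤ d (u t x) - d (w t x) ∧ b (u t x) - b (w t x) ≤ Bs * (u t x - w t x))
    (hft : ∫ y, {y : Rn n | L < y 0}.indicator f y ≤ δ)
    (hx1 : X + L + c * τ ≤ x1) (hL : 0 ≤ L) (hT : τ ≤ T) (hT0 : 0 < T0)
    (hS : ∀ s ≥ T0, (Bs + B * δ) * (s - τ) ^ (-q) + q * s ^ (-q - 1) ≤ Ds * s ^ (-q))
    (hSt : U ≤ Ms * (T0 + T) ^ (-q))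
    (hmid : ∀ t ≥ T, ∀ x : Rn n, x 0 + c * t ≤ x1 → u t x - w t x ≤ Ms * (T0 + t) ^ (-q)) :
    ∀ t ≥ T, ∀ x : Rn n, u t x - w t x ≤ Ms * (T0 + t) ^ (-q) := by
  have hτ := S.τ0
  have hcτ : 0 < c * τ := mul_pos hc hτ
  have hvU : ∀ t x, u t x - w t x ≤ U := fun t x => by
    linarith [hu.i.le t x, hw.i.nn t x]
  have hd' : ∀ t : ℝ, 0 < T0 + t → HasDerivAt (fun t => Ms * (T0 + t) ^ (-q)) (Ms * (-(q * (T0 + t) ^ (-q - 1)))) t := by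
    intro t ht
    have h1 : HasDerivAt (fun t : ℝ => T0 + t) 1 t := (hasDerivAt_id t).const_add T0
    have := (h1.rpow_const (p := -q) (Or.inl ht.ne')).const_mul Ms
    have e : Ms * (-(q * (T0 + t) ^ (-q - 1))) = Ms * (1 * -q * (T0 + t) ^ (-q - 1)) := by ring
    rw [e]; exact this
  have key := aux_cmp (fun x t => (u t x - w t x) - Ms * (T0 + t) ^ (-q))
    (fun x t => ((cv J (u t) x - u t x - d (u t x) + cv f (fun y => b (u (t - τ) y)) x) -
      (cv J (w t) x - w t x - d (w t x) + cv f (fun y => b (w (t - τ) y)) x)) -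
      (Ms * (-(q * (T0 + t) ^ (-q - 1))))) T U (1 + Bs + B * δ) (by have := S.B0; positivity)
    (fun x t ht => by
      have ht' : T ≤ t := ht
      exact (((uc_t hu.i.c x).sub (uc_t hw.i.c x)).continuousAt.sub
        (hd' t (by linarith)).continuousAt).continuousWithinAt)
    (fun x => by linarith [hvU T x])
    (fun x t ht => by
      have : 0 < Ms * (T0 + t) ^ (-q) := mul_pos hMs (Real.rpow_pos_of_pos (by linarith) _)
      linarith [hvU t x])
    (fun x t ht => ((hu.e t (by linarith) x).sub (hw.e t (by linarith) x)).sub (hd' t (by linarith)))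
    (by
      intro K hK x t ht hzt hs
      have hB0 := S.B0
      have hpos : ∀ s, T - τ ≤ s → 0 < Ms * (T0 + s) ^ (-q) := fun s hs =>
        mul_pos hMs (Real.rpow_pos_of_pos (by linarith) _)
      have hge : ∀ s, T - τ ≤ s → s ≤ t → ∀ y : Rn n, u s y - w s y ≤ Ms * (T0 + s) ^ (-q) + K := by
        intro s h1 h2 y
        rcases le_total T s with h | h
        · have := hs y s h h2
          linarith
        · have : Ms * (T0 + T) ^ (-q) ≤ Ms * (T0 + s) ^ (-q) :=
            mul_le_mul_of_nonneg_left (Real.rpow_le_rpow_of_nonpos (by linarith) (by linarith) (by linarith)) hMs.le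
          linarith [hvU s y]
      have hxx : x1 < x 0 + c * t := by
        by_contra hcon
        have := hmid t ht.le x (by linarith)
        linarith
      have hd1 := (hd t (by linarith) x (by linarith) (by linarith [hpos t (by linarith)])).1
      have g1 : cv J (u t) x - cv J (w t) x ≤ Ms * (T0 + t) ^ (-q) + K := by
        rw [← cv_sub (cv_int S.kJ.int (uc_x hu.i.c t) (hu.i.abs t) x)
          (cv_int S.kJ.int (uc_x hw.i.c t) (hw.i.abs t) x)]
        refine cv_le S.kJ ((uc_x hu.i.c t).sub (uc_x hw.i.c t)) (M := U) (fun y => ?_)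
          (hge t (by linarith) le_rfl) x
        change |u t y - w t y| ≤ U
        exact abs_le.2 ⟨by linarith [hw.i.le t y, hu.i.nn t y], hvU t y⟩
      set R := Ms * (T0 + (t - τ)) ^ (-q) + K with hR
      have hR0 : 0 ≤ R := by linarith [hpos (t - τ) (by linarith)]
      have g2 : cv f (fun y => b (u (t - τ) y)) x - cv f (fun y => b (w (t - τ) y)) x ≤ Bs * R + B * R * δ := by
        have i1 := S.bIn hu.i
        have i2 := S.bIn hw.i
        have j1 := cv_int S.kf.int (uc_x i1.c t) (i1.abs t) x
        have j2 := cv_int S.kf.int (uc_x i2.c t) (i2.abs t) x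
        have j3 : Integrable fun y => f y * (b (w (t - τ) (x - y)) - b (u (t - τ) (x - y))) := by
          simp only [mul_sub]; exact j2.sub j1
        have := cv_ge_tail (g := fun y => b (w (t - τ) y) - b (u (t - τ) y)) (a := -(Bs * R)) (e := B * R) S.kf j3 hft (by positivity) ?_ ?_
        · rw [cv_sub j2 j1] at this
          linarith
        · intro y hy
          have h1 := hge (t - τ) (by linarith) (by linarith) (x - y)
          rcases le_total (w (t - τ) (x - y)) (u (t - τ) (x - y)) with h | h
          · have h2 := (hd (t - τ) (by linarith) (x - y) (by simp only [PiLp.sub_apply]; linarith) h).2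
            have := mul_le_mul_of_nonneg_left h1 hBs
            linarith
          · have := (S.hb _ _ h).1
            have : 0 ≤ Bs * R := by positivity
            linarith
        · intro y
          have h1 := hge (t - τ) (by linarith) (by linarith) (x - y)
          have h4 : 0 ≤ Bs * R := by positivity
          rcases le_total (w (t - τ) (x - y)) (u (t - τ) (x - y)) with h | h
          · have h2 := (S.hb _ _ h).2
            have := mul_le_mul_of_nonneg_left h1 hB0
            linarith
          · have := (S.hb _ _ h).1
            have : 0 ≤ B * R := by positivity
            linarith
      have g3 := mul_le_mul_of_nonneg_left (hS (T0 + t) (by linarith)) hMs.le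
      have g4 := mul_le_mul_of_nonneg_left hzt.le hDs
      have e1 : T0 + t - τ = T0 + (t - τ) := by ring
      rw [e1] at g3
      have e2 : Bs * R + B * R * δ = Ms * ((Bs + B * δ) * (T0 + (t - τ)) ^ (-q)) + (Bs + B * δ) * K := by
        rw [hR]; ring
      linarith)
  intro t ht x
  have := key x t ht
  linarith

lemma S_ex {q τ A Ds : ℝ} (h : A < Ds) :
    ∃ T1 : ℝ, ∀ s ≥ T1, A * (s - τ) ^ (-q) + q * s ^ (-q - 1) ≤ Ds * s ^ (-q) := by
  have h1 : Tendsto (fun s : ℝ => A * (1 - τ * s⁻¹) ^ (-q) + q * s⁻¹) atTop (nhds (A * (1 - τ * 0) ^ (-q) + q * 0)) := by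
    have hi := tendsto_inv_atTop_zero (𝕜 := ℝ)
    refine (((tendsto_const_nhds.sub (hi.const_mul τ)).rpow_const ?_).const_mul A).add (hi.const_mul q)
    left; norm_num
  have h2 : A * (1 - τ * 0) ^ (-q) + q * 0 < Ds := by simpa using h
  obtain ⟨T1, hT⟩ := eventually_atTop.1 ((h1.eventually (gt_mem_nhds h2)).and ((eventually_gt_atTop 0).and (eventually_ge_atTop τ)))
  refine ⟨T1, fun s hs => ?_⟩
  obtain ⟨a1, a2, a3⟩ := hT s hs
  have e1 : (s - τ) ^ (-q) = s ^ (-q) * (1 - τ * s⁻¹) ^ (-q) := by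
    rw [← Real.mul_rpow a2.le]
    · congr 1; field_simp
    · rw [sub_nonneg, ← div_eq_mul_inv, div_le_one a2]; exact a3
  rw [e1, Real.rpow_sub_one a2.ne']
  have := mul_le_mul_of_nonneg_left a1.le (Real.rpow_pos_of_pos a2 (-q)).le
  calc _ = s ^ (-q) * (A * (1 - τ * s⁻¹) ^ (-q) + q * s⁻¹) := by ring
    _ ≤ _ := by linarith

end

section
variable {n : ℕ} [NeZero n] {J : Rn n → ℝ} {d b : ℝ → ℝ} {D B U τ β c lam d1 P M : ℝ}
  {u w : ℝ → Rn n → ℝ}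

lemma hk_conv_zero {a : Rn n → ℝ} (hβ : 0 < β) (ha : Integrable a) (ha0 : ∀ y, 0 ≤ a y) :
    Tendsto (fun x => cv (heatKernel n β) a x) (cocompact (Rn n)) (nhds 0) := by
  have hcg : IsCountablyGenerated (cocompact (Rn n)) := by
    rw [← Metric.cobounded_eq_cocompact, ← comap_norm_atTop]; infer_instance
  simp only [← cv_eq]
  rw [show (0:ℝ) = ∫ _ : Rn n, (0:ℝ) by simp]
  apply tendsto_integral_filter_of_dominated_convergence (bound := fun y => (4 * π * β) ^ (-(n : ℝ) / 2) * a y)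
  · refine Eventually.of_forall fun x => ?_
    exact (((hk_cont n β).comp (by fun_prop)).aestronglyMeasurable).mul ha.aestronglyMeasurable
  · refine Eventually.of_forall fun x => Eventually.of_forall fun y => ?_
    rw [Real.norm_of_nonneg (mul_nonneg (hk_pos n hβ _).le (ha0 y))]
    exact mul_le_mul_of_nonneg_right (hk_bdd hβ _) (ha0 y)
  · exact ha.const_mul _
  · refine Eventually.of_forall fun y => ?_
    have h1 : Tendsto (fun x : Rn n => x - y) (cocompact (Rn n)) (cocompact (Rn n)) := by
      simpa [sub_eq_add_neg] using (Homeomorph.addRight (-y)).isClosedEmbedding.tendsto_cocompact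
    simpa using ((hk_zero hβ).comp h1).mul_const (a y)

lemma ini_low (S : Sys J (heatKernel n β) d b D B U τ)
    (hu : Sol J (heatKernel n β) d b U τ u) {κ : ℝ} (hκ : 0 < κ) (hκb : ∀ p, 0 ≤ p → p ≤ U → κ * p ≤ b p) (x : Rn n) :
    Real.exp (-((1 + D) * τ)) * (κ * ∫ s in (0:ℝ)..τ, cv (heatKernel n β) (u (s - τ)) x) ≤ u τ x ∧
    ∀ t ≥ τ, Real.exp (-((1 + D) * (t - τ))) * u τ x ≤ u t x := by
  have hτ := S.τ0
  have hI := shift_In hu.i τ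
  have hcc : Continuous fun s => cv (heatKernel n β) (u (s - τ)) x :=
    uc_t (cv_cont S.kf.int hI.c hI.abs) x
  have hcn : ∀ s, 0 ≤ cv (heatKernel n β) (u (s - τ)) x := fun s =>
    le_cv S.kf (uc_x hI.c s) (hI.abs s) (hI.nn s) x
  have hder : ∀ t > 0, HasDerivAt (fun t => Real.exp ((1 + D) * t) * u t x)
      (Real.exp ((1 + D) * t) * rhs J (heatKernel n β) d b D τ u t x) t := by
    intro t ht
    have h1 : HasDerivAt (fun t => Real.exp ((1 + D) * t)) (Real.exp ((1 + D) * t) * (1 + D)) t := by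
      simpa using ((hasDerivAt_id t).const_mul (1 + D)).exp
    have h2 := h1.mul (hu.e t ht x)
    have e : Real.exp ((1 + D) * t) * rhs J (heatKernel n β) d b D τ u t x = Real.exp ((1 + D) * t) * (1 + D) * u t x +
        Real.exp ((1 + D) * t) * (cv J (u t) x - u t x - d (u t x) + cv (heatKernel n β) (fun y => b (u (t - τ) y)) x) := by
      unfold rhs; ring
    rw [e]; exact h2
  have hlow : ∀ t, κ * cv (heatKernel n β) (u (t - τ)) x ≤ rhs J (heatKernel n β) d b D τ u t x := by
    intro t
    refine le_trans ?_ (S.rhs_nn hu.i t x).1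
    rw [← cv_smul]
    have h2 := S.bIn hu.i
    refine cv_mono S.kf.nn ?_ (cv_int S.kf.int (uc_x h2.c t) (h2.abs t) x) (fun y => hκb _ (hu.i.nn _ _) (hu.i.le _ _))
    have := (cv_int S.kf.int (uc_x hI.c t) (hI.abs t) x).const_mul κ
    refine this.congr (Eventually.of_forall fun y => ?_)
    simp only []; ring
  have hec : Continuous fun t => Real.exp ((1 + D) * t) * u t x :=
    (by fun_prop : Continuous fun t : ℝ => Real.exp ((1 + D) * t)).mul (uc_t hu.i.c x)
  have hD := S.D0
  constructor
  · have hprim : ∀ t, HasDerivAt (fun t => ∫ s in (0:ℝ)..t, cv (heatKernel n β) (u (s - τ)) x)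
        (cv (heatKernel n β) (u (t - τ)) x) t := fun t =>
      intervalIntegral.integral_hasDerivAt_right (hcc.intervalIntegrable _ _)
        hcc.aestronglyMeasurable.stronglyMeasurableAtFilter hcc.continuousAt
    have hmon : MonotoneOn (fun t => Real.exp ((1 + D) * t) * u t x - κ * ∫ s in (0:ℝ)..t, cv (heatKernel n β) (u (s - τ)) x) (Icc 0 τ) := by
      apply monotoneOn_of_hasDerivWithinAt_nonneg (convex_Icc 0 τ)
        (f' := fun t => Real.exp ((1 + D) * t) * rhs J (heatKernel n β) d b D τ u t x - κ * cv (heatKernel n β) (u (t - τ)) x)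
      · exact (hec.sub (continuous_const.mul (continuous_iff_continuousAt.2 fun t => (hprim t).continuousAt))).continuousOn
      · intro t ht
        rw [interior_Icc] at ht
        exact ((hder t ht.1).sub ((hprim t).const_mul κ)).hasDerivWithinAt
      · intro t ht
        rw [interior_Icc] at ht
        have h1 := hlow t
        have h2 : 1 ≤ Real.exp ((1 + D) * t) := Real.one_le_exp (mul_nonneg (by linarith) ht.1.le)
        have h3 := (S.rhs_nn hu.i t x).2
        nlinarith
    have := hmon ⟨le_rfl, hτ.le⟩ ⟨hτ.le, le_rfl⟩ hτ.le
    simp only [mul_zero, Real.exp_zero, one_mul, intervalIntegral.integral_same, sub_zero] at this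
    have h0 := hu.i.nn 0 x
    have h4 := mul_le_mul_of_nonneg_left (by linarith : κ * (∫ s in (0:ℝ)..τ, cv (heatKernel n β) (u (s - τ)) x) ≤ Real.exp ((1 + D) * τ) * u τ x) (Real.exp_pos (-((1 + D) * τ))).le
    rw [← mul_assoc, ← mul_assoc, ← Real.exp_add, neg_add_cancel, Real.exp_zero, one_mul, mul_assoc] at h4
    exact h4
  · intro t ht
    have hmon : MonotoneOn (fun t => Real.exp ((1 + D) * t) * u t x) (Ici τ) := by
      apply monotoneOn_of_hasDerivWithinAt_nonneg (convex_Ici τ)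
        (f' := fun t => Real.exp ((1 + D) * t) * rhs J (heatKernel n β) d b D τ u t x) hec.continuousOn
      · intro t ht
        rw [interior_Ici] at ht
        have ht' : τ < t := ht
        exact (hder t (by linarith)).hasDerivWithinAt
      · intro t ht
        exact mul_nonneg (Real.exp_pos _).le (S.rhs_nn hu.i t x).2
    have h1 : Real.exp ((1 + D) * τ) * u τ x ≤ Real.exp ((1 + D) * t) * u t x := hmon self_mem_Ici ht ht
    have h4 := mul_le_mul_of_nonneg_left h1 (Real.exp_pos (-((1 + D) * t))).le
    rw [← mul_assoc, ← mul_assoc, ← Real.exp_add, ← Real.exp_add, neg_add_cancel, Real.exp_zero, one_mul] at h4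
    have e : -((1 + D) * (t - τ)) = -((1 + D) * t) + (1 + D) * τ := by ring
    rw [e]; exact h4

lemma ini_pos (S : Sys J (heatKernel n β) d b D B U τ) (hβ : 0 < β) (hc : 0 < c)
    (hu : Sol J (heatKernel n β) d b U τ u) (hw : Sol J (heatKernel n β) d b U τ w)
    {κ : ℝ} (hκ : 0 < κ) (hκb : ∀ p, 0 ≤ p → p ≤ U → κ * p ≤ b p)
    (hv : ∀ s ∈ Icc (-τ) 0, Integrable (av u w s))
    {φ : ℝ → ℝ} (hφ : Monotone φ) (hφc : Continuous φ) (hwφ : ∀ t x, w t x = φ (x 0 + c * t)) {xa : ℝ} (hxa : 0 < φ xa) (X0 : ℝ) :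
    ∃ ε > 0, ∀ x : Rn n, X0 ≤ x 0 → ε ≤ u τ x := by
  have hτ := S.τ0
  have hcτ : 0 < c * τ := mul_pos hc hτ
  set f := heatKernel n β with hf
  have hcg : IsCountablyGenerated (cocompact (Rn n)) := by
    rw [← Metric.cobounded_eq_cocompact, ← comap_norm_atTop]; infer_instance
  have hφ0 : ∀ r, 0 ≤ φ r := fun r => by
    have := hw.i.nn 0 (EuclideanSpace.single 0 r)
    rw [hwφ] at this; simpa using this
  have hφU : ∀ r, φ r ≤ U := fun r => by
    have := hw.i.le 0 (EuclideanSpace.single 0 r)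
    rw [hwφ] at this; simpa using this
  set a0 := ∫ y : Rn n, f y * φ (X0 - y 0 - c * τ) with ha0
  have hai : Integrable fun y : Rn n => f y * φ (X0 - y 0 - c * τ) := by
    refine S.kf.int.mul_bdd (c := U) (hφc.comp (by fun_prop)).aestronglyMeasurable (Eventually.of_forall fun y => ?_)
    rw [Real.norm_of_nonneg (hφ0 _)]; exact hφU _
  have ha0p : 0 < a0 := by
    refine integral_pos_of_integrable_nonneg_nonzero (x := EuclideanSpace.single 0 (X0 - c * τ - xa)) ((hk_cont n β).mul (hφc.comp (by fun_prop))) hai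
      (fun y => mul_nonneg (S.kf.nn y) (hφ0 _)) ?_
    have := hk_pos n hβ (EuclideanSpace.single 0 (X0 - c * τ - xa))
    refine (mul_pos this ?_).ne'
    have e : X0 - (X0 - c * τ - xa) - c * τ = xa := by ring
    simpa [e] using hxa
  -- lower bound for the mollified solution
  have hlb : ∀ s ∈ Icc (-τ) 0, ∀ x : Rn n, X0 ≤ x 0 → a0 - cv f (av u w s) x ≤ cv f (u s) x := by
    intro s hs x hx
    have hA : Continuous (av u w s) := ((uc_x hu.i.c s).sub (uc_x hw.i.c s)).abs
    have hAb : ∀ y, |av u w s y| ≤ U := fun y => by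
      rw [av, abs_abs]
      exact abs_le.2 ⟨by linarith [hu.i.nn s y, hw.i.le s y], by linarith [hu.i.le s y, hw.i.nn s y]⟩
    have j1 := cv_int S.kf.int (uc_x hu.i.c s) (hu.i.abs s) x
    have j2 := cv_int S.kf.int hA hAb x
    have : a0 ≤ cv f (fun y => u s y + av u w s y) x := by
      refine integral_mono hai ?_ fun y => ?_
      · simp only [mul_add]; exact j1.add j2
      · refine mul_le_mul_of_nonneg_left ?_ (S.kf.nn y)
        have h1 : φ (X0 - y 0 - c * τ) ≤ w s (x - y) := by
          rw [hwφ]; apply hφ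
          have := mul_le_mul_of_nonneg_left hs.1 hc.le
          simp only [PiLp.sub_apply]; linarith
        have := neg_abs_le (u s (x - y) - w s (x - y))
        change _ ≤ u s (x - y) + |u s (x - y) - w s (x - y)|
        linarith
    rw [cv_add j1 j2] at this
    linarith
  have hz : ∀ s ∈ Icc (-τ) 0, Tendsto (fun x => cv f (av u w s) x) (cocompact (Rn n)) (nhds 0) :=
    fun s hs => hk_conv_zero hβ (hv s hs) (fun y => abs_nonneg _)
  have hAI : In U (av u w) := 
    { c := (hu.i.c.sub hw.i.c).abs
      nn := fun t x => abs_nonneg _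
      le := fun s y => abs_le.2 ⟨by linarith [hu.i.nn s y, hw.i.le s y], by linarith [hu.i.le s y, hw.i.nn s y]⟩ }
  have hAs := shift_In hAI τ
  have hus := shift_In hu.i τ
  -- nontriviality
  have hpos : ∀ s ∈ Icc (-τ) 0, ∀ x, 0 < cv f (u s) x := by
    intro s hs
    have : ∃ y, u s y ≠ 0 := by
      by_contra hcon
      push Not at hcon
      have h1 : Tendsto (fun r : ℝ => (EuclideanSpace.single (0 : Fin n) r : Rn n)) atTop (cocompact (Rn n)) := by
        rw [← Metric.cobounded_eq_cocompact, ← tendsto_norm_atTop_iff_cobounded]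
        simpa using tendsto_abs_atTop_atTop
      have h2 := ((hz s hs).comp h1).eventually (gt_mem_nhds ha0p)
      obtain ⟨r, hr1, hr2⟩ := (h2.and (eventually_ge_atTop X0)).exists
      have h3 := hlb s hs (EuclideanSpace.single 0 r) (by simpa using hr2)
      have h4 : cv f (u s) (EuclideanSpace.single 0 r) = 0 := by
        unfold cv; simp [hcon]
      simp only [Function.comp_apply] at hr1
      linarith
    obtain ⟨y, hy⟩ := this
    intro x
    refine integral_pos_of_integrable_nonneg_nonzero (x := x - y) ((hk_cont n β).mul ((uc_x hu.i.c s).comp (by fun_prop)))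
      (cv_int S.kf.int (uc_x hu.i.c s) (hu.i.abs s) x) (fun y => mul_nonneg (S.kf.nn y) (hu.i.nn s _)) ?_
    refine mul_ne_zero (hk_pos n hβ _).ne' ?_
    simpa using hy
  set G : Rn n → ℝ := fun x => ∫ s in (0:ℝ)..τ, cv f (av u w (s - τ)) x with hG
  have hccG : ∀ x, Continuous fun s => cv f (av u w (s - τ)) x := fun x =>
    uc_t (cv_cont S.kf.int hAs.c hAs.abs) x
  have hccF : ∀ x, Continuous fun s => cv f (u (s - τ)) x := fun x =>
    uc_t (cv_cont S.kf.int hus.c hus.abs) x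
  have hG0 : Tendsto G (cocompact (Rn n)) (nhds 0) := by
    rw [show (0:ℝ) = ∫ s in (0:ℝ)..τ, (0:ℝ) by simp]
    apply intervalIntegral.tendsto_integral_filter_of_dominated_convergence (bound := fun _ => U)
    · exact Eventually.of_forall fun x => (hccG x).aestronglyMeasurable
    · refine Eventually.of_forall fun x => Eventually.of_forall fun s _ => ?_
      rw [Real.norm_of_nonneg (le_cv S.kf (uc_x hAs.c s) (hAs.abs s) (hAs.nn s) x)]
      exact cv_le S.kf (uc_x hAs.c s) (hAs.abs s) (hAs.le s) x
    · exact intervalIntegrable_const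
    · refine Eventually.of_forall fun s hs => ?_
      rw [uIoc_of_le hτ.le] at hs
      exact hz (s - τ) ⟨by linarith [hs.1], by linarith [hs.2]⟩
  have hFG : ∀ x : Rn n, X0 ≤ x 0 → a0 * τ - G x ≤ ∫ s in (0:ℝ)..τ, cv f (u (s - τ)) x := by
    intro x hx
    have e : a0 * τ - G x = ∫ s in (0:ℝ)..τ, (a0 - cv f (av u w (s - τ)) x) := by
      rw [intervalIntegral.integral_sub intervalIntegrable_const ((hccG x).intervalIntegrable _ _)]
      simp [hG, mul_comm]
    rw [e]
    refine intervalIntegral.integral_mono_on hτ.le ((continuous_const.sub (hccG x)).intervalIntegrable _ _) ((hccF x).intervalIntegrable _ _) fun s hs => ?_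
    exact hlb (s - τ) ⟨by linarith [hs.1], by linarith [hs.2]⟩ x hx
  have hup : ∀ x, 0 < u τ x := by
    intro x
    refine lt_of_lt_of_le ?_ (ini_low S hu hκ hκb x).1
    have : 0 < ∫ s in (0:ℝ)..τ, cv f (u (s - τ)) x :=
      intervalIntegral.intervalIntegral_pos_of_pos_on ((hccF x).intervalIntegrable _ _)
        (fun s hs => hpos (s - τ) ⟨by linarith [hs.1], by linarith [hs.2]⟩ x) hτ
    positivity
  have hev := hG0.eventually (gt_mem_nhds (by positivity : 0 < a0 * τ / 2))
  obtain ⟨Kc, hKc, hsub⟩ := mem_cocompact.1 hev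
  have hmin : ∃ ε > 0, ∀ x ∈ Kc, ε ≤ u τ x := by
    rcases Kc.eq_empty_or_nonempty with he | hne
    · exact ⟨1, one_pos, by simp [he]⟩
    · obtain ⟨x, hx, hm⟩ := hKc.exists_isMinOn hne (uc_x hu.i.c τ).continuousOn
      exact ⟨u τ x, hup x, fun y hy => hm hy⟩
  obtain ⟨ε, hε, he⟩ := hmin
  refine ⟨min ε (Real.exp (-((1 + D) * τ)) * (κ * (a0 * τ / 2))), lt_min hε (by positivity), fun x hx => ?_⟩
  by_cases hxK : x ∈ Kc
  · exact (min_le_left _ _).trans (he x hxK)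
  · refine (min_le_right _ _).trans (le_trans ?_ (ini_low S hu hκ hκb x).1)
    have h1 : G x < a0 * τ / 2 := hsub hxK
    have h2 := hFG x hx
    gcongr
    linarith

end

lemma slope_ge {d : ℝ → ℝ} {U ε p r φ0 : ℝ} (hd : ConvexOn ℝ (Icc 0 U) d) (hε : 0 ≤ ε) (h1 : ε < φ0)
    (hp : ε ≤ p) (hpr : p ≤ r) (hr : φ0 ≤ r) (hrU : r ≤ U) :
    (d φ0 - d ε) / (φ0 - ε) * (r - p) ≤ d r - d p := by
  rcases hpr.eq_or_lt with h | h
  · subst h; simp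
  · have a2 : (d φ0 - d ε) / (φ0 - ε) ≤ (d r - d ε) / (r - ε) :=
      hd.secant_mono ⟨hε, by linarith⟩ ⟨by linarith, by linarith⟩ ⟨by linarith, hrU⟩ h1.ne' (by linarith : ε < r).ne' hr
    have a3 : (d ε - d r) / (ε - r) ≤ (d p - d r) / (p - r) :=
      hd.secant_mono ⟨by linarith, hrU⟩ ⟨hε, by linarith⟩ ⟨by linarith, by linarith⟩ (by linarith : ε < r).ne h.ne hp
    rw [← neg_div_neg_eq, ← neg_div_neg_eq (d p - d r)] at a3
    simp only [neg_sub] at a3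
    exact (le_div_iff₀ (by linarith)).1 (a2.trans a3)

lemma slope_le {b : ℝ → ℝ} {U ε p r φ0 : ℝ} (hb : ConcaveOn ℝ (Icc 0 U) b) (hε : 0 ≤ ε) (h1 : ε < φ0)
    (hp : ε ≤ p) (hpr : p ≤ r) (hr : φ0 ≤ r) (hrU : r ≤ U) :
    b r - b p ≤ (b φ0 - b ε) / (φ0 - ε) * (r - p) := by
  have h := slope_ge hb.neg hε h1 hp hpr hr hrU
  simp only [Pi.neg_apply] at h
  have e : (-b φ0 - -b ε) / (φ0 - ε) = -((b φ0 - b ε) / (φ0 - ε)) := by ring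
  rw [e] at h
  linarith

lemma chord_le {d : ℝ → ℝ} {U e p : ℝ} (hd : ConvexOn ℝ (Icc 0 U) d) (hd0 : d 0 = 0) (he : 0 < e) (heU : e ≤ U)
    (hp : 0 ≤ p) (hpe : p ≤ e) : d p ≤ d e / e * p := by
  have h0 : (0:ℝ) ∈ Icc 0 U := ⟨le_rfl, by linarith⟩
  have h1 : e ∈ Icc 0 U := ⟨he.le, heU⟩
  have h := hd.2 h0 h1 (by rw [sub_nonneg, div_le_one he]; exact hpe : (0:ℝ) ≤ 1 - p / e) (by positivity : 0 ≤ p / e) (by ring)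
  simp only [smul_eq_mul, mul_zero, zero_add, hd0] at h
  rw [div_mul_cancel₀ _ he.ne'] at h
  calc d p ≤ _ := h
    _ = _ := by ring

lemma chord_ge {b : ℝ → ℝ} {U e p : ℝ} (hb : ConcaveOn ℝ (Icc 0 U) b) (hb0 : b 0 = 0) (he : 0 < e) (heU : e ≤ U)
    (hp : 0 ≤ p) (hpe : p ≤ e) : b e / e * p ≤ b p := by
  have h := chord_le hb.neg (by simp [hb0]) he heU hp hpe
  simp only [Pi.neg_apply, neg_div, neg_mul] at h
  linarith

section
variable {n : ℕ} [NeZero n] {J : Rn n → ℝ} {d b : ℝ → ℝ} {D B U τ β c lam d1 P M : ℝ}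
  {u w : ℝ → Rn n → ℝ}

lemma nq_pos (n : ℕ) [NeZero n] : 0 < (n : ℝ) / 2 := by
  have : 0 < (n : ℝ) := by exact_mod_cast Nat.pos_of_ne_zero (NeZero.ne n)
  positivity

lemma Setup.positivity (H : Setup J d b D B U τ β c lam d1 P M u w)
    (hdx : ConvexOn ℝ (Icc 0 U) d) (hbx : ConcaveOn ℝ (Icc 0 U) b)
    (hbd : ∀ p, 0 < p → p < U → d p < b p)
    (hv : ∀ s ∈ Icc (-τ) 0, Integrable (av u w s))
    {φ : ℝ → ℝ} (hφ : Monotone φ) (hφc : Continuous φ) (hwφ : ∀ t x, w t x = φ (x 0 + c * t))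
    (hlim : Tendsto φ atTop (nhds U)) :
    ∃ ε > 0, ε < U ∧ ∃ T ≥ τ, ∃ X, ∀ t ≥ T, ∀ x : Rn n, X ≤ x 0 + c * t → ε ≤ u t x := by
  have hU := H.S.U0
  have hτ := H.S.τ0
  have hc := H.c0
  have hcτ : 0 < c * τ := mul_pos hc hτ
  have hq := nq_pos n
  set e := U / 2 with he
  have he0 : 0 < e := by positivity
  have hbe := hbd e he0 (by rw [he]; linarith)
  have hde : 0 ≤ d e := by have := (H.S.hd 0 e he0.le).1; rw [H.S.d0] at this; linarith
  set bh := b e / e with hbh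
  set dh := d e / e with hdh
  have hdh0 : 0 ≤ dh := by positivity
  have hlt : dh < bh := by rw [hdh, hbh]; gcongr
  have hbU : 0 < b U := by have := (H.S.hb e U (by rw [he]; linarith)).1; linarith
  set δ := (bh - dh) / (1 + bh) with hδ
  have hδ0 : 0 < δ := div_pos (by linarith) (by linarith)
  have hδ1 : δ * (1 + bh) ≤ bh - dh := by
    rw [hδ, div_mul_cancel₀]; linarith
  obtain ⟨xa, hxa⟩ := (hlim.eventually (lt_mem_nhds hU)).exists
  obtain ⟨L1, hL1, hL1'⟩ := tail_ex H.S.kJ hδ0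
  obtain ⟨L2, hL2, hL2'⟩ := tail_ex H.S.kf hδ0
  set L := max L1 L2 with hL
  have hL0 : 0 ≤ L := hL1.trans (le_max_left _ _)
  set xb := xa + 1 + L + c * τ with hxb
  set T00 := max 1 (max (2 * τ) (4 * ((n : ℝ) / 2))) with hT00
  have hT01 : 1 ≤ T00 := le_max_left _ _
  have hT02 : 2 * τ ≤ T00 := (le_max_left _ _).trans (le_max_right _ _)
  have hT03 : 4 * ((n : ℝ) / 2) ≤ T00 := (le_max_right _ _).trans (le_max_right _ _)
  obtain ⟨C, hC, hW⟩ := H.Wb (by linarith) hT02 hT03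
  have hlim2 : Tendsto (fun t : ℝ => C * (T00 + t) ^ (-((n : ℝ) / 2)) * (1 + Real.exp (lam * xb))) atTop (nhds (C * 0 * (1 + Real.exp (lam * xb)))) :=
    (((tendsto_rpow_neg_atTop hq).comp (tendsto_atTop_add_const_left _ T00 tendsto_id)).const_mul C).mul_const _
  rw [mul_zero, zero_mul] at hlim2
  obtain ⟨T1, hT1⟩ := eventually_atTop.1 (hlim2.eventually (gt_mem_nhds (half_pos hxa)))
  set T := max T1 (2 * τ) with hT
  have hTT : 2 * τ ≤ T := le_max_right _ _
  obtain ⟨ε1, hε1, hini⟩ := ini_pos H.S H.β0 hc H.hu H.hw (κ := b U / U) (by positivity)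
    (fun p h1 h2 => chord_ge hbx H.S.b0 hU le_rfl h1 h2) hv hφ hφc hwφ hxa (xa - c * T)
  set ε := min e (min (φ xa / 2) (Real.exp (-((1 + D) * (T - τ))) * ε1)) with hε
  have hεe : ε ≤ e := min_le_left _ _
  have hε2 : ε ≤ φ xa / 2 := (min_le_right _ _).trans (min_le_left _ _)
  have hε3 : ε ≤ Real.exp (-((1 + D) * (T - τ))) * ε1 := (min_le_right _ _).trans (min_le_right _ _)
  have hε0 : 0 < ε := lt_min he0 (lt_min (half_pos hxa) (by positivity))
  refine ⟨ε, hε0, by rw [he] at hεe; linarith, T, by linarith, xa + 1, ?_⟩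
  refine pos_prop H.S H.hu hc hε0 (dh := dh) (bh := bh) (δ := δ) (L := L) (xb := xb)
    (fun p h1 h2 => chord_le hdx H.S.d0 he0 (by rw [he]; linarith) h1 (h2.trans hεe))
    (fun p h1 h2 => chord_ge hbx H.S.b0 he0 (by rw [he]; linarith) h1 (h2.trans hεe))
    (by linarith) hdh0 hδ1 (hL1' L (le_max_left _ _)) (hL2' L (le_max_right _ _)) le_rfl hL0 (by linarith) ?_ ?_
  · intro t ht x h1 h2
    have a1 := hW t (by linarith) x
    have a2 := hT1 t ((le_max_left _ _).trans ht)
    have a3 : Real.exp (lam * (x 0 + c * t)) ≤ Real.exp (lam * xb) := by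
      have := H.lam0; gcongr
    have a4 : 0 ≤ C * (T00 + t) ^ (-((n : ℝ) / 2)) := mul_nonneg hC.le (Real.rpow_nonneg (by linarith) _)
    have a5 : φ xa ≤ w t x := by rw [hwφ]; exact hφ h1
    have a6 := (abs_le.1 (le_refl (av u w t x))).1
    have a7 := mul_le_mul_of_nonneg_left (by linarith : 1 + Real.exp (lam * (x 0 + c * t)) ≤ 1 + Real.exp (lam * xb)) a4
    linarith
  · intro t ht x hx
    have a1 : ε1 ≤ u τ x := hini x (by
      have := mul_le_mul_of_nonneg_left ht.2 hc.le
      linarith)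
    have a2 := (ini_low H.S H.hu (κ := b U / U) (by positivity)
      (fun p h1 h2 => chord_ge hbx H.S.b0 hU le_rfl h1 h2) x).2 t (by linarith [ht.1])
    refine hε3.trans (le_trans ?_ a2)
    have hD := H.S.D0
    have a3 : Real.exp (-((1 + D) * (T - τ))) ≤ Real.exp (-((1 + D) * (t - τ))) := by
      apply Real.exp_le_exp.2
      have := mul_le_mul_of_nonneg_left ht.2 (by linarith : 0 ≤ 1 + D)
      linarith
    exact mul_le_mul a3 a1 hε1.le (Real.exp_pos _).le

lemma Setup.decay (H : Setup J d b D B U τ β c lam d1 P M u w)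
    (hdx : ConvexOn ℝ (Icc 0 U) d) (hbx : ConcaveOn ℝ (Icc 0 U) b)
    (hbd : ∀ p, 0 < p → p < U → d p < b p)
    (hv : ∀ s ∈ Icc (-τ) 0, Integrable (av u w s))
    {φ : ℝ → ℝ} (hφ : Monotone φ) (hφc : Continuous φ) (hwφ : ∀ t x, w t x = φ (x 0 + c * t))
    (hlim : Tendsto φ atTop (nhds U)) :
    ∃ C > 0, ∀ t ≥ 0, ∀ x : Rn n, |u t x - w t x| ≤ C * (1 + t) ^ (-((n : ℝ) / 2)) := by
  have hU := H.S.U0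
  have hτ := H.S.τ0
  have hc := H.c0
  have hB := H.B1
  have hcτ : 0 < c * τ := mul_pos hc hτ
  set q := (n : ℝ) / 2 with hq'
  have hq : 0 < q := nq_pos n
  obtain ⟨ε, hε, hεU, T, hT, X, hpos⟩ := H.positivity hdx hbx hbd hv hφ hφc hwφ hlim
  have hbde := hbd ε hε hεU
  have l1 : Tendsto (fun r => b (φ r) - d (φ r)) atTop (nhds (b U - d U)) :=
    ((H.S.bc.tendsto U).comp hlim).sub ((H.S.dc.tendsto U).comp hlim)
  rw [H.S.dbU, sub_self] at l1
  obtain ⟨x0, hx01, hx02⟩ := ((l1.eventually (gt_mem_nhds (by linarith : 0 < b ε - d ε))).and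
    (hlim.eventually (lt_mem_nhds hεU))).exists
  set φ0 := φ x0 with hφ0
  have hφ0U : φ0 ≤ U := by
    exact ge_of_tendsto hlim (by filter_upwards [eventually_ge_atTop x0] with r hr using hφ hr)
  set Ds := (d φ0 - d ε) / (φ0 - ε) with hDs
  set Bs := (b φ0 - b ε) / (φ0 - ε) with hBs
  have hDB : Bs < Ds := by
    rw [hDs, hBs]
    exact div_lt_div_of_pos_right (by linarith) (by linarith)
  have hBs0 : 0 ≤ Bs := div_nonneg (H.S.hb _ _ hx02.le).1 (by linarith)
  set δ := (Ds - Bs) / (2 * B) with hδ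
  have hδ0 : 0 < δ := div_pos (by linarith) (by linarith)
  have hA : Bs + B * δ < Ds := by
    have : B * δ = (Ds - Bs) / 2 := by rw [hδ]; field_simp
    rw [this]; linarith
  obtain ⟨T1, hT1⟩ := S_ex (q := q) (τ := τ) hA
  obtain ⟨L, hL, hL'⟩ := tail_ex H.S.kf hδ0
  set T0 := max (max T1 1) (max (2 * τ) (4 * q)) with hT0
  have hT0a : T1 ≤ T0 := (le_max_left _ _).trans (le_max_left _ _)
  have hT0b : 1 ≤ T0 := (le_max_right _ _).trans (le_max_left _ _)
  have hT0c : 2 * τ ≤ T0 := (le_max_left _ _).trans (le_max_right _ _)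
  have hT0d : 4 * q ≤ T0 := (le_max_right _ _).trans (le_max_right _ _)
  obtain ⟨C, hC, hW⟩ := H.Wb (by linarith) hT0c hT0d
  rw [← hq'] at hW
  set XX := max X x0 with hXX
  set x1 := XX + L + c * τ with hx1
  set T' := T + τ with hT'
  have hTp : 0 < T0 + T' := by linarith
  set Ms := C * (1 + Real.exp (lam * x1)) + U * (T0 + T') ^ q with hMs
  have hMs0 : 0 < Ms := by positivity
  have hSt : U ≤ Ms * (T0 + T') ^ (-q) := by
    have h1 : U = U * (T0 + T') ^ q * (T0 + T') ^ (-q) := by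
      rw [mul_assoc, ← Real.rpow_add hTp, add_neg_cancel, Real.rpow_zero, mul_one]
    calc U = U * (T0 + T') ^ q * (T0 + T') ^ (-q) := h1
      _ ≤ _ := by
        refine mul_le_mul_of_nonneg_right ?_ (Real.rpow_nonneg hTp.le _)
        have : 0 ≤ C * (1 + Real.exp (lam * x1)) := by positivity
        linarith
  have hmid : ∀ t ≥ T', ∀ x : Rn n, x 0 + c * t ≤ x1 → av u w t x ≤ Ms * (T0 + t) ^ (-q) := by
    intro t ht x hx
    have a1 := hW t (by linarith) x
    have a3 : Real.exp (lam * (x 0 + c * t)) ≤ Real.exp (lam * x1) := by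
      have := H.lam0; gcongr
    have a4 : 0 ≤ (T0 + t) ^ (-q) := Real.rpow_nonneg (by linarith) _
    have a5 : C * (1 + Real.exp (lam * (x 0 + c * t))) ≤ Ms := by
      have : 0 ≤ U * (T0 + T') ^ q := by positivity
      have := mul_le_mul_of_nonneg_left (by linarith : 1 + Real.exp (lam * (x 0 + c * t)) ≤ 1 + Real.exp (lam * x1)) hC.le
      linarith
    have := mul_le_mul_of_nonneg_right a5 a4
    linarith
  have hwlow : ∀ t, ∀ x : Rn n, XX ≤ x 0 + c * t → φ0 ≤ w t x := fun t x hx => by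
    rw [hwφ]; exact hφ ((le_max_right _ _).trans hx)
  have hulow : ∀ t ≥ T' - τ, ∀ x : Rn n, XX ≤ x 0 + c * t → ε ≤ u t x := fun t ht x hx =>
    hpos t (by linarith) x ((le_max_left _ _).trans hx)
  have k1 := fin_one H.S H.hu H.hw hc (X := XX) (x1 := x1) (T := T') (T0 := T0) (L := L) hq.le hMs0 (by linarith) hBs0 hδ0.le
    (fun t ht x hx hle => by
      have g1 := hwlow t x hx
      exact ⟨slope_ge hdx hε.le hx02 (by linarith) hle (by linarith) (H.hu.i.le t x),
        slope_le hbx hε.le hx02 (by linarith) hle (by linarith) (H.hu.i.le t x)⟩)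
    (hL' L le_rfl) le_rfl hL (by linarith) (by linarith) (fun s hs => hT1 s (by linarith)) hSt
    (fun t ht x hx => (le_abs_self _).trans (hmid t ht x hx))
  have k2 := fin_one H.S H.hw H.hu hc (X := XX) (x1 := x1) (T := T') (T0 := T0) (L := L) hq.le hMs0 (by linarith) hBs0 hδ0.le
    (fun t ht x hx hle => by
      have g1 := hwlow t x hx
      have g2 := hulow t ht x hx
      exact ⟨slope_ge hdx hε.le hx02 g2 hle g1 (H.hw.i.le t x),
        slope_le hbx hε.le hx02 g2 hle g1 (H.hw.i.le t x)⟩)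
    (hL' L le_rfl) le_rfl hL (by linarith) (by linarith) (fun s hs => hT1 s (by linarith)) hSt
    (fun t ht x hx => by
      have := neg_abs_le (u t x - w t x)
      have := hmid t ht x hx
      unfold av at this
      linarith)
  have hT'0 : 0 < 1 + T' := by linarith
  refine ⟨Ms + U * (1 + T') ^ q, by positivity, fun t ht x => ?_⟩
  have h1t : 0 < 1 + t := by linarith
  have hr : 0 ≤ (1 + t) ^ (-q) := Real.rpow_nonneg h1t.le _
  rcases le_total T' t with h | h
  · have a1 := k1 t h x
    have a2 := k2 t h x
    have a3 : (T0 + t) ^ (-q) ≤ (1 + t) ^ (-q) := Real.rpow_le_rpow_of_nonpos h1t (by linarith) (by linarith)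
    have a4 := mul_le_mul_of_nonneg_left a3 hMs0.le
    have a5 : 0 ≤ U * (1 + T') ^ q * (1 + t) ^ (-q) := by positivity
    exact abs_le.2 ⟨by linarith, by linarith⟩
  · have a1 : |u t x - w t x| ≤ U := H.av_In.le t x
    have a2 : (1 + T') ^ (-q) ≤ (1 + t) ^ (-q) := Real.rpow_le_rpow_of_nonpos h1t (by linarith) (by linarith)
    have a3 : U = U * (1 + T') ^ q * (1 + T') ^ (-q) := by
      rw [mul_assoc, ← Real.rpow_add hT'0, add_neg_cancel, Real.rpow_zero, mul_one]
    have a4 := mul_le_mul_of_nonneg_left a2 (by positivity : 0 ≤ U * (1 + T') ^ q)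
    have a5 : 0 ≤ Ms * (1 + t) ^ (-q) := by positivity
    linarith

end

lemma mono_der {g g' : ℝ → ℝ} {U : ℝ} (h : ∀ u ∈ Icc 0 U, HasDerivAt g (g' u) u)
    (h0 : ∀ u ∈ Icc 0 U, 0 ≤ g' u) : MonotoneOn g (Icc 0 U) := by
  refine monotoneOn_of_hasDerivWithinAt_nonneg (f' := g') (convex_Icc 0 U)
    (fun u hu => (h u hu).continuousAt.continuousWithinAt)
    (fun u hu => (h u (interior_subset hu)).hasDerivWithinAt) (fun u hu => h0 u (interior_subset hu))

lemma convex_der {g g' g'' : ℝ → ℝ} {U : ℝ} (h : ∀ u ∈ Icc 0 U, HasDerivAt g (g' u) u)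
    (h' : ∀ u ∈ Icc 0 U, HasDerivAt g' (g'' u) u)
    (h0 : ∀ u ∈ Icc 0 U, 0 ≤ g'' u) : ConvexOn ℝ (Icc 0 U) g := by
  refine MonotoneOn.convexOn_of_deriv (convex_Icc 0 U) (fun u hu => (h u hu).continuousAt.continuousWithinAt)
    (fun u hu => (h u (interior_subset hu)).differentiableAt.differentiableWithinAt) ?_
  intro x hx y hy hxy
  rw [(h x (interior_subset hx)).deriv, (h y (interior_subset hy)).deriv]
  exact mono_der h' h0 (interior_subset hx) (interior_subset hy) hxy

lemma slope_bd {g g' g'' : ℝ → ℝ} {U : ℝ} (hU : 0 < U) (h : ∀ u ∈ Icc 0 U, HasDerivAt g (g' u) u)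
    (h' : ∀ u ∈ Icc 0 U, HasDerivAt g' (g'' u) u)
    (h0 : ∀ u ∈ Icc 0 U, 0 ≤ g'' u) {p r : ℝ} (hp : 0 ≤ p) (hpr : p ≤ r) (hr : r ≤ U) :
    g' 0 * (r - p) ≤ g r - g p ∧ g r - g p ≤ g' U * (r - p) := by
  have hm := mono_der h' h0
  have i0 : (0:ℝ) ∈ Icc 0 U := ⟨le_rfl, hU.le⟩
  have iU : U ∈ Icc 0 U := ⟨hU.le, le_rfl⟩
  have ip : p ∈ Icc 0 U := ⟨hp, by linarith⟩
  have ir : r ∈ Icc 0 U := ⟨by linarith, hr⟩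
  have m1 : MonotoneOn (fun x => g x - g' 0 * x) (Icc 0 U) :=
    mono_der (g' := fun x => g' x - g' 0) (fun u hu => by
      have := (h u hu).sub ((hasDerivAt_id u).const_mul (g' 0))
      rw [mul_one] at this; exact this)
      (fun u hu => sub_nonneg.2 (hm i0 hu hu.1))
  have m2 : MonotoneOn (fun x => g' U * x - g x) (Icc 0 U) :=
    mono_der (g' := fun x => g' U - g' x) (fun u hu => by
      have := ((hasDerivAt_id u).const_mul (g' U)).sub (h u hu)
      rw [mul_one] at this; exact this)
      (fun u hu => sub_nonneg.2 (hm hu iU hu.2))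
  have a1 := m1 ip ir hpr
  have a2 := m2 ip ir hpr
  simp only at a1 a2
  constructor <;> linarith

/-- truncation -/
def clp (U y : ℝ) : ℝ := max 0 (min y U)

lemma clp_cont (U : ℝ) : Continuous (clp U) := by unfold clp; fun_prop

lemma clp_id {U y : ℝ} (h : y ∈ Icc 0 U) : clp U y = y := by
  unfold clp; rw [min_eq_left h.2, max_eq_right h.1]

lemma clp_mem {U : ℝ} (hU : 0 < U) (y : ℝ) : clp U y ∈ Icc 0 U :=
  ⟨le_max_left _ _, max_le hU.le (min_le_right _ _)⟩

lemma clp_mono {U p r : ℝ} (h : p ≤ r) : clp U p ≤ clp U r :=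
  max_le_max le_rfl (min_le_min h le_rfl)

lemma clp_lip {U p r : ℝ} (h : p ≤ r) : clp U r - clp U p ≤ r - p := by
  unfold clp
  rcases le_total p U with h1 | h1 <;> rcases le_total r U with h2 | h2 <;>
    rcases le_total p 0 with h3 | h3 <;> rcases le_total r 0 with h4 | h4 <;>
    rcases le_total U 0 with h5 | h5 <;> simp only [min_eq_left, min_eq_right, max_eq_left, max_eq_right, h1, h2, h3, h4, h5] <;> linarith

lemma bd_pos {d b : ℝ → ℝ} {d0 b0 U : ℝ} (hd : ConvexOn ℝ (Icc 0 U) d) (hb : ConcaveOn ℝ (Icc 0 U) b)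
    (h0 : d 0 = 0) (h0' : b 0 = 0) (hU : d U = b U)
    (hdd : HasDerivAt d d0 0) (hbd : HasDerivAt b b0 0) (hlt : d0 < b0) (p : ℝ) (hp : 0 < p) (hpU : p < U) :
    d p < b p := by
  have hg := hbd.sub hdd
  rw [hasDerivAt_iff_tendsto_slope] at hg
  have hg' := (hg.mono_left (nhdsWithin_mono 0 (fun x (hx : x ∈ Ioi (0:ℝ)) => (ne_of_gt hx : x ∈ ({0} : Set ℝ)ᶜ)))).eventually
    (lt_mem_nhds (sub_pos.2 hlt))
  obtain ⟨s, hs1, hs2⟩ := (hg'.and (Ioo_mem_nhdsGT hp)).exists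
  have hsg : 0 < b s - d s := by
    rw [slope_def_field] at hs1
    simp only [Pi.sub_apply, h0, h0', sub_zero] at hs1
    have := mul_pos hs1 hs2.1
    rwa [div_mul_cancel₀ _ hs2.1.ne'] at this
  have hc := hb.sub hd
  have iS : s ∈ Icc 0 U := ⟨hs2.1.le, by linarith [hs2.2]⟩
  have iU : U ∈ Icc 0 U := ⟨by linarith, le_rfl⟩
  have hUs : 0 < U - s := by linarith [hs2.2]
  have h := hc.2 iS iU (div_nonneg (by linarith) hUs.le : (0:ℝ) ≤ (U - p) / (U - s))
    (div_nonneg (by linarith [hs2.2]) hUs.le : 0 ≤ (p - s) / (U - s)) (by field_simp; ring)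
  simp only [smul_eq_mul, Pi.sub_apply, hU, sub_self, mul_zero, add_zero] at h
  have e : (U - p) / (U - s) * s + (p - s) / (U - s) * U = p := by field_simp; ring
  rw [e] at h
  have : 0 < (U - p) / (U - s) * (b s - d s) := mul_pos (div_pos (by linarith) hUs) hsg
  linarith


lemma clip_slope {g : ℝ → ℝ} {U A : ℝ} (hU : 0 < U) (hA : 0 ≤ A)
    (h : ∀ p r, 0 ≤ p → p ≤ r → r ≤ U → 0 ≤ g r - g p ∧ g r - g p ≤ A * (r - p)) (p r : ℝ) (hpr : p ≤ r) :
    0 ≤ g (clp U r) - g (clp U p) ∧ g (clp U r) - g (clp U p) ≤ A * (r - p) := by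
  have a := h (clp U p) (clp U r) (clp_mem hU p).1 (clp_mono hpr) (clp_mem hU r).2
  exact ⟨a.1, a.2.trans (mul_le_mul_of_nonneg_left (clp_lip hpr) hA)⟩

lemma clip_cont {g : ℝ → ℝ} {U : ℝ} (hU : 0 < U) (h : ContinuousOn g (Icc 0 U)) :
    Continuous fun y => g (clp U y) :=
  h.comp_continuous (clp_cont U) (clp_mem hU)

lemma wgt_pos (l a x : ℝ) : 0 < wgt l a x := by
  unfold wgt; split_ifs
  · exact Real.exp_pos _
  · exact one_pos

lemma wgt_ge {l a : ℝ} (hl : 0 < l) (x : ℝ) : 1 ≤ wgt l a x := by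
  unfold wgt; split_ifs with h
  · exact Real.one_le_exp (by nlinarith)
  · exact le_rfl

lemma wgt_ge' {l a : ℝ} (hl : 0 < l) (x : ℝ) : Real.exp (-l * (x - a)) ≤ wgt l a x := by
  unfold wgt; split_ifs with h
  · exact le_rfl
  · exact Real.exp_le_one_iff.2 (by push Not at h; nlinarith)

lemma wgt_meas (l a : ℝ) : Measurable (wgt l a) := by
  unfold wgt
  exact Measurable.ite measurableSet_Iic (by fun_prop) measurable_const

lemma HSobSqW_nn {n : ℕ} [NeZero n] (l a : ℝ) (m : ℕ) (f : Rn n → ℝ) : 0 ≤ HSobSqW (wgt l a) m f :=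
  Finset.sum_nonneg fun _ _ => integral_nonneg fun _ => mul_nonneg (wgt_pos _ _ _).le (sq_nonneg _)

lemma wave_sol {n : ℕ} [NeZero n] {d b : ℝ → ℝ} {U τ β c : ℝ} (hβ : 0 < β)
    {J₁ : Fin n → ℝ → ℝ} {J : Rn n → ℝ}
    (hJprod : ∀ x : Rn n, J x = ∏ i, J₁ i (x i)) (hJunit : ∀ i, (∫ y : ℝ, J₁ i y) = 1)
    {φ φd : ℝ → ℝ} (hphid : ∀ ξ : ℝ, HasDerivAt φ (φd ξ) ξ)
    (h0 : ∀ ξ, φ ξ ∈ Icc 0 U)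
    (hTW : ∀ ξ : ℝ, c * φd ξ - (∫ y : ℝ, J₁ 0 (ξ - y) * φ y) + φ ξ + d (φ ξ)
        = ∫ y : ℝ, heatKernel1 β y * b (φ (ξ - y - c * τ))) :
    Sol J (heatKernel n β) d b U τ (fun t x => φ (x 0 + c * t)) where
  i := by
    refine ⟨?_, fun t x => (h0 _).1, fun t x => (h0 _).2⟩
    have hc : Continuous φ := continuous_iff_continuousAt.2 fun ξ => (hphid ξ).continuousAt
    unfold Function.uncurry
    fun_prop
  e t ht x := by
    have h1 : HasDerivAt (fun t => φ (x 0 + c * t)) (φd (x 0 + c * t) * c) t :=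
      (hphid (x 0 + c * t)).comp t (by simpa using ((hasDerivAt_id t).const_mul c).const_add (x 0))
    convert h1 using 1
    have e1 : cv J (fun x : Rn n => φ (x 0 + c * t)) x = ∫ y : ℝ, J₁ 0 (x 0 + c * t - y) * φ y := by
      unfold cv
      simp only [hJprod, PiLp.sub_apply]
      rw [marginal J₁ hJunit (fun s => φ (x 0 - s + c * t)),
        ← integral_sub_left_eq_self (fun y => J₁ 0 (x 0 + c * t - y) * φ y) volume (x 0 + c * t)]
      congr 1; ext y
      rw [sub_sub_cancel]; congr 2; ring
    have e2 : cv (heatKernel n β) (fun y : Rn n => b (φ (y 0 + c * (t - τ)))) x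
        = ∫ y : ℝ, heatKernel1 β y * b (φ (x 0 + c * t - y - c * τ)) := by
      unfold cv
      simp only [hk_prod n hβ, PiLp.sub_apply]
      rw [marginal (fun _ => heatKernel1 β) (fun _ => hk1_mass hβ) (fun s => b (φ (x 0 - s + c * (t - τ))))]
      congr 1; ext y
      congr 3; ring
    rw [e1, e2, ← hTW]
    ring

/-- global algebraic stability of critical planar traveling waves,
`c = c*`, with time-delay `τ > 0`. -/
theorem stability_critical_delay {n : ℕ} [NeZero n]
    (d b d' b' d'' b'' : ℝ → ℝ) (uplus : ℝ)
    -- (H1)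
    (huplus : 0 < uplus) (hd0 : d 0 = 0) (hb0 : b 0 = 0) (hdbu : d uplus = b uplus)
    (hd'def : ∀ u ∈ Set.Icc 0 uplus, HasDerivAt d (d' u) u)
    (hb'def : ∀ u ∈ Set.Icc 0 uplus, HasDerivAt b (b' u) u)
    (hd''def : ∀ u ∈ Set.Icc 0 uplus, HasDerivAt d' (d'' u) u)
    (hb''def : ∀ u ∈ Set.Icc 0 uplus, HasDerivAt b' (b'' u) u)
    (hd''cont : ContinuousOn d'' (Set.Icc 0 uplus))
    (hb''cont : ContinuousOn b'' (Set.Icc 0 uplus))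
    -- (H2)
    (h2a : d' 0 < b' 0) (h2b : 0 ≤ d' 0) (h2c : 0 ≤ b' uplus) (h2d : b' uplus < d' uplus)
    -- (H3)
    (h3 : ∀ u ∈ Set.Icc 0 uplus, 0 ≤ d' u ∧ 0 ≤ b' u ∧ 0 ≤ d'' u ∧ b'' u ≤ 0)
    -- (J1): J is a product of smooth, even, nonnegative, unit-mass 1-D kernels
    (J₁ : Fin n → ℝ → ℝ) (J : Rn n → ℝ)
    (hJprod : ∀ x : Rn n, J x = ∏ i, J₁ i (x i))
    (hJsmooth : ∀ i, ContDiff ℝ (⊤ : ℕ∞) (J₁ i))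
    (hJeven : ∀ i, ∀ y : ℝ, J₁ i (-y) = J₁ i y)
    (hJpos : ∀ i, ∀ y : ℝ, 0 ≤ J₁ i y)
    (hJunit : ∀ i, (∫ y : ℝ, J₁ i y) = 1)
    -- (J2): Ĵ(ξ) = 1 - 𝒦|ξ|^α + o(|ξ|^α) as ξ → 0
    (Kcal alpha : ℝ) (hK : 0 < Kcal) (hal : 0 < alpha) (hal2 : alpha ≤ 2)
    (hJ2 : (fun ξ : Rn n => (FT J ξ).re - (1 - Kcal * ‖ξ‖ ^ alpha))
        =o[nhds 0] fun ξ : Rn n => ‖ξ‖ ^ alpha)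
    (hJ1exp : ∀ lam > (0 : ℝ), Integrable (fun y : ℝ => J₁ 0 y * Real.exp (-lam * y)))
    (τ β : ℝ) (hτ : 0 < τ) (hβ : 0 < β)
    (cstar lamstar : ℝ) (hcstar : 0 < cstar) (hlamstar : 0 < lamstar)
    (htan : (b' 0 * Real.exp (β * lamstar ^ 2 - lamstar * cstar * τ)) = (cstar * lamstar - ((∫ y : ℝ, J₁ 0 y * Real.exp (-lamstar * y)) - 1) + d' 0))
    (htan' : ∃ slope : ℝ,
      HasDerivAt (fun lam => b' 0 * Real.exp (β * lam ^ 2 - lam * cstar * τ)) slope lamstar ∧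
      HasDerivAt (fun lam =>
        cstar * lam - ((∫ y : ℝ, J₁ 0 y * Real.exp (-lam * y)) - 1) + d' 0) slope lamstar)
    (φ φd : ℝ → ℝ) (hmono : Monotone φ)
    (hphid : ∀ ξ : ℝ, HasDerivAt φ (φd ξ) ξ) (hphidcont : Continuous φd)
    (hlim0 : Filter.Tendsto φ Filter.atBot (nhds 0))
    (hlimup : Filter.Tendsto φ Filter.atTop (nhds uplus))
    (hTW : ∀ ξ : ℝ, cstar * φd ξ - (∫ y : ℝ, J₁ 0 (ξ - y) * φ y) + φ ξ + d (φ ξ)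
        = ∫ y : ℝ, heatKernel1 β y * b (φ (ξ - y - cstar * τ)))
    (xstar : ℝ) (hxstar : 0 < xstar)
    (hxstar1 : 0 < d' (φ xstar)
        - ∫ y : Rn n, heatKernel n β y * b' (φ (xstar - y 0 - cstar * τ)))
    (hxstar2 : d' (φ xstar)
        - (∫ y : Rn n, heatKernel n β y * b' (φ (xstar - y 0 - cstar * τ)))
      < d' uplus - b' uplus)
    (m : ℕ) (hm : (n : ℝ) / 2 < (m : ℝ))
    (u₀ u₀s : ℝ → Rn n → ℝ)
    (hu₀bd : ∀ s ∈ Set.Icc (-τ) 0, ∀ x : Rn n, 0 ≤ u₀ s x ∧ u₀ s x ≤ uplus)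
    -- u₀ - φ ∈ C([-τ,0]; H^m_w(ℝⁿ) ∩ L¹_w(ℝⁿ))
    (hu₀cont : ContinuousOn (fun p : ℝ × Rn n => u₀ p.1 p.2 - φ (p.2 0 + cstar * p.1))
      (Set.Icc (-τ) 0 ×ˢ Set.univ))
    (hu₀L1w : ∀ s ∈ Set.Icc (-τ) 0,
      Integrable (fun x : Rn n => wgt lamstar xstar (x 0) * |u₀ s x - φ (x 0 + cstar * s)|))
    (hu₀Hmw : ∀ s ∈ Set.Icc (-τ) 0, ∀ j : Fin n → Fin (m + 1), (∑ i, (j i : ℕ)) ≤ m →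
      Integrable (fun x : Rn n => wgt lamstar xstar (x 0)
        * (mpd (fun i => (j i : ℕ)) (fun x : Rn n => u₀ s x - φ (x 0 + cstar * s)) x) ^ 2))
    -- ∂ₛ(u₀ - φ) ∈ L¹([-τ,0]; H^m_w(ℝⁿ) ∩ L¹_w(ℝⁿ))
    (hu₀s : ∀ s ∈ Set.Icc (-τ) 0, ∀ x : Rn n,
      HasDerivAt (fun s => u₀ s x - φ (x 0 + cstar * s)) (u₀s s x) s)
    (hu₀sL1w : ∀ s ∈ Set.Icc (-τ) 0,
      Integrable (fun x : Rn n => wgt lamstar xstar (x 0) * |u₀s s x|))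
    (hu₀sHmw : ∀ s ∈ Set.Icc (-τ) 0, ∀ j : Fin n → Fin (m + 1), (∑ i, (j i : ℕ)) ≤ m →
      Integrable (fun x : Rn n => wgt lamstar xstar (x 0)
        * (mpd (fun i => (j i : ℕ)) (u₀s s) x) ^ 2))
    (hu₀sInt : IntegrableOn
      (fun s => (∫ x : Rn n, wgt lamstar xstar (x 0) * |u₀s s x|)
        + (HSobSqW (wgt lamstar xstar) m (u₀s s)) ^ ((1 : ℝ) / 2))
      (Set.Icc (-τ) 0))
 :
    ∃ u ut : ℝ → Rn n → ℝ,
      (ContinuousOn (fun p : ℝ × Rn n => u p.1 p.2) (Set.Ici (-τ) ×ˢ Set.univ) ∧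
      (∀ s ∈ Set.Icc (-τ) 0, ∀ x : Rn n, u s x = u₀ s x) ∧
      (∀ x : Rn n, ContinuousOn (fun t => ut t x) (Set.Ioi 0)) ∧
      (∀ t > (0 : ℝ), ∀ x : Rn n, HasDerivAt (fun t => u t x) (ut t x) t) ∧
      (∀ t > (0 : ℝ), ∀ x : Rn n,
        ut t x - (∫ y : Rn n, J (x - y) * u t y) + u t x + d (u t x)
          = ∫ y : Rn n, heatKernel n β y * b (u (t - τ) (x - y))) ∧
      (∀ t ≥ (0 : ℝ), ∀ x : Rn n, 0 ≤ u t x ∧ u t x ≤ uplus)) ∧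
      (∀ u' ut' : ℝ → Rn n → ℝ,
        (ContinuousOn (fun p : ℝ × Rn n => u' p.1 p.2) (Set.Ici (-τ) ×ˢ Set.univ) ∧
      (∀ s ∈ Set.Icc (-τ) 0, ∀ x : Rn n, u' s x = u₀ s x) ∧
      (∀ x : Rn n, ContinuousOn (fun t => ut' t x) (Set.Ioi 0)) ∧
      (∀ t > (0 : ℝ), ∀ x : Rn n, HasDerivAt (fun t => u' t x) (ut' t x) t) ∧
      (∀ t > (0 : ℝ), ∀ x : Rn n,
        ut' t x - (∫ y : Rn n, J (x - y) * u' t y) + u' t x + d (u' t x)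
          = ∫ y : Rn n, heatKernel n β y * b (u' (t - τ) (x - y))) ∧
      (∀ t ≥ (0 : ℝ), ∀ x : Rn n, 0 ≤ u' t x ∧ u' t x ≤ uplus)) →
        ∀ t ≥ -τ, ∀ x : Rn n, u' t x = u t x) ∧
      ∃ C > (0 : ℝ), ∀ t > (0 : ℝ), ∀ x : Rn n,
        |u t x - φ (x 0 + cstar * t)| ≤ C * (1 + t) ^ (-((n : ℝ) / alpha)) := by
  have i0 : (0:ℝ) ∈ Icc 0 uplus := ⟨le_rfl, huplus.le⟩
  have iU : uplus ∈ Icc 0 uplus := ⟨huplus.le, le_rfl⟩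
  have hb0' : 0 < b' 0 := lt_of_le_of_lt h2b h2a
  have hdmono := mono_der hd'def (fun u hu => (h3 u hu).1)
  have hbmono := mono_der hb'def (fun u hu => (h3 u hu).2.1)
  have hd'm := mono_der hd''def (fun u hu => (h3 u hu).2.2.1)
  have hconv : ConvexOn ℝ (Icc 0 uplus) d := convex_der hd'def hd''def (fun u hu => (h3 u hu).2.2.1)
  have hnb1 : ∀ u ∈ Icc 0 uplus, HasDerivAt (fun y => -b y) (-b' u) u := fun u hu => (hb'def u hu).neg
  have hnb2 : ∀ u ∈ Icc 0 uplus, HasDerivAt (fun y => -b' y) (-b'' u) u := fun u hu => (hb''def u hu).neg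
  have hnb3 : ∀ u ∈ Icc 0 uplus, 0 ≤ -b'' u := fun u hu => neg_nonneg.2 (h3 u hu).2.2.2
  have hconc : ConcaveOn ℝ (Icc 0 uplus) b := by
    have := convex_der (g' := fun y => -b' y) (g'' := fun y => -b'' y) hnb1 hnb2 hnb3
    exact neg_convexOn_iff.1 this
  have hbd := bd_pos hconv hconc hd0 hb0 hdbu (hd'def 0 i0) (hb'def 0 i0) h2a
  have sd := fun p r hp hpr hr => slope_bd (p := p) (r := r) huplus hd'def hd''def (fun u hu => (h3 u hu).2.2.1) hp hpr hr
  have sb := fun p r hp hpr hr => slope_bd (g := fun y => -b y) (g' := fun y => -b' y) (g'' := fun y => -b'' y)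
    (p := p) (r := r) huplus hnb1 hnb2 hnb3 hp hpr hr
  have hD0 : 0 ≤ d' uplus := (h3 _ iU).1
  set dc : ℝ → ℝ := fun y => d (clp uplus y) with hdc
  set bc : ℝ → ℝ := fun y => b (clp uplus y) with hbc
  have dce : ∀ y ∈ Icc 0 uplus, dc y = d y := fun y hy => by simp only [hdc, clp_id hy]
  have bce : ∀ y ∈ Icc 0 uplus, bc y = b y := fun y hy => by simp only [hbc, clp_id hy]
  have hJint : ∀ i, Integrable (J₁ i) := fun i => int_of_mass (hJunit i)
  have hJf : J = fun x : Rn n => ∏ i, J₁ i (x i) := funext hJprod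
  have kJ : Kern J := by
    refine ⟨fun y => ?_, ?_, ?_⟩
    · rw [hJprod]; exact Finset.prod_nonneg fun i _ => hJpos i _
    · rw [hJf]; exact marg_int _ hJint
    · rw [hJf, marg_eq]; simp [hJunit]
  have S : Sys J (heatKernel n β) dc bc (d' uplus) (b' 0) uplus τ := by
    refine ⟨kJ, hk_kern n hβ, hD0, hb0'.le, huplus, hτ, ?_, ?_, ?_, ?_, ?_, ?_, ?_⟩
    · refine clip_slope huplus hD0 fun p r hp hpr hr => ⟨?_, (sd p r hp hpr hr).2⟩
      exact sub_nonneg.2 (hdmono ⟨hp, by linarith⟩ ⟨by linarith, hr⟩ hpr)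
    · refine clip_slope huplus hb0'.le fun p r hp hpr hr => ⟨?_, ?_⟩
      · exact sub_nonneg.2 (hbmono ⟨hp, by linarith⟩ ⟨by linarith, hr⟩ hpr)
      · have := (sb p r hp hpr hr).1
        linarith
    · rw [dce 0 i0, hd0]
    · rw [bce 0 i0, hb0]
    · rw [dce _ iU, bce _ iU, hdbu]
    · exact clip_cont huplus fun u hu => (hd'def u hu).continuousAt.continuousWithinAt
    · exact clip_cont huplus fun u hu => (hb'def u hu).continuousAt.continuousWithinAt
  have hφI : ∀ ξ, φ ξ ∈ Icc 0 uplus := fun ξ => ⟨hmono.le_of_tendsto hlim0 ξ, hmono.ge_of_tendsto hlimup ξ⟩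
  have hφc : Continuous φ := continuous_iff_continuousAt.2 fun ξ => (hphid ξ).continuousAt
  have hw : Sol J (heatKernel n β) dc bc uplus τ (fun t x => φ (x 0 + cstar * t)) := by
    refine wave_sol hβ hJprod hJunit hphid hφI fun ξ => ?_
    rw [dce _ (hφI ξ), hTW]
    congr 1; ext y
    rw [bce _ (hφI _)]
  -- initial data
  set u0 : ℝ → Rn n → ℝ := fun t x => u₀ (max (-τ) (min t 0)) x with hu0
  have hcl : ∀ t : ℝ, max (-τ) (min t 0) ∈ Icc (-τ) 0 := fun t =>
    ⟨le_max_left _ _, max_le (by linarith) (min_le_right _ _)⟩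
  have h0In : In uplus u0 := by
    refine ⟨?_, fun t x => (hu₀bd _ (hcl t) x).1, fun t x => (hu₀bd _ (hcl t) x).2⟩
    have q : Continuous fun p : ℝ × Rn n => (max (-τ) (min p.1 0), p.2) := by fun_prop
    have h1 := hu₀cont.comp_continuous q fun p => ⟨hcl p.1, mem_univ _⟩
    have h2 : Continuous fun p : ℝ × Rn n => φ (p.2 0 + cstar * (max (-τ) (min p.1 0))) := by fun_prop
    have h3' := h1.add h2
    refine h3'.congr fun p => ?_
    simp [hu0, Function.uncurry]
  obtain ⟨u, huI, hue, hud⟩ := S.exist h0In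
  have huS : Sol J (heatKernel n β) dc bc uplus τ u := ⟨huI, hud⟩
  have hu00 : ∀ s ∈ Icc (-τ) 0, ∀ x, u s x = u₀ s x := by
    intro s hs x
    rw [hue s hs.2 x]
    simp only [hu0]
    rw [min_eq_left hs.2, max_eq_right hs.1]
  have huIc : ∀ t x, u t x ∈ Icc 0 uplus := fun t x => ⟨huI.nn t x, huI.le t x⟩
  -- the weighted bound
  obtain ⟨M, hM⟩ := wL1 (n := n) (v := fun s x => u₀ s x - φ (x 0 + cstar * s)) (vs := u₀s) hτ
    (w := fun x => wgt lamstar xstar (x 0)) ((wgt_meas _ _).comp (by fun_prop)) (fun x => wgt_pos _ _ _)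
    hu₀cont hu₀s (hu₀L1w 0 ⟨by linarith, le_rfl⟩) hu₀sL1w
    (h := fun s => (HSobSqW (wgt lamstar xstar) m (u₀s s)) ^ ((1 : ℝ) / 2))
    (fun s => Real.rpow_nonneg (HSobSqW_nn _ _ _ _) _) hu₀sInt
  set K : ℝ := Real.exp (-lamstar * xstar + lamstar * cstar * τ) with hKd
  have hKpos : 0 < K := Real.exp_pos _
  have hmeas : ∀ s, Continuous fun x : Rn n => |u s x - φ (x 0 + cstar * s)| := fun s =>
    ((uc_x huI.c s).sub (by fun_prop)).abs
  have hpt : ∀ s ∈ Icc (-τ) 0, ∀ x : Rn n, Real.exp (-lamstar * (x 0 + cstar * s)) * |u s x - φ (x 0 + cstar * s)|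
      ≤ K * (wgt lamstar xstar (x 0) * |u₀ s x - φ (x 0 + cstar * s)|) := by
    intro s hs x
    rw [hu00 s hs x, ← mul_assoc]
    refine mul_le_mul_of_nonneg_right ?_ (abs_nonneg _)
    refine le_trans ?_ (mul_le_mul_of_nonneg_left (wgt_ge' (a := xstar) hlamstar (x 0)) hKpos.le)
    rw [hKd, ← Real.exp_add]
    apply Real.exp_le_exp.2
    have := mul_le_mul_of_nonneg_left hs.1 (mul_pos hlamstar hcstar).le
    nlinarith
  have hMi : ∀ s ∈ Icc (-τ) 0, Integrable fun x : Rn n =>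
      Real.exp (-lamstar * (x 0 + cstar * s)) * |u s x - φ (x 0 + cstar * s)| := by
    intro s hs
    refine ((hu₀L1w s hs).const_mul K).mono' ?_ (Eventually.of_forall fun x => ?_)
    · have := hmeas s
      exact Continuous.aestronglyMeasurable (by fun_prop)
    · rw [Real.norm_of_nonneg (mul_nonneg (Real.exp_pos _).le (abs_nonneg _))]
      exact hpt s hs x
  have hv : ∀ s ∈ Icc (-τ) 0, Integrable (av u (fun t x => φ (x 0 + cstar * t)) s) := by
    intro s hs
    refine (hu₀L1w s hs).mono' (hmeas s).aestronglyMeasurable (Eventually.of_forall fun x => ?_)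
    unfold av
    rw [Real.norm_of_nonneg (abs_nonneg _), hu00 s hs x]
    exact le_mul_of_one_le_left (abs_nonneg _) (wgt_ge hlamstar _)
  have H : Setup J dc bc (d' uplus) (b' 0) uplus τ β cstar lamstar (d' 0)
      (∫ y : ℝ, J₁ 0 y * Real.exp (-lamstar * y)) (K * |M| + 1) u (fun t x => φ (x 0 + cstar * t)) := by
    refine ⟨S, hβ, hcstar, hlamstar, hb0', h2b, hd'm i0 iU huplus.le, ?_, ?_, ?_, ?_, huS, hw, by positivity,
      hMi, ?_⟩
    · intro p r hp hpr hr
      rw [dce p ⟨hp, by linarith⟩, dce r ⟨by linarith, hr⟩]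
      exact (sd p r hp hpr hr).1
    · rw [hJf]
      exact marginal_int J₁ hJint (fun y => Real.exp (-lamstar * y)) (hJ1exp lamstar hlamstar)
    · rw [hJf]
      exact marginal J₁ hJunit (fun y => Real.exp (-lamstar * y))
    · linarith
    · intro s hs
      have h1 := integral_mono (hMi s hs) ((hu₀L1w s hs).const_mul K) (hpt s hs)
      rw [integral_const_mul] at h1
      have h2 := mul_le_mul_of_nonneg_left ((hM s hs (hu₀L1w s hs)).trans (le_abs_self M)) hKpos.le
      linarith
  obtain ⟨C, hC, hdec⟩ := H.decay (hconv.congr fun y hy => (dce y hy).symm)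
    (hconc.congr fun y hy => (bce y hy).symm)
    (fun p hp hpU => by
      rw [dce p ⟨hp.le, hpU.le⟩, bce p ⟨hp.le, hpU.le⟩]; exact hbd p hp hpU)
    hv hmono hφc (fun t x => rfl) hlimup
  have hα := alpha_ge J₁ J hJprod hJeven hJpos hJunit Kcal alpha hK hal hJ2 hJ1exp
  refine ⟨u, fun t x => cv J (u t) x - u t x - dc (u t x) + cv (heatKernel n β) (fun y => bc (u (t - τ) y)) x,
    ⟨huI.c.continuousOn, hu00, ?_, hud, ?_, fun t _ x => huIc t x⟩, ?_, C, hC, ?_⟩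
  · intro x
    have c1 := uc_t (cv_cont kJ.int huI.c (M := uplus) (fun t x => by
      rw [abs_of_nonneg (huI.nn t x)]; exact huI.le t x)) x
    have c2 : Continuous (Function.uncurry fun t (y : Rn n) => bc (u (t - τ) y)) :=
      S.bc.comp (huI.c.comp (by fun_prop : Continuous fun p : ℝ × Rn n => (p.1 - τ, p.2)))
    have c3 := uc_t (cv_cont (hk_kern n hβ).int c2 (M := bc uplus) (fun t y => by
      have e1 := (S.hb 0 _ (huI.nn (t - τ) y)).1
      have e2 := (S.hb _ _ (huI.le (t - τ) y)).1
      rw [S.b0] at e1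
      rw [abs_of_nonneg (by linarith)]; linarith)) x
    have c4 := S.dc.comp (uc_t huI.c x)
    exact (((c1.sub (uc_t huI.c x)).sub c4).add c3).continuousOn
  · intro t ht x
    rw [cv_eq]
    simp only [dce _ (huIc t x)]
    simp only [bce _ (huIc _ _)]
    unfold cv
    ring
  · rintro u' ut' ⟨hc', hi', -, hd1', he', hb1'⟩ t ht x
    have hIc' : ∀ t ≥ -τ, ∀ x, u' t x ∈ Icc 0 uplus := by
      intro t ht x
      rcases le_total t 0 with h | h
      · rw [hi' t ⟨ht, h⟩ x]; exact hu₀bd t ⟨ht, h⟩ x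
      · exact hb1' t h x
    have hSu : Sol J (heatKernel n β) dc bc uplus τ (fun t x => u' (max t (-τ)) x) := by
      refine ⟨⟨?_, fun t x => (hIc' _ (le_max_right _ _) x).1, fun t x => (hIc' _ (le_max_right _ _) x).2⟩, ?_⟩
      · have q : Continuous fun p : ℝ × Rn n => (max p.1 (-τ), p.2) := by fun_prop
        exact hc'.comp_continuous q fun p => ⟨mem_Ici.2 (le_max_right _ _), mem_univ _⟩
      · intro t ht x
        have m1 : max t (-τ) = t := max_eq_left (by linarith)
        have m2 : max (t - τ) (-τ) = t - τ := max_eq_left (by linarith)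
        have hh := hd1' t ht x
        have hE := he' t ht x
        rw [cv_eq] at hE
        have : HasDerivAt (fun t => u' (max t (-τ)) x) (ut' t x) t := by
          refine hh.congr_of_eventuallyEq ?_
          filter_upwards [lt_mem_nhds ht] with s hs
          rw [max_eq_left (by linarith)]
        convert this using 1
        rw [m1, m2, dce _ (hIc' t (by linarith) x)]
        simp only [bce _ (hIc' (t - τ) (by linarith) _)]
        unfold cv at hE ⊢
        linarith
    have := S.uniq hSu huS (fun t ht x => by
      show u' (max t (-τ)) x = u t x
      rw [max_eq_left ht.1, hi' t ht x, hu00 t ht x]) t ht x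
    rwa [max_eq_left ht] at this
  · intro t ht x
    refine (hdec t ht.le x).trans (mul_le_mul_of_nonneg_left ?_ hC.le)
    apply Real.rpow_le_rpow_of_exponent_le (by linarith)
    apply neg_le_neg
    exact div_le_div_of_nonneg_left (Nat.cast_nonneg n) two_pos hα

end
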